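/- Let φ ∈ C^∞(ℝ^n_y × ℝ^n_ξ) be real-valued with |det ∂_y∂_ξ φ(y,ξ)| ≥ C₀ > 0 for all (y,ξ), and with every entry h of ∂_y∂_ξ φ satisfying |∂_y^α h| ≤ C_α and |∂_ξ^β h| ≤ C_β for all |α|, |β| ≤ 2n+1. Let 2 ≤ p < ∞ and let a ∈ C^∞(ℝ^n_x × ℝ^n_ξ) satisfy ∂_x^α ∂_ξ^β a ∈ L^p(ℝ^n_x × ℝ^n_ξ) for all multi-indices with |α|, |β| ≤ ⌊n(1/2 − 1/p)⌋ + 1, and assume a(x,ξ) = 0 whenever ξ lies outside some compact set K. Then the operator Tu(x) = ∫∫ e^{i(x·ξ + φ(y,ξ))} a(x,ξ) u(y) dy dξ, defined for Schwartz u, satisfies ‖Tu‖_{L²(ℝ^n)} ≤ C ‖u‖_{L²(ℝ^n)}, where C depends only on n, p, C₀, the phase constants, and the listed L^p norms of derivatives of a, and is independent of K. -/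

import Mathlib

open MeasureTheory Complex SchwartzMap
open scoped BigOperators ENNReal Real RealInnerProductSpace

noncomputable section

/-- The derivative of `g` along the direction `v`. -/
def dLine {W F : Type*} [NormedAddCommGroup W] [NormedSpace ℝ W]
    [NormedAddCommGroup F] [NormedSpace ℝ F] (v : W) (g : W → F) : W → F :=
  fun z => fderiv ℝ g z v

/-- The iterated partial derivative `∂^α` along the coordinate directions `dirs`,
with multiplicities given by the multi-index `α`. -/
def mderiv {n : ℕ} {W F : Type*} [NormedAddCommGroup W] [NormedSpace ℝ W]
    [NormedAddCommGroup F] [NormedSpace ℝ F]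
    (dirs : Fin n → W) (α : Fin n → ℕ) (g : W → F) : W → F :=
  ((List.ofFn fun i => (dLine (dirs i) (F := F))^[α i]).foldr (· ∘ ·) id) g

/-- The length `|α|` of a multi-index. -/
def mdeg {n : ℕ} (α : Fin n → ℕ) : ℕ := ∑ i, α i

/-- The first-factor coordinate directions in `ℝ^n × ℝ^n`. -/
def dX {n : ℕ} (i : Fin n) : EuclideanSpace ℝ (Fin n) × EuclideanSpace ℝ (Fin n) :=
  (EuclideanSpace.single i 1, 0)

/-- The second-factor coordinate directions in `ℝ^n × ℝ^n`. -/
def dY {n : ℕ} (j : Fin n) : EuclideanSpace ℝ (Fin n) × EuclideanSpace ℝ (Fin n) :=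
  (0, EuclideanSpace.single j 1)

/-- The entry `∂²φ/∂u_i∂v_j` of the mixed Hessian of a function of two `ℝ^n` variables. -/
def mixedHessXY {n : ℕ}
    (φ : EuclideanSpace ℝ (Fin n) × EuclideanSpace ℝ (Fin n) → ℝ) (i j : Fin n) :
    EuclideanSpace ℝ (Fin n) × EuclideanSpace ℝ (Fin n) → ℝ :=
  dLine (dX i) (dLine (dY j) φ)

/-! ### Directional derivatives -/

section Deriv
variable {W F : Type*} [NormedAddCommGroup W] [NormedSpace ℝ W]
    [NormedAddCommGroup F] [NormedSpace ℝ F]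

lemma dLine_contDiff {g : W → F} (hg : ContDiff ℝ (⊤ : ℕ∞) g) (v : W) :
    ContDiff ℝ (⊤ : ℕ∞) (dLine v g) := by
  unfold dLine
  exact (hg.fderiv_right (m := (⊤ : ℕ∞)) (by simp)).clm_apply contDiff_const

lemma smooth_diff {g : W → F} (hg : ContDiff ℝ (⊤ : ℕ∞) g) : Differentiable ℝ g :=
  hg.differentiable (by simp)

lemma dLine_comm {g : W → F} (hg : ContDiff ℝ (⊤ : ℕ∞) g) (v w : W) :
    dLine v (dLine w g) = dLine w (dLine v g) := by
  have hd : Differentiable ℝ (fderiv ℝ g) :=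
    (hg.fderiv_right (m := (⊤ : ℕ∞)) (by simp)).differentiable (by simp)
  funext z
  unfold dLine
  rw [fderiv_clm_apply (hd z) (differentiableAt_const _),
    fderiv_clm_apply (hd z) (differentiableAt_const _)]
  simp only [fderiv_fun_const, Pi.zero_apply, ContinuousLinearMap.comp_zero, zero_add,
    ContinuousLinearMap.flip_apply]
  have : IsSymmSndFDerivAt ℝ g z :=
    (hg.contDiffAt (x := z)).isSymmSndFDerivAt
      (by simp only [minSmoothness_of_isRCLikeNormedField]
          exact WithTop.coe_le_coe.2 (le_top : (2 : ℕ∞) ≤ ⊤))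
  exact this v w

lemma dLine_add {f g : W → F} (hf : Differentiable ℝ f) (hg : Differentiable ℝ g) (v : W) :
    dLine v (fun z => f z + g z) = fun z => dLine v f z + dLine v g z := by
  funext z; simp [dLine, fderiv_fun_add (hf z) (hg z)]

lemma dLine_sub {f g : W → F} (hf : Differentiable ℝ f) (hg : Differentiable ℝ g) (v : W) :
    dLine v (fun z => f z - g z) = fun z => dLine v f z - dLine v g z := by
  funext z; simp [dLine, fderiv_fun_sub (hf z) (hg z)]

lemma dLine_sum {ι : Type*} (s : Finset ι) {f : ι → W → F} (hf : ∀ i, Differentiable ℝ (f i))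
    (v : W) : dLine v (fun z => ∑ i ∈ s, f i z) = fun z => ∑ i ∈ s, dLine v (f i) z := by
  funext z; simp [dLine, fderiv_fun_sum (fun i _ => hf i z)]

lemma dLine_mul {𝔸 : Type*} [NormedCommRing 𝔸] [NormedAlgebra ℝ 𝔸] {f g : W → 𝔸}
    (hf : Differentiable ℝ f) (hg : Differentiable ℝ g) (v : W) :
    dLine v (fun z => f z * g z) = fun z => dLine v f z * g z + f z * dLine v g z := by
  funext z; simp [dLine, fderiv_fun_mul (hf z) (hg z)]; ring

lemma dLine_inv {f : W → ℝ} (hf : Differentiable ℝ f) (h0 : ∀ z, f z ≠ 0) (v : W) :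
    dLine v (fun z => (f z)⁻¹) = fun z => (-1) * ((f z)⁻¹ * (f z)⁻¹ * dLine v f z) := by
  funext z
  have : HasFDerivAt (fun z => (f z)⁻¹) (-(f z ^ 2)⁻¹ • fderiv ℝ f z) z :=
    (hasDerivAt_inv (h0 z)).comp_hasFDerivAt z (hf z).hasFDerivAt
  simp only [dLine, this.fderiv]
  simp only [_root_.smul_apply, smul_eq_mul]
  rw [pow_two, mul_inv]; ring

/-- apply a list of directional derivatives -/
def dList {ι : Type*} (d : ι → W) (l : List ι) (g : W → F) : W → F :=
  l.foldr (fun i g => dLine (d i) g) g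

@[simp] lemma dList_nil {ι : Type*} (d : ι → W) (g : W → F) : dList d [] g = g := rfl
@[simp] lemma dList_cons {ι : Type*} (d : ι → W) (i : ι) (l : List ι) (g : W → F) :
    dList d (i :: l) g = dLine (d i) (dList d l g) := rfl

lemma dList_contDiff {ι : Type*} {d : ι → W} (l : List ι) {g : W → F}
    (hg : ContDiff ℝ (⊤ : ℕ∞) g) : ContDiff ℝ (⊤ : ℕ∞) (dList d l g) := by
  induction l with
  | nil => exact hg
  | cons i l ih => exact dLine_contDiff ih _

lemma dList_append {ι : Type*} (d : ι → W) (l l' : List ι) (g : W → F) :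
    dList d (l ++ l') g = dList d l (dList d l' g) := by
  simp [dList, List.foldr_append]

lemma dLine_dList_comm {ι : Type*} (d : ι → W) (v : W) (l : List ι) {g : W → F}
    (hg : ContDiff ℝ (⊤ : ℕ∞) g) : dLine v (dList d l g) = dList d l (dLine v g) := by
  induction l with
  | nil => rfl
  | cons i l ih => rw [dList_cons, dLine_comm (dList_contDiff l hg), ih]; rfl

lemma dList_perm {ι : Type*} (d : ι → W) {l l' : List ι} (h : l.Perm l') {g : W → F}
    (hg : ContDiff ℝ (⊤ : ℕ∞) g) : dList d l g = dList d l' g := by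
  induction h with
  | nil => rfl
  | cons i _ ih => simp [ih]
  | swap i j l => simp [dLine_comm (dList_contDiff l hg)]
  | trans _ _ h1 h2 => exact h1.trans h2

lemma iter_eq_dList {ι : Type*} (d : ι → W) (i : ι) (k : ℕ) (g : W → F) :
    (dLine (d i))^[k] g = dList d (List.replicate k i) g := by
  induction k with
  | zero => rfl
  | succ k ih => rw [Function.iterate_succ_apply', ih]; rfl

lemma foldr_eq_dList {ι : Type*} (d : ι → W) (α : ι → ℕ) (l : List ι) (g : W → F) :
    ((l.map fun i => (dLine (d i) (F := F))^[α i]).foldr (· ∘ ·) id) g =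
      dList d (l.flatMap fun i => List.replicate (α i) i) g := by
  induction l with
  | nil => rfl
  | cons i l ih =>
    simp only [List.map_cons, List.foldr_cons, Function.comp, List.flatMap_cons, dList_append]
    rw [← iter_eq_dList]
    exact congrArg _ ih

lemma dList_eq_mderiv {n : ℕ} (d : Fin n → W) (l : List (Fin n)) {g : W → F}
    (hg : ContDiff ℝ (⊤ : ℕ∞) g) :
    dList d l g = mderiv d (fun i => l.count i) g := by
  unfold mderiv
  rw [List.ofFn_eq_map, foldr_eq_dList]
  apply dList_perm _ _ hg
  rw [List.perm_iff_count]
  intro a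
  rw [List.count_flatMap]
  simp only [Function.comp_def, List.count_replicate, beq_iff_eq]
  rw [← List.ofFn_eq_map, List.sum_ofFn]
  simp

lemma mdeg_count {n : ℕ} (l : List (Fin n)) : mdeg (fun i => l.count i) = l.length := by
  unfold mdeg
  simpa using Multiset.sum_count_eq_card (s := Finset.univ) (m := (l : Multiset (Fin n))) (by simp)

/-- all derivatives of order at most `m` along `d` bounded by `C` -/
def DB {ι : Type*} (d : ι → W) (m : ℕ) (C : ℝ) (f : W → ℝ) : Prop :=
  ∀ l : List ι, l.length ≤ m → ∀ z, |dList d l f z| ≤ C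

lemma DB_zero_iff {ι : Type*} {d : ι → W} {C : ℝ} {f : W → ℝ} :
    DB d 0 C f ↔ ∀ z, |f z| ≤ C := by
  constructor
  · intro h z; exact h [] le_rfl z
  · intro h l hl z
    have : l = [] := by simpa using hl
    subst this; exact h z

lemma DB_succ_iff {ι : Type*} {d : ι → W} {m : ℕ} {C : ℝ} {f : W → ℝ} :
    DB d (m + 1) C f ↔ (∀ z, |f z| ≤ C) ∧ ∀ i, DB d m C (dLine (d i) f) := by
  constructor
  · intro h
    refine ⟨fun z => h [] (by simp) z, fun i l hl z => ?_⟩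
    have := h (l ++ [i]) (by simpa using hl) z
    simpa [dList_append] using this
  · rintro ⟨h0, h1⟩ l hl z
    rcases List.eq_nil_or_concat l with rfl | ⟨l', i, rfl⟩
    · exact h0 z
    · have := h1 i l' (by simpa using hl) z
      simpa [dList_append] using this

lemma DB.mono {ι : Type*} {d : ι → W} {m m' : ℕ} {C C' : ℝ} {f : W → ℝ} (h : DB d m C f)
    (hm : m' ≤ m) (hC : C ≤ C') : DB d m' C' f :=
  fun l hl z => (h l (hl.trans hm) z).trans hC

lemma DB.abs_le {ι : Type*} {d : ι → W} {m : ℕ} {C : ℝ} {f : W → ℝ} (h : DB d m C f) (z : W) :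
    |f z| ≤ C := h [] (by simp) z

lemma DB.nonneg {ι : Type*} {d : ι → W} {m : ℕ} {C : ℝ} {f : W → ℝ} (h : DB d m C f) :
    0 ≤ C := (abs_nonneg _).trans (h.abs_le 0)

lemma DB.add {ι : Type*} {d : ι → W} {m : ℕ} {A B : ℝ} {f g : W → ℝ}
    (hf : DB d m A f) (hg : DB d m B g) (sf : ContDiff ℝ (⊤ : ℕ∞) f)
    (sg : ContDiff ℝ (⊤ : ℕ∞) g) : DB d m (A + B) (fun z => f z + g z) := by
  induction m generalizing f g with
  | zero =>
    rw [DB_zero_iff] at *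
    exact fun z => (abs_add_le _ _).trans (add_le_add (hf z) (hg z))
  | succ m ih =>
    rw [DB_succ_iff] at *
    refine ⟨fun z => (abs_add_le _ _).trans (add_le_add (hf.1 z) (hg.1 z)), fun i => ?_⟩
    rw [dLine_add (smooth_diff sf) (smooth_diff sg)]
    exact ih (hf.2 i) (hg.2 i) (dLine_contDiff sf _) (dLine_contDiff sg _)

lemma DB_const_zero {ι : Type*} {d : ι → W} {m : ℕ} : DB d m 0 (fun _ => 0) := by
  induction m with
  | zero => rw [DB_zero_iff]; simp
  | succ m ih =>
    rw [DB_succ_iff]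
    refine ⟨by simp, fun i => ?_⟩
    have : dLine (d i) (fun _ : W => (0 : ℝ)) = fun _ => 0 := by funext z; simp [dLine]
    rw [this]; exact ih

lemma DB.sum {ι κ : Type*} {d : ι → W} {m : ℕ} {A : ℝ} (s : Finset κ) {f : κ → W → ℝ}
    (hf : ∀ k, DB d m A (f k)) (sf : ∀ k, ContDiff ℝ (⊤ : ℕ∞) (f k)) :
    DB d m (s.card * A) (fun z => ∑ k ∈ s, f k z) := by
  classical
  induction s using Finset.induction_on with
  | empty => simpa using DB_const_zero
  | insert a s ha ih =>
    simp only [Finset.sum_insert ha, Finset.card_insert_of_notMem ha]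
    have := DB.add (hf a) ih (sf a) (ContDiff.sum fun k _ => sf k)
    convert this using 1
    push_cast; ring

lemma DB.mul {ι : Type*} {d : ι → W} {m : ℕ} {A B : ℝ} {f g : W → ℝ}
    (hf : DB d m A f) (hg : DB d m B g) (sf : ContDiff ℝ (⊤ : ℕ∞) f)
    (sg : ContDiff ℝ (⊤ : ℕ∞) g) : DB d m (2 ^ m * (A * B)) (fun z => f z * g z) := by
  have hA := hf.nonneg
  have hB := hg.nonneg
  have key : ∀ z, |f z * g z| ≤ A * B := fun z => by
    rw [abs_mul]; exact mul_le_mul (hf.abs_le z) (hg.abs_le z) (abs_nonneg _) hA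
  induction m generalizing f g with
  | zero =>
    rw [DB_zero_iff]
    simpa using key
  | succ m ih =>
    have hf' := DB_succ_iff.1 hf
    have hg' := DB_succ_iff.1 hg
    rw [DB_succ_iff]
    refine ⟨fun z => (key z).trans ?_, fun i => ?_⟩
    · exact le_mul_of_one_le_left (by positivity) (one_le_pow₀ (by norm_num))
    · rw [dLine_mul (smooth_diff sf) (smooth_diff sg)]
      have h1 := ih (hf'.2 i) (hg.mono (Nat.le_succ m) le_rfl) (dLine_contDiff sf _) sg
        (fun z => by
          rw [abs_mul]; exact mul_le_mul ((hf'.2 i).abs_le z) (hg.abs_le z) (abs_nonneg _) hA)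
      have h2 := ih (hf.mono (Nat.le_succ m) le_rfl) (hg'.2 i) sf (dLine_contDiff sg _)
        (fun z => by
          rw [abs_mul]; exact mul_le_mul (hf.abs_le z) ((hg'.2 i).abs_le z) (abs_nonneg _) hA)
      have := h1.add h2 ((dLine_contDiff sf _).mul sg) (sf.mul (dLine_contDiff sg _))
      exact this.mono le_rfl (by rw [pow_succ]; linarith)

lemma DB.const_mul {ι : Type*} {d : ι → W} {m : ℕ} {A : ℝ} {f : W → ℝ}
    (hf : DB d m A f) (sf : ContDiff ℝ (⊤ : ℕ∞) f) (c : ℝ) :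
    DB d m (|c| * A) (fun z => c * f z) := by
  induction m generalizing f with
  | zero =>
    rw [DB_zero_iff] at *
    exact fun z => by rw [abs_mul]; exact mul_le_mul_of_nonneg_left (hf z) (abs_nonneg _)
  | succ m ih =>
    rw [DB_succ_iff] at *
    refine ⟨fun z => by
      rw [abs_mul]; exact mul_le_mul_of_nonneg_left (hf.1 z) (abs_nonneg _), fun i => ?_⟩
    have : dLine (d i) (fun z => c * f z) = fun z => c * dLine (d i) f z := by
      rw [dLine_mul (differentiable_const c) (smooth_diff sf)]
      funext z; simp [dLine]
    rw [this]; exact ih (hf.2 i) (dLine_contDiff sf _)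

lemma DB_inv_exists (m : ℕ) (c C : ℝ) (hc : 0 < c) : ∃ K : ℝ, ∀ {W ι : Type}
    [NormedAddCommGroup W] [NormedSpace ℝ W] (d : ι → W) (f : W → ℝ),
    ContDiff ℝ (⊤ : ℕ∞) f → DB d m C f → (∀ z, c ≤ f z) → DB d m K (fun z => (f z)⁻¹) := by
  induction m with
  | zero =>
    refine ⟨c⁻¹, fun d f sf hf hc' => ?_⟩
    rw [DB_zero_iff]
    intro z
    have := hc.trans_le (hc' z)
    rw [abs_of_pos (inv_pos.2 this)]
    exact inv_anti₀ hc (hc' z)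
  | succ m ih =>
    obtain ⟨K, hK⟩ := ih
    refine ⟨max c⁻¹ (1 * (2 ^ m * ((2 ^ m * (K * K)) * C))), fun d f sf hf hc' => ?_⟩
    have hpos : ∀ z, 0 < f z := fun z => hc.trans_le (hc' z)
    have hK' := hK d f sf (hf.mono (Nat.le_succ m) le_rfl) hc'
    have sinv : ContDiff ℝ (⊤ : ℕ∞) (fun z => (f z)⁻¹) := sf.inv fun z => (hpos z).ne'
    rw [DB_succ_iff]
    refine ⟨fun z => le_max_of_le_left ?_, fun i => ?_⟩
    · rw [abs_of_pos (inv_pos.2 (hpos z))]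
      exact inv_anti₀ hc (hc' z)
    · rw [dLine_inv (smooth_diff sf) (fun z => (hpos z).ne')]
      have h1 := ((hK'.mul hK' sinv sinv).mul ((DB_succ_iff.1 hf).2 i) (sinv.mul sinv)
        (dLine_contDiff sf _)).const_mul ((sinv.mul sinv).mul (dLine_contDiff sf _)) (-1)
      exact h1.mono le_rfl (by simp)

end Deriv

/-! ### A quantitative Hadamard global inverse theorem -/

section Hadamard
open Filter Topology

lemma hadamard_inj {E : Type*} [NormedAddCommGroup E] [NormedSpace ℝ E] (G : E → E)
    (hG : Continuous G) (c r : ℝ) (hc : 0 < c) (hr : 0 < r)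
    (hinj : ∀ x y, dist x y ≤ r → c * dist x y ≤ dist (G x) (G y))
    (hsurj : ∀ x w, dist (G x) w ≤ c * r → ∃ y, dist x y ≤ r ∧ G y = w) :
    Function.Injective G := by
  intro a b hab
  set w := G a with hw
  let γ : Set.Icc (0:ℝ) 1 → E := fun t => a + (t : ℝ) • (b - a)
  have hγ : Continuous γ := by fun_prop
  obtain ⟨R, hR⟩ : ∃ R, ∀ t, ‖G (γ t) - w‖ ≤ R := by
    have : Continuous fun t => ‖G (γ t) - w‖ := by fun_prop
    obtain ⟨R, hR⟩ := (isCompact_range this).bddAbove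
    exact ⟨R, fun t => hR ⟨t, rfl⟩⟩
  obtain ⟨M, hM⟩ := exists_nat_gt (R / (c * r / 4))
  have hR0 : 0 ≤ R := (norm_nonneg _).trans (hR ⟨0, by simp⟩)
  have hM0 : (0:ℝ) < M := lt_of_le_of_lt (by positivity) hM
  have hRM : R / M ≤ c * r / 4 := by
    rw [div_lt_iff₀ (by positivity)] at hM
    rw [div_le_iff₀ hM0]; linarith
  have step : ∀ i : ℕ, ∃ H : Set.Icc (0:ℝ) 1 → E, Continuous H ∧
      (∀ t, G (H t) = w + (1 - (i:ℝ) / M) • (G (γ t) - w)) ∧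
      H ⟨0, by simp⟩ = a ∧ H ⟨1, by simp⟩ = b := by
    intro i
    induction i with
    | zero =>
      refine ⟨γ, hγ, fun t => by simp, by simp [γ], by simp [γ]⟩
    | succ i ih =>
      obtain ⟨H, hH, hH1, hH0a, hH1b⟩ := ih
      have hd : ∀ t, dist (G (H t)) (w + (1 - ((i+1 : ℕ):ℝ) / M) • (G (γ t) - w)) ≤ c * (r / 4) := by
        intro t
        rw [hH1, dist_add_left, dist_eq_norm, ← sub_smul, norm_smul]
        have : ((1 - (i:ℝ) / M) - (1 - ((i+1 : ℕ):ℝ) / M)) = 1 / M := by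
          push_cast; field_simp; ring
        rw [this, Real.norm_of_nonneg (by positivity)]
        calc 1 / (M:ℝ) * ‖G (γ t) - w‖ ≤ 1 / M * R := by gcongr; exact hR t
          _ = R / M := by ring
          _ ≤ _ := by linarith
      have : ∀ t, ∃ y, dist (H t) y ≤ r / 4 ∧ G y = w + (1 - ((i+1 : ℕ):ℝ) / M) • (G (γ t) - w) := by
        intro t
        obtain ⟨y, hy, hy'⟩ := hsurj (H t) _ ((hd t).trans (by nlinarith))
        refine ⟨y, ?_, hy'⟩
        have h1 := hinj _ _ hy
        rw [hy'] at h1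
        exact le_of_mul_le_mul_left (h1.trans (hd t)) hc
      choose H' hH' hH'' using this
      refine ⟨H', ?_, hH'', ?_, ?_⟩
      · rw [continuous_iff_continuousAt]
        intro t
        rw [ContinuousAt, tendsto_iff_dist_tendsto_zero]
        have hcG : Continuous fun t => G (H' t) := by
          simp only [hH'']; fun_prop
        have e1 : ∀ᶠ t' in 𝓝 t, dist (H t') (H t) < r / 4 :=
          (hH.tendsto t).eventually (Metric.ball_mem_nhds _ (by positivity))
        have e2 : ∀ᶠ t' in 𝓝 t, dist (H' t') (H' t) ≤ c⁻¹ * dist (G (H' t')) (G (H' t)) := by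
          filter_upwards [e1] with t' ht'
          have : dist (H' t') (H' t) ≤ r := by
            calc dist (H' t') (H' t) ≤ dist (H' t') (H t') + dist (H t') (H t) + dist (H t) (H' t) :=
                  dist_triangle4 _ _ _ _
              _ ≤ r / 4 + r / 4 + r / 4 := by
                gcongr
                · rw [dist_comm]; exact hH' t'
                · exact hH' t
              _ ≤ r := by linarith
          have := hinj _ _ this
          rw [inv_mul_eq_div, le_div_iff₀ hc]; linarith
        have e3 : Tendsto (fun t' => c⁻¹ * dist (G (H' t')) (G (H' t))) (𝓝 t) (𝓝 0) := by
          have := (tendsto_iff_dist_tendsto_zero.1 (hcG.tendsto t)).const_mul c⁻¹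
          simpa using this
        exact squeeze_zero' (Eventually.of_forall fun _ => dist_nonneg) e2 e3
      · have h1 := hinj _ _ ((hH' ⟨0, by simp⟩).trans (by linarith))
        rw [hH'', hH0a] at h1
        have : dist a (H' ⟨0, by simp⟩) = 0 := by
          have h2 : G (γ ⟨0, by simp⟩) - w = 0 := by simp [γ, hw]
          rw [h2, ← hw] at h1
          simp only [smul_zero, add_zero, dist_self] at h1
          exact le_antisymm (by by_contra h; push Not at h; have := mul_pos hc h; linarith) dist_nonneg
        exact (dist_eq_zero.1 this).symm
      · have h1 := hinj _ _ ((hH' ⟨1, by simp⟩).trans (by linarith))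
        rw [hH'', hH1b] at h1
        have : dist b (H' ⟨1, by simp⟩) = 0 := by
          have h2 : G (γ ⟨1, by simp⟩) - w = 0 := by simp [γ, hab]
          rw [h2, ← hab] at h1
          simp only [smul_zero, add_zero, dist_self] at h1
          exact le_antisymm (by by_contra h; push Not at h; have := mul_pos hc h; linarith) dist_nonneg
        exact (dist_eq_zero.1 this).symm
  obtain ⟨H, hH, hH1, hH0a, hH1b⟩ := step M
  have hlc : IsLocallyConstant H := by
    rw [IsLocallyConstant.iff_eventually_eq]
    intro t
    have e1 : ∀ᶠ t' in 𝓝 t, dist (H t') (H t) < r :=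
      (hH.tendsto t).eventually (Metric.ball_mem_nhds _ (by positivity))
    filter_upwards [e1] with t' ht'
    have h1 := hinj _ _ ht'.le
    rw [hH1, hH1, div_self hM0.ne'] at h1
    simp only [sub_self, zero_smul, add_zero, dist_self] at h1
    have : dist (H t') (H t) = 0 :=
      le_antisymm (by by_contra h; push Not at h; have := mul_pos hc h; linarith) dist_nonneg
    exact dist_eq_zero.1 this
  have := hlc.apply_eq_of_preconnectedSpace ⟨0, by simp⟩ ⟨1, by simp⟩
  rw [hH0a, hH1b] at this
  exact this

lemma hadamard_dist {E : Type*} [NormedAddCommGroup E] [NormedSpace ℝ E] (G : E → E)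
    (hG : Continuous G) (c r : ℝ) (hc : 0 < c) (hr : 0 < r)
    (hinj : ∀ x y, dist x y ≤ r → c * dist x y ≤ dist (G x) (G y))
    (hsurj : ∀ x w, dist (G x) w ≤ c * r → ∃ y, dist x y ≤ r ∧ G y = w) (a b : E) :
    c * dist a b ≤ dist (G a) (G b) := by
  have hi := hadamard_inj G hG c r hc hr hinj hsurj
  set v := G b - G a with hv
  obtain ⟨M, hM⟩ := exists_nat_gt (‖v‖ / (c * r))
  have hM0 : (0:ℝ) < M := lt_of_le_of_lt (by positivity) hM
  have hRM : ‖v‖ / M ≤ c * r := by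
    rw [div_lt_iff₀ (by positivity)] at hM
    rw [div_le_iff₀ hM0]; linarith
  have step : ∀ i : ℕ, ∃ x, G x = G a + ((i:ℝ) / M) • v ∧ c * dist a x ≤ (i / M) * ‖v‖ := by
    intro i
    induction i with
    | zero => exact ⟨a, by simp, by simp⟩
    | succ i ih =>
      obtain ⟨x, hx, hx'⟩ := ih
      have hd : dist (G x) (G a + (((i+1 : ℕ):ℝ) / M) • v) ≤ ‖v‖ / M := by
        rw [hx, dist_add_left, dist_eq_norm, ← sub_smul, norm_smul]
        have : ((i:ℝ) / M - ((i+1 : ℕ):ℝ) / M) = -(1 / M) := by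
          push_cast; field_simp; ring
        rw [this, norm_neg, Real.norm_of_nonneg (by positivity)]
        apply le_of_eq; ring
      obtain ⟨y, hy, hy'⟩ := hsurj x _ (hd.trans hRM)
      refine ⟨y, hy', ?_⟩
      have h1 := hinj _ _ hy
      rw [hy'] at h1
      calc c * dist a y ≤ c * (dist a x + dist x y) := by gcongr; exact dist_triangle _ _ _
        _ ≤ i / M * ‖v‖ + ‖v‖ / M := by rw [mul_add]; exact add_le_add hx' (h1.trans hd)
        _ = _ := by push_cast; ring
  obtain ⟨x, hx, hx'⟩ := step M
  rw [div_self hM0.ne', one_smul, hv, add_sub_cancel] at hx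
  rw [div_self hM0.ne', one_mul, hi hx, hv, ← dist_eq_norm, dist_comm (G b)] at hx'
  exact hx'

lemma hadamard_fderiv {E : Type*} [NormedAddCommGroup E] [NormedSpace ℝ E]
    [FiniteDimensional ℝ E] (G : E → E) (hG : Differentiable ℝ G) (c L : ℝ) (hc : 0 < c)
    (hL : 0 < L) (hlow : ∀ x v, 2 * c * ‖v‖ ≤ ‖fderiv ℝ G x v‖)
    (hLip : ∀ x y, ‖fderiv ℝ G x - fderiv ℝ G y‖ ≤ L * ‖x - y‖) (a b : E) :
    c * dist a b ≤ dist (G a) (G b) := by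
  have hr : 0 < c / L := by positivity
  have happ : ∀ x, ∀ y ∈ Metric.closedBall x (c / L), ∀ z ∈ Metric.closedBall x (c / L),
      ‖G y - G z - fderiv ℝ G x (y - z)‖ ≤ c * ‖y - z‖ := by
    intro x y hy z hz
    refine (convex_closedBall x (c/L)).norm_image_sub_le_of_norm_hasFDerivWithin_le'
      (f := G) (f' := fun x => fderiv ℝ G x) (fun w _ => (hG w).hasFDerivAt.hasFDerivWithinAt)
      ?_ hz hy
    intro w hw
    refine (hLip _ _).trans ?_
    rw [Metric.mem_closedBall, dist_eq_norm] at hw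
    calc L * ‖w - x‖ ≤ L * (c / L) := by gcongr
      _ = c := by field_simp
  have : CompleteSpace E := FiniteDimensional.complete ℝ E
  refine hadamard_dist G hG.continuous c (c / L) hc hr ?_ ?_ a b
  · intro x y hxy
    have h1 := happ x x (by simp [hr.le]) y (by rw [Metric.mem_closedBall, dist_comm]; exact hxy)
    have h2 := hlow x (x - y)
    have h3 : ‖fderiv ℝ G x (x - y)‖ ≤ ‖G x - G y‖ + ‖G x - G y - fderiv ℝ G x (x - y)‖ := by
      have := norm_sub_le (G x - G y) (G x - G y - fderiv ℝ G x (x - y))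
      simpa using this
    rw [dist_eq_norm, dist_eq_norm]; linarith
  · intro x w hw
    have hinj : Function.Injective (fderiv ℝ G x : E →ₗ[ℝ] E) := by
      rw [← LinearMap.ker_eq_bot, LinearMap.ker_eq_bot']
      intro v hv
      have := hlow x v
      have h0 : fderiv ℝ G x v = 0 := hv
      rw [h0, norm_zero] at this
      have h2 : ‖v‖ ≤ 0 := by
        by_contra h; push Not at h
        have : 0 < 2 * c * ‖v‖ := by positivity
        linarith
      exact norm_le_zero_iff.1 h2
    have hsur : Function.Surjective (fderiv ℝ G x : E →ₗ[ℝ] E) :=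
      LinearMap.surjective_of_injective hinj
    choose inv hinv using hsur
    let S : (fderiv ℝ G x).NonlinearRightInverse :=
      { toFun := inv
        nnnorm := ⟨(2 * c)⁻¹, by positivity⟩
        bound' := by
          intro y
          have h1 := hlow x (inv y)
          have h2 : fderiv ℝ G x (inv y) = y := hinv y
          rw [h2] at h1
          change ‖inv y‖ ≤ (2 * c)⁻¹ * ‖y‖
          rw [inv_mul_eq_div, le_div_iff₀ (by positivity)]; linarith
        right_inv' := fun y => hinv y }
    have hA : ApproximatesLinearOn G (fderiv ℝ G x) (Metric.closedBall x (c / L)) ⟨c, hc.le⟩ :=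
      (fun y hy z hz => happ x y hy z hz)
    have := hA.surjOn_closedBall_of_nonlinearRightInverse S hr.le subset_rfl
    have hmem : w ∈ Metric.closedBall (G x) ((((S.nnnorm : NNReal) : ℝ)⁻¹ - ((⟨c, hc.le⟩ : NNReal) : ℝ)) * (c / L)) := by
      rw [Metric.mem_closedBall, dist_comm]
      refine hw.trans (le_of_eq ?_)
      change c * (c / L) = ((2 * c)⁻¹⁻¹ - c) * (c / L)
      rw [inv_inv]; ring
    obtain ⟨y, hy, hy'⟩ := this hmem
    exact ⟨y, by rw [dist_comm]; exact hy, hy'⟩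

end Hadamard

/-! ### The phase function -/

/-- Euclidean space -/
abbrev Eu (n : ℕ) := EuclideanSpace ℝ (Fin n)

/-- coordinate vectors -/
def bas {n : ℕ} (i : Fin n) : Eu n := EuclideanSpace.single i 1

/-- the standing assumptions on the phase -/
structure GoodPhase (n : ℕ) (C₀ C : ℝ) (φ : Eu n × Eu n → ℝ) : Prop where
  smooth : ContDiff ℝ (⊤ : ℕ∞) φ
  det : ∀ z, C₀ ≤ |Matrix.det (Matrix.of fun i j => mixedHessXY φ i j z)|
  dbx : ∀ i j, DB dX (2 * n + 1) C (mixedHessXY φ i j)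
  dby : ∀ i j, DB dY (2 * n + 1) C (mixedHessXY φ i j)

lemma eu_sum_bas {n : ℕ} (v : Eu n) : v = ∑ i, v i • bas i := by
  ext k
  simp [bas, Pi.single_apply]

lemma eu_norm_le_sum {n : ℕ} (v : Eu n) : ‖v‖ ≤ ∑ i, |v i| := by
  conv_lhs => rw [eu_sum_bas v]
  refine (norm_sum_le _ _).trans (Finset.sum_le_sum fun i _ => ?_)
  rw [norm_smul]; simp [bas]

lemma eu_abs_le {n : ℕ} (v : Eu n) (i : Fin n) : |v i| ≤ ‖v‖ := PiLp.norm_apply_le v i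

lemma dLine_restrict_fst {n : ℕ} {F : Type*} [NormedAddCommGroup F] [NormedSpace ℝ F]
    {g : Eu n × Eu n → F} (hg : Differentiable ℝ g) (i : Fin n)
    (ξ : Eu n) : dLine (bas i) (fun y => g (y, ξ)) = fun y => dLine (dX i) g (y, ξ) := by
  funext y
  have h1 : HasFDerivAt (fun y : Eu n => (y, ξ)) (ContinuousLinearMap.inl ℝ (Eu n) (Eu n)) y :=
    hasFDerivAt_prodMk_left y ξ
  have := (hg (y, ξ)).hasFDerivAt.comp y h1
  change fderiv ℝ (g ∘ fun y => (y, ξ)) y (bas i) = _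
  rw [this.fderiv]
  simp [dLine, dX, bas]

lemma dLine_restrict_snd {n : ℕ} {F : Type*} [NormedAddCommGroup F] [NormedSpace ℝ F]
    {g : Eu n × Eu n → F} (hg : Differentiable ℝ g) (i : Fin n)
    (y : Eu n) : dLine (bas i) (fun ξ => g (y, ξ)) = fun ξ => dLine (dY i) g (y, ξ) := by
  funext ξ
  have h1 : HasFDerivAt (fun ξ : Eu n => (y, ξ)) (ContinuousLinearMap.inr ℝ (Eu n) (Eu n)) ξ :=
    hasFDerivAt_prodMk_right y ξ
  have := (hg (y, ξ)).hasFDerivAt.comp ξ h1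
  change fderiv ℝ (g ∘ fun ξ => (y, ξ)) ξ (bas i) = _
  rw [this.fderiv]
  simp [dLine, dY, bas]

lemma dList_restrict_fst {n : ℕ} {F : Type*} [NormedAddCommGroup F] [NormedSpace ℝ F]
    {g : Eu n × Eu n → F} (hg : ContDiff ℝ (⊤ : ℕ∞) g) (l : List (Fin n))
    (ξ : Eu n) : dList bas l (fun y => g (y, ξ)) = fun y => dList dX l g (y, ξ) := by
  induction l with
  | nil => rfl
  | cons i l ih =>
    rw [dList_cons, ih, dLine_restrict_fst (smooth_diff (dList_contDiff l hg))]; rfl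

lemma dList_restrict_snd {n : ℕ} {F : Type*} [NormedAddCommGroup F] [NormedSpace ℝ F]
    {g : Eu n × Eu n → F} (hg : ContDiff ℝ (⊤ : ℕ∞) g) (l : List (Fin n))
    (y : Eu n) : dList bas l (fun ξ => g (y, ξ)) = fun ξ => dList dY l g (y, ξ) := by
  induction l with
  | nil => rfl
  | cons i l ih =>
    rw [dList_cons, ih, dLine_restrict_snd (smooth_diff (dList_contDiff l hg))]; rfl

lemma dLine_swap {n : ℕ} {g : Eu n × Eu n → ℝ} (hg : Differentiable ℝ g) (v : Eu n × Eu n) :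
    dLine v (fun z => g z.swap) = fun z => dLine v.swap g z.swap := by
  funext z
  have h1 : HasFDerivAt (fun z : Eu n × Eu n => z.swap)
      ((ContinuousLinearEquiv.prodComm ℝ (Eu n) (Eu n)) : Eu n × Eu n →L[ℝ] Eu n × Eu n) z :=
    (ContinuousLinearEquiv.prodComm ℝ (Eu n) (Eu n)).hasFDerivAt
  have := (hg z.swap).hasFDerivAt.comp z h1
  change fderiv ℝ (g ∘ fun z => z.swap) z v = _
  rw [this.fderiv]
  rfl

lemma dList_swap {n : ℕ} {g : Eu n × Eu n → ℝ} (hg : ContDiff ℝ (⊤ : ℕ∞) g)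
    (d : Fin n → Eu n × Eu n) (l : List (Fin n)) :
    dList d l (fun z => g z.swap) = fun z => dList (fun i => (d i).swap) l g z.swap := by
  induction l with
  | nil => rfl
  | cons i l ih => rw [dList_cons, ih, dLine_swap (smooth_diff (dList_contDiff l hg))]; rfl

lemma contDiff_swap {n : ℕ} {g : Eu n × Eu n → ℝ} (hg : ContDiff ℝ (⊤ : ℕ∞) g) :
    ContDiff ℝ (⊤ : ℕ∞) (fun z : Eu n × Eu n => g z.swap) :=
  hg.comp (contDiff_snd.prodMk contDiff_fst)

lemma mixedHess_contDiff {n : ℕ} {φ : Eu n × Eu n → ℝ} (h : ContDiff ℝ (⊤ : ℕ∞) φ) (i j : Fin n) :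
    ContDiff ℝ (⊤ : ℕ∞) (mixedHessXY φ i j) := dLine_contDiff (dLine_contDiff h _) _

lemma mixedHess_swap {n : ℕ} {φ : Eu n × Eu n → ℝ} (h : ContDiff ℝ (⊤ : ℕ∞) φ) (i j : Fin n) :
    mixedHessXY (fun z => φ z.swap) i j = fun z => mixedHessXY φ j i z.swap := by
  unfold mixedHessXY
  rw [dLine_swap (smooth_diff h), dLine_swap (smooth_diff (dLine_contDiff h _)),
    dLine_comm h]
  rfl

lemma GoodPhase.swap {n : ℕ} {C₀ C : ℝ} {φ : Eu n × Eu n → ℝ} (h : GoodPhase n C₀ C φ) :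
    GoodPhase n C₀ C (fun z => φ z.swap) where
  smooth := contDiff_swap h.smooth
  det := by
    intro z
    have := h.det z.swap
    rw [← Matrix.det_transpose] at this
    convert this using 4
    ext i j
    simp [mixedHess_swap h.smooth]
  dbx := by
    intro i j l hl z
    rw [mixedHess_swap h.smooth, dList_swap (mixedHess_contDiff h.smooth _ _)]
    exact h.dby j i l hl z.swap
  dby := by
    intro i j l hl z
    rw [mixedHess_swap h.smooth, dList_swap (mixedHess_contDiff h.smooth _ _)]
    exact h.dbx j i l hl z.swap

lemma goodPhase_of_hyp (n : ℕ) (C₀ : ℝ) (Cph : (Fin n → ℕ) → ℝ) : ∃ C : ℝ, 0 ≤ C ∧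
    ∀ φ : Eu n × Eu n → ℝ, ContDiff ℝ (⊤ : ℕ∞) φ →
    (∀ z, C₀ ≤ |Matrix.det (Matrix.of fun i j => mixedHessXY φ i j z)|) →
    (∀ i j : Fin n, ∀ α : Fin n → ℕ, mdeg α ≤ 2 * n + 1 →
          (∀ z, |mderiv dX α (mixedHessXY φ i j) z| ≤ Cph α) ∧
          (∀ z, |mderiv dY α (mixedHessXY φ i j) z| ≤ Cph α)) → GoodPhase n C₀ C φ := by
  classical
  set S := Fintype.piFinset (fun _ : Fin n => Finset.range (2 * n + 2))
  refine ⟨∑ α ∈ S, |Cph α|, Finset.sum_nonneg fun _ _ => abs_nonneg _, ?_⟩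
  intro φ hs hd hb
  have key : ∀ l : List (Fin n), l.length ≤ 2 * n + 1 →
      Cph (fun i => l.count i) ≤ ∑ α ∈ S, |Cph α| := by
    intro l hl
    refine (le_abs_self _).trans ?_
    refine Finset.single_le_sum (f := fun α => |Cph α|) (fun _ _ => abs_nonneg _) ?_
    simp only [S, Fintype.mem_piFinset, Finset.mem_range]
    intro i
    have := List.count_le_length (a := i) (l := l)
    omega
  refine ⟨hs, hd, fun i j l hl z => ?_, fun i j l hl z => ?_⟩
  · rw [dList_eq_mderiv _ _ (mixedHess_contDiff hs _ _)]
    exact ((hb i j _ (by rw [mdeg_count]; exact hl)).1 z).trans (key l hl)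
  · rw [dList_eq_mderiv _ _ (mixedHess_contDiff hs _ _)]
    exact ((hb i j _ (by rw [mdeg_count]; exact hl)).2 z).trans (key l hl)

lemma lip_of_dY {n : ℕ} {g : Eu n × Eu n → ℝ} (hg : ContDiff ℝ (⊤ : ℕ∞) g) {C : ℝ}
    (h : ∀ j z, |dLine (dY j) g z| ≤ C) (hC : 0 ≤ C) (y ξ ξ' : Eu n) :
    |g (y, ξ) - g (y, ξ')| ≤ n * C * ‖ξ - ξ'‖ := by
  have hd : Differentiable ℝ (fun ξ => g (y, ξ)) :=
    (smooth_diff hg).comp (by fun_prop)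
  have := Convex.norm_image_sub_le_of_norm_fderiv_le (𝕜 := ℝ) (f := fun ξ => g (y, ξ))
    (s := Set.univ) (C := n * C) (x := ξ') (y := ξ) (fun x _ => hd x) ?_ convex_univ
    (Set.mem_univ _) (Set.mem_univ _)
  · simpa using this
  · intro x _
    refine ContinuousLinearMap.opNorm_le_bound _ (by positivity) fun v => ?_
    conv_lhs => rw [eu_sum_bas v]
    rw [map_sum]
    refine (norm_sum_le _ _).trans ?_
    calc ∑ i, ‖fderiv ℝ (fun ξ => g (y, ξ)) x (v i • bas i)‖ ≤ ∑ i : Fin n, ‖v‖ * C := by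
          refine Finset.sum_le_sum fun i _ => ?_
          rw [map_smul, norm_smul]
          refine mul_le_mul (eu_abs_le v i) ?_ (norm_nonneg _) (norm_nonneg _)
          have h1 := congrFun (dLine_restrict_snd (smooth_diff hg) i y) x
          have h2 := h i (y, x)
          rw [← h1] at h2
          exact h2
      _ = n * C * ‖v‖ := by simp; ring

lemma DB_diff {n m : ℕ} {g : Eu n × Eu n → ℝ} (hg : ContDiff ℝ (⊤ : ℕ∞) g) {C : ℝ} (hC : 0 ≤ C)
    (h : ∀ j, DB dX m C (dLine (dY j) g)) (ξ ξ' : Eu n) :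
    DB bas m (n * C * ‖ξ - ξ'‖) (fun y => g (y, ξ) - g (y, ξ')) := by
  induction m generalizing g with
  | zero =>
    rw [DB_zero_iff]
    exact fun y => lip_of_dY hg (fun j z => (h j).abs_le z) hC y ξ ξ'
  | succ m ih =>
    rw [DB_succ_iff]
    refine ⟨fun y => lip_of_dY hg (fun j z => (h j).abs_le z) hC y ξ ξ', fun i => ?_⟩
    have hd : ∀ ξ, Differentiable ℝ (fun y => g (y, ξ)) :=
      fun ξ => (smooth_diff hg).comp (by fun_prop)
    rw [dLine_sub (hd ξ) (hd ξ'), dLine_restrict_fst (smooth_diff hg),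
      dLine_restrict_fst (smooth_diff hg)]
    refine ih (dLine_contDiff hg _) fun j => ?_
    rw [dLine_comm hg]
    exact (DB_succ_iff.1 (h j)).2 i

lemma matrix_lower {n : ℕ} (M : Matrix (Fin n) (Fin n) ℝ) (C₀ C : ℝ) (hd : C₀ ≤ |M.det|)
    (hM : ∀ i j, |M i j| ≤ C) (v w : Eu n) (hw : ∀ i, w i = ∑ j, M i j * v j) :
    C₀ * ‖v‖ ≤ (n * (n * (n.factorial * (max C 1) ^ n))) * ‖w‖ := by
  classical
  have hadj : ∀ i j, |M.adjugate i j| ≤ n.factorial * (max C 1) ^ n := by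
    intro i j
    rw [Matrix.adjugate_apply]
    have := Matrix.det_le (A := M.updateRow j (Pi.single i 1))
      (abv := (AbsoluteValue.abs : AbsoluteValue ℝ ℝ)) (x := max C 1) ?_
    · simpa [nsmul_eq_mul] using this
    · intro a b
      by_cases hab : a = j
      · subst hab
        simp only [Matrix.updateRow_self, AbsoluteValue.abs_apply, Pi.single_apply]
        split_ifs <;> simp
      · rw [Matrix.updateRow_ne hab]
        exact le_max_of_le_left (hM a b)
  have hcomp : ∀ i, |M.det| * |v i| ≤ n * (n.factorial * (max C 1) ^ n) * ‖w‖ := by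
    intro i
    have h1 : M.det * v i = ∑ k, M.adjugate i k * w k := by
      have h2 : (M.adjugate * M).mulVec (fun j => v j) i = M.det * v i := by
        rw [Matrix.adjugate_mul, Matrix.smul_mulVec, Matrix.one_mulVec]; simp
      rw [← h2, ← Matrix.mulVec_mulVec]
      simp only [Matrix.mulVec, dotProduct, hw]
    rw [← abs_mul, h1]
    calc |∑ k, M.adjugate i k * w k| ≤ ∑ k, |M.adjugate i k * w k| := Finset.abs_sum_le_sum_abs _ _
      _ ≤ ∑ k : Fin n, (n.factorial * (max C 1) ^ n) * ‖w‖ := by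
        refine Finset.sum_le_sum fun k _ => ?_
        rw [abs_mul]
        exact mul_le_mul (hadj i k) (eu_abs_le w k) (abs_nonneg _) (by positivity)
      _ = _ := by simp; ring
  calc C₀ * ‖v‖ ≤ |M.det| * ∑ i, |v i| := by
        exact mul_le_mul hd (eu_norm_le_sum v) (norm_nonneg _) (abs_nonneg _)
    _ = ∑ i, |M.det| * |v i| := by rw [Finset.mul_sum]
    _ ≤ ∑ i : Fin n, n * (n.factorial * (max C 1) ^ n) * ‖w‖ :=
        Finset.sum_le_sum fun i _ => hcomp i
    _ = _ := by simp; ring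

lemma phase_diff (n : ℕ) (C₀ C : ℝ) (hC₀ : 0 < C₀) (hC : 0 ≤ C) : ∃ c : ℝ, 0 < c ∧
    ∀ φ : Eu n × Eu n → ℝ, GoodPhase n C₀ C φ → ∀ ξ ξ' : Eu n,
      (∀ i, DB bas (2 * n + 1) (n * C * ‖ξ - ξ'‖)
        (dLine (bas i) (fun y => φ (y, ξ) - φ (y, ξ')))) ∧
      ∀ y, (c * ‖ξ - ξ'‖) ^ 2 ≤ ∑ i, (dLine (bas i) (fun y => φ (y, ξ) - φ (y, ξ')) y) ^ 2 := by
  set Q : ℝ := n * (n * (n.factorial * (max C 1) ^ n)) with hQ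
  have hQ0 : 0 ≤ Q := by positivity
  set c : ℝ := C₀ / (Q + 1) / 2 with hc
  have hc0 : 0 < c := by positivity
  refine ⟨c, hc0, fun φ hφ ξ ξ' => ?_⟩
  have hs := hφ.smooth
  have hd : ∀ ξ, Differentiable ℝ (fun y => φ (y, ξ)) :=
      fun ξ => (smooth_diff hs).comp (by fun_prop)
  have hdl : ∀ i, dLine (bas i) (fun y => φ (y, ξ) - φ (y, ξ')) =
      fun y => dLine (dX i) φ (y, ξ) - dLine (dX i) φ (y, ξ') := by
    intro i
    rw [dLine_sub (hd ξ) (hd ξ'), dLine_restrict_fst (smooth_diff hs),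
      dLine_restrict_fst (smooth_diff hs)]
  refine ⟨fun i => ?_, fun y => ?_⟩
  · rw [hdl]
    refine DB_diff (dLine_contDiff hs _) hC (fun j => ?_) ξ ξ'
    rw [dLine_comm hs]
    exact hφ.dbx i j
  · simp only [hdl]
    let G : Eu n → Eu n := fun ξ => WithLp.toLp 2 fun i => dLine (dX i) φ (y, ξ)
    have hder : ∀ i, Differentiable ℝ (fun ξ => dLine (dX i) φ (y, ξ)) :=
      fun i => (smooth_diff (dLine_contDiff hs _)).comp (by fun_prop)
    have hG : Differentiable ℝ G := by
      rw [differentiable_euclidean]; exact hder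
    have hGv : ∀ x v i, (fderiv ℝ G x v) i = ∑ j, mixedHessXY φ i j (y, x) * v j := by
      intro x v i
      have h1 : (fderiv ℝ G x v) i = fderiv ℝ (fun ξ => dLine (dX i) φ (y, ξ)) x v := by
        have h2 := ((EuclideanSpace.proj i : Eu n →L[ℝ] ℝ).hasFDerivAt (x := G x)).comp x
          (hG x).hasFDerivAt
        exact (congrArg (fun L : Eu n →L[ℝ] ℝ => L v) h2.fderiv).symm
      rw [h1]
      conv_lhs => rw [eu_sum_bas v]
      rw [map_sum]
      refine Finset.sum_congr rfl fun j _ => ?_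
      rw [map_smul, smul_eq_mul, mul_comm]
      congr 1
      have := congrFun (dLine_restrict_snd (smooth_diff (dLine_contDiff hs (dX i))) j y) x
      rw [dLine_comm hs] at this
      exact this
    have hlow : ∀ x v, 2 * c * ‖v‖ ≤ ‖fderiv ℝ G x v‖ := by
      intro x v
      have h1 := matrix_lower (Matrix.of fun i j => mixedHessXY φ i j (y, x)) C₀ C (hφ.det (y, x))
        (fun i j => (hφ.dbx i j).abs_le _) v (fderiv ℝ G x v) (fun i => hGv x v i)
      rw [← hQ] at h1
      have : 2 * c = C₀ / (Q + 1) := by rw [hc]; ring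
      rw [this, div_mul_eq_mul_div, div_le_iff₀ (by positivity)]
      have := norm_nonneg (fderiv ℝ G x v)
      linarith
    have hLip : ∀ x x', ‖fderiv ℝ G x - fderiv ℝ G x'‖ ≤ (n * (n * (n * C)) + 1) * ‖x - x'‖ := by
      intro x x'
      refine ContinuousLinearMap.opNorm_le_bound _ (by positivity) fun v => ?_
      refine (eu_norm_le_sum _).trans ?_
      calc ∑ i, |((fderiv ℝ G x - fderiv ℝ G x') v) i|
          ≤ ∑ i : Fin n, (n * (n * C * ‖x - x'‖ * ‖v‖)) := by
            refine Finset.sum_le_sum fun i _ => ?_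
            have : ((fderiv ℝ G x - fderiv ℝ G x') v) i =
                ∑ j, (mixedHessXY φ i j (y, x) - mixedHessXY φ i j (y, x')) * v j := by
              simp only [sub_mul, Finset.sum_sub_distrib]
              rw [← hGv, ← hGv]; rfl
            rw [this]
            refine (Finset.abs_sum_le_sum_abs _ _).trans ?_
            calc _ ≤ ∑ j : Fin n, n * C * ‖x - x'‖ * ‖v‖ := by
                  refine Finset.sum_le_sum fun j _ => ?_
                  rw [abs_mul]
                  refine mul_le_mul ?_ (eu_abs_le v j) (abs_nonneg _) (by positivity)
                  exact lip_of_dY (mixedHess_contDiff hs i j)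
                    (fun k z => ((DB_succ_iff.1 (hφ.dby i j)).2 k).abs_le z) hC y x x'
              _ = _ := by simp
        _ = n * (n * (n * C)) * ‖x - x'‖ * ‖v‖ := by simp; ring
        _ ≤ _ := by gcongr; linarith
    have := hadamard_fderiv G hG c _ hc0 (by positivity) hlow hLip ξ ξ'
    rw [dist_eq_norm, dist_eq_norm] at this
    have h2 : ‖G ξ - G ξ'‖ ^ 2 =
        ∑ i, (dLine (dX i) φ (y, ξ) - dLine (dX i) φ (y, ξ')) ^ 2 := by
      rw [EuclideanSpace.norm_sq_eq]
      refine Finset.sum_congr rfl fun i _ => ?_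
      rw [Real.norm_eq_abs, sq_abs]; rfl
    rw [← h2]
    gcongr

/-! ### Nonstationary phase -/

/-- the oscillating factor -/
def osc (t : ℝ) : ℂ := Complex.exp (Complex.I * (t : ℂ))

lemma norm_osc (t : ℝ) : ‖osc t‖ = 1 := by
  rw [osc, mul_comm, Complex.norm_exp_ofReal_mul_I]

lemma osc_add (s t : ℝ) : osc (s + t) = osc s * osc t := by
  simp [osc, mul_add, Complex.exp_add]

lemma osc_neg (t : ℝ) : osc (-t) = (starRingEnd ℂ) (osc t) := by
  rw [osc, osc, ← Complex.exp_conj]; simp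

lemma osc_sub (s t : ℝ) : osc (s - t) = osc s * (starRingEnd ℂ) (osc t) := by
  rw [sub_eq_add_neg, osc_add, osc_neg]

lemma osc_zero : osc 0 = 1 := by simp [osc]

lemma osc_contDiff {W : Type*} [NormedAddCommGroup W] [NormedSpace ℝ W] {ψ : W → ℝ}
    (h : ContDiff ℝ (⊤ : ℕ∞) ψ) : ContDiff ℝ (⊤ : ℕ∞) (fun y => osc (ψ y)) := by
  unfold osc
  exact ContDiff.cexp (contDiff_const.mul (Complex.ofRealCLM.contDiff.comp h))

lemma continuous_osc : Continuous osc := by unfold osc; fun_prop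

lemma dLine_osc {W : Type*} [NormedAddCommGroup W] [NormedSpace ℝ W] {ψ : W → ℝ}
    (h : Differentiable ℝ ψ) (v : W) : dLine v (fun y => osc (ψ y)) =
      fun y => Complex.I * ((dLine v ψ y : ℝ) : ℂ) * osc (ψ y) := by
  funext y
  have h1 : HasFDerivAt (fun y => ((ψ y : ℝ) : ℂ)) (Complex.ofRealCLM.comp (fderiv ℝ ψ y)) y :=
    Complex.ofRealCLM.hasFDerivAt.comp y (h y).hasFDerivAt
  have h2 := (h1.const_mul Complex.I).cexp
  unfold dLine osc
  rw [h2.fderiv]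
  simp
  ring

lemma dLine_ofReal {W : Type*} [NormedAddCommGroup W] [NormedSpace ℝ W] {ψ : W → ℝ}
    (h : Differentiable ℝ ψ) (v : W) : dLine v (fun y => ((ψ y : ℝ) : ℂ)) =
      fun y => ((dLine v ψ y : ℝ) : ℂ) := by
  funext y
  have h1 : HasFDerivAt (fun y => ((ψ y : ℝ) : ℂ)) (Complex.ofRealCLM.comp (fderiv ℝ ψ y)) y :=
    Complex.ofRealCLM.hasFDerivAt.comp y (h y).hasFDerivAt
  unfold dLine
  rw [h1.fderiv]
  simp

lemma tsupport_dLine_subset {W F : Type*} [NormedAddCommGroup W] [NormedSpace ℝ W]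
    [NormedAddCommGroup F] [NormedSpace ℝ F] (v : W) (g : W → F) :
    tsupport (dLine v g) ⊆ tsupport g := by
  refine closure_minimal (fun x hx => ?_) (isClosed_tsupport g)
  by_contra h
  apply hx
  have : fderiv ℝ g x = 0 := by
    by_contra h'
    exact h (support_fderiv_subset ℝ h')
  simp [dLine, this]

lemma osc_ibp {n : ℕ} {ψ b : Eu n → ℝ} (hψ : ContDiff ℝ (⊤ : ℕ∞) ψ) (hb : ContDiff ℝ (⊤ : ℕ∞) b)
    (hs : HasCompactSupport b) (v : Eu n) :
    ∫ y, osc (ψ y) * ((dLine v b y : ℝ) : ℂ) =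
      - ∫ y, Complex.I * ((dLine v ψ y : ℝ) : ℂ) * osc (ψ y) * (b y : ℂ) := by
  have ho := osc_contDiff hψ
  have hbC : ContDiff ℝ (⊤ : ℕ∞) (fun y => ((b y : ℝ) : ℂ)) := Complex.ofRealCLM.contDiff.comp hb
  have hsC : HasCompactSupport (fun y => ((b y : ℝ) : ℂ)) :=
    hs.comp_left (g := fun t : ℝ => (t : ℂ)) (by simp)
  have hds : HasCompactSupport (dLine v (fun y => ((b y : ℝ) : ℂ))) :=
    hsC.of_isClosed_subset (isClosed_tsupport _) (tsupport_dLine_subset _ _)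
  have h := integral_mul_fderiv_eq_neg_fderiv_mul_of_integrable (μ := (volume : Measure (Eu n)))
    (f := fun y => osc (ψ y)) (g := fun y => ((b y : ℝ) : ℂ)) (v := v) ?_ ?_ ?_ ?_ ?_
  · have e1 : ∀ y, fderiv ℝ (fun y => ((b y : ℝ) : ℂ)) y v = ((dLine v b y : ℝ) : ℂ) :=
      fun y => congrFun (dLine_ofReal (smooth_diff hb) v) y
    have e2 : ∀ y, fderiv ℝ (fun y => osc (ψ y)) y v = Complex.I * ((dLine v ψ y : ℝ) : ℂ) * osc (ψ y) :=
      fun y => congrFun (dLine_osc (smooth_diff hψ) v) y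
    simp only [e1, e2] at h
    exact h
  · exact ((dLine_contDiff ho v).continuous.mul hbC.continuous).integrable_of_hasCompactSupport
      hsC.mul_left
  · exact (ho.continuous.mul (dLine_contDiff hbC v).continuous).integrable_of_hasCompactSupport
      hds.mul_left
  · exact (ho.continuous.mul hbC.continuous).integrable_of_hasCompactSupport hsC.mul_left
  · exact fun x _ => smooth_diff ho x
  · exact fun x _ => smooth_diff hbC x

lemma osc_triv {n : ℕ} (R : ℝ) (ψ b : Eu n → ℝ) (B : ℝ) (z : Eu n) (hB : ∀ y, |b y| ≤ B)
    (hs : tsupport b ⊆ Metric.closedBall z R) :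
    ‖∫ y, osc (ψ y) * (b y : ℂ)‖ ≤ (volume (Metric.closedBall (0 : Eu n) R)).toReal * B := by
  have e : ∫ y, osc (ψ y) * (b y : ℂ) = ∫ y in Metric.closedBall z R, osc (ψ y) * (b y : ℂ) := by
    rw [setIntegral_eq_integral_of_forall_compl_eq_zero]
    intro y hy
    have : b y = 0 := by
      by_contra h
      exact hy (hs (subset_tsupport _ h))
    simp [this]
  rw [e]
  refine (norm_setIntegral_le_of_norm_le_const (C := B) ?_ ?_).trans ?_
  · exact measure_closedBall_lt_top
  · intro y hy
    rw [norm_mul, norm_osc, one_mul, Complex.norm_real]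
    exact hB y
  · rw [mul_comm, Measure.real, Measure.addHaar_closedBall_center]

lemma nonstat_step {n : ℕ} (R Kv : ℝ) (k : ℕ) : ∃ K : ℝ, 0 ≤ K ∧
    ∀ (ψ : Eu n → ℝ) (V : Fin n → Eu n → ℝ) (L : ℝ), 0 < L → ContDiff ℝ (⊤ : ℕ∞) ψ →
    (∀ i, ContDiff ℝ (⊤ : ℕ∞) (V i)) → (∀ i, DB bas k Kv (V i)) →
    (∀ y, ∑ i, V i y * dLine (bas i) ψ y = L) →
    ∀ (b : Eu n → ℝ) (B : ℝ) (z : Eu n), ContDiff ℝ (⊤ : ℕ∞) b → DB bas k B b →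
    tsupport b ⊆ Metric.closedBall z R →
    L ^ k * ‖∫ y, osc (ψ y) * (b y : ℂ)‖ ≤ K * B := by
  induction k with
  | zero =>
    refine ⟨(volume (Metric.closedBall (0 : Eu n) R)).toReal, ENNReal.toReal_nonneg, ?_⟩
    intro ψ V L hL hψ hV hVB hVL b B z hb hB hs
    rw [pow_zero, one_mul]
    exact osc_triv R ψ b B z hB.abs_le hs
  | succ k ih =>
    obtain ⟨K, hK0, hK⟩ := ih
    refine ⟨K * (n * (2 ^ (k+1) * |Kv|)), by positivity, ?_⟩
    intro ψ V L hL hψ hV hVB hVL b B z hb hB hs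
    have hB0 := hB.nonneg
    have hsm : ∀ i, ContDiff ℝ (⊤ : ℕ∞) (fun y => b y * V i y) := fun i => hb.mul (hV i)
    have hsb : ∀ i, tsupport (fun y => b y * V i y) ⊆ tsupport b := fun i =>
      tsupport_mul_subset_left
    have hcb : HasCompactSupport b :=
      (isCompact_closedBall z R).of_isClosed_subset (isClosed_tsupport _) hs
    have hcbi : ∀ i, HasCompactSupport (fun y => b y * V i y) := fun i => hcb.mul_right
    set b' : Eu n → ℝ := fun y => ∑ i, dLine (bas i) (fun y => b y * V i y) y with hb'
    have hb's : ContDiff ℝ (⊤ : ℕ∞) b' := ContDiff.sum fun i _ => dLine_contDiff (hsm i) _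
    have hDB : DB bas k (n * (2 ^ (k+1) * (B * |Kv|))) b' := by
      have := DB.sum (d := bas) (m := k) (A := 2 ^ (k+1) * (B * |Kv|)) Finset.univ
        (f := fun i => dLine (bas i) (fun y => b y * V i y)) (fun i => ?_)
        (fun i => dLine_contDiff (hsm i) _)
      · simpa using this
      · have h1 := hB.mul ((hVB i).mono le_rfl (le_abs_self _)) hb (hV i)
        exact (DB_succ_iff.1 h1).2 i
    have hsupp : tsupport b' ⊆ Metric.closedBall z R := by
      refine closure_minimal (fun x hx => ?_) Metric.isClosed_closedBall
      by_contra h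
      apply hx
      refine Finset.sum_eq_zero fun i _ => ?_
      by_contra h'
      exact h (hs (hsb i (tsupport_dLine_subset _ _ (subset_tsupport _ h'))))
    have main : Complex.I * L * ∫ y, osc (ψ y) * (b y : ℂ) = - ∫ y, osc (ψ y) * (b' y : ℂ) := by
      have e1 : ∫ y, osc (ψ y) * (b' y : ℂ) =
          ∑ i, ∫ y, osc (ψ y) * ((dLine (bas i) (fun y => b y * V i y) y : ℝ) : ℂ) := by
        rw [← integral_finsetSum]
        · simp only [hb', Complex.ofReal_sum, Finset.mul_sum]
        · intro i _
          refine Continuous.integrable_of_hasCompactSupport ?_ ?_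
          · exact (osc_contDiff hψ).continuous.mul
              (Complex.continuous_ofReal.comp (dLine_contDiff (hsm i) _).continuous)
          · refine HasCompactSupport.mul_left ?_
            exact HasCompactSupport.comp_left (g := fun t : ℝ => (t : ℂ))
              ((hcbi i).of_isClosed_subset (isClosed_tsupport _) (tsupport_dLine_subset _ _))
              (by simp)
      rw [e1, ← integral_const_mul]
      simp only [osc_ibp hψ (hsm _) (hcbi _)]
      rw [Finset.sum_neg_distrib, neg_neg, ← integral_finsetSum]
      · congr 1
        funext y
        have := congrArg (fun t : ℝ => (t : ℂ)) (hVL y)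
        simp only [Complex.ofReal_sum, Complex.ofReal_mul] at this
        rw [← this, Finset.mul_sum, Finset.sum_mul]
        refine Finset.sum_congr rfl fun i _ => ?_
        push_cast; ring
      · intro i _
        refine Continuous.integrable_of_hasCompactSupport ?_ ?_
        · have c1 := (dLine_contDiff hψ (bas i)).continuous
          have c2 := (osc_contDiff hψ).continuous
          have c3 := (hsm i).continuous
          have c4 := Complex.continuous_ofReal.comp c1
          have c5 := Complex.continuous_ofReal.comp c3
          exact ((continuous_const.mul c4).mul c2).mul c5
        · refine HasCompactSupport.mul_left ?_
          exact HasCompactSupport.comp_left (g := fun t : ℝ => (t : ℂ)) (hcbi i) (by simp)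
    have hn := congrArg norm main
    rw [norm_neg, norm_mul, norm_mul, Complex.norm_I, one_mul, Complex.norm_real,
      Real.norm_of_nonneg hL.le] at hn
    have := hK ψ V L hL hψ hV (fun i => (hVB i).mono (Nat.le_succ k) le_rfl) hVL b' _ z hb's hDB hsupp
    rw [pow_succ, mul_assoc, hn]
    refine this.trans (le_of_eq ?_)
    ring

lemma nonstat (n N : ℕ) (R c C : ℝ) (hc : 0 < c) (hC : 0 ≤ C) : ∃ K : ℝ, 0 ≤ K ∧
    ∀ (ψ : Eu n → ℝ) (L : ℝ), 0 ≤ L → ContDiff ℝ (⊤ : ℕ∞) ψ →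
    (∀ i, DB bas N (C * L) (dLine (bas i) ψ)) →
    (∀ y, (c * L) ^ 2 ≤ ∑ i, (dLine (bas i) ψ y) ^ 2) →
    ∀ (b : Eu n → ℝ) (B : ℝ) (z : Eu n), ContDiff ℝ (⊤ : ℕ∞) b → DB bas N B b →
    tsupport b ⊆ Metric.closedBall z R →
    (1 + L) ^ N * ‖∫ y, osc (ψ y) * (b y : ℂ)‖ ≤ K * B := by
  obtain ⟨Ki, hKi⟩ := DB_inv_exists N (c ^ 2) (n * (2 ^ N * (C * C))) (by positivity)
  obtain ⟨K1, hK10, hK1⟩ := nonstat_step (n := n) R (2 ^ N * (C * |Ki|)) N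
  set K0 := (volume (Metric.closedBall (0 : Eu n) R)).toReal with hK0
  have hK00 : 0 ≤ K0 := ENNReal.toReal_nonneg
  refine ⟨2 ^ N * (K1 + K0), by positivity, ?_⟩
  intro ψ L hL hψ hψB hlow b B z hb hB hs
  have hB0 := hB.nonneg
  rcases le_or_gt L 1 with hL1 | hL1
  · have triv := osc_triv R ψ b B z hB.abs_le hs
    calc _ ≤ (2 : ℝ) ^ N * (K0 * B) := by
          gcongr
          linarith
      _ ≤ _ := by
          rw [mul_assoc]
          gcongr
          linarith
  · have hLpos : 0 < L := by linarith
    have hg : ∀ i, ContDiff ℝ (⊤ : ℕ∞) (fun y => L⁻¹ * dLine (bas i) ψ y) :=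
      fun i => contDiff_const.mul (dLine_contDiff hψ _)
    have hgB : ∀ i, DB bas N C (fun y => L⁻¹ * dLine (bas i) ψ y) := by
      intro i
      have := (hψB i).const_mul (dLine_contDiff hψ _) L⁻¹
      refine this.mono le_rfl (le_of_eq ?_)
      rw [abs_of_pos (by positivity)]
      field_simp
    set f : Eu n → ℝ := fun y => ∑ i, (L⁻¹ * dLine (bas i) ψ y) * (L⁻¹ * dLine (bas i) ψ y) with hf
    have hfs : ContDiff ℝ (⊤ : ℕ∞) f := ContDiff.sum fun i _ => (hg i).mul (hg i)
    have hfB : DB bas N (n * (2 ^ N * (C * C))) f := by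
      have := DB.sum (d := bas) (m := N) (A := 2 ^ N * (C * C)) Finset.univ
        (f := fun i y => (L⁻¹ * dLine (bas i) ψ y) * (L⁻¹ * dLine (bas i) ψ y))
        (fun i => (hgB i).mul (hgB i) (hg i) (hg i)) (fun i => (hg i).mul (hg i))
      simpa using this
    have hfe : ∀ y, f y = L⁻¹ ^ 2 * ∑ i, (dLine (bas i) ψ y) ^ 2 := by
      intro y
      rw [hf, Finset.mul_sum]
      refine Finset.sum_congr rfl fun i _ => by ring
    have hfl : ∀ y, c ^ 2 ≤ f y := by
      intro y
      rw [hfe]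
      calc c ^ 2 = L⁻¹ ^ 2 * (c * L) ^ 2 := by field_simp
        _ ≤ _ := by gcongr; exact hlow y
    have hfpos : ∀ y, 0 < f y := fun y => lt_of_lt_of_le (by positivity) (hfl y)
    have hinv := (hKi bas f hfs hfB hfl).mono le_rfl (le_abs_self Ki)
    have hinvs : ContDiff ℝ (⊤ : ℕ∞) (fun y => (f y)⁻¹) := hfs.inv fun y => (hfpos y).ne'
    have := hK1 ψ (fun i y => L⁻¹ * dLine (bas i) ψ y * (f y)⁻¹) L hLpos hψ
      (fun i => (hg i).mul hinvs) (fun i => (hgB i).mul hinv (hg i) hinvs) ?_ b B z hb hB hs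
    · calc (1 + L) ^ N * ‖∫ y, osc (ψ y) * (b y : ℂ)‖
          ≤ (2 * L) ^ N * ‖∫ y, osc (ψ y) * (b y : ℂ)‖ := by gcongr; linarith
        _ = 2 ^ N * (L ^ N * ‖∫ y, osc (ψ y) * (b y : ℂ)‖) := by rw [mul_pow]; ring
        _ ≤ 2 ^ N * (K1 * B) := by gcongr
        _ ≤ _ := by
          rw [mul_assoc]
          gcongr
          linarith
    · intro y
      have h1 : ∑ i, L⁻¹ * dLine (bas i) ψ y * (f y)⁻¹ * dLine (bas i) ψ y
          = L * (f y)⁻¹ * (L⁻¹ ^ 2 * ∑ i, (dLine (bas i) ψ y) ^ 2) := by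
        rw [Finset.mul_sum, Finset.mul_sum]
        refine Finset.sum_congr rfl fun i _ => ?_
        field_simp
      rw [h1, ← hfe]
      have := (hfpos y).ne'
      field_simp

/-! ### Cotlar-Stein -/

lemma cotlar_aux {A : Type*} [CStarAlgebra A] (hone : ‖(1 : A)‖ ≤ 1)
    {ι : Type} [Fintype ι] (T : ι → A) (γ : ι → ι → ℝ) (M B : ℝ) (hM : 0 < M)
    (hγ : ∀ i j, 0 ≤ γ i j)
    (h1 : ∀ i j, ‖star (T i) * T j‖ ≤ γ i j ^ 2)
    (h2 : ∀ i j, ‖T i * star (T j)‖ ≤ γ i j ^ 2)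
    (hs : ∀ i, ∑ j, γ i j ≤ M) (hB : ∀ i, ‖T i‖ ≤ B) (m : ℕ) :
    ∃ (X : Type) (_ : Fintype X) (W : X → A),
      (star (∑ i, T i) * ∑ i, T i) ^ m = ∑ x, W x ∧
      ∀ c, ∑ x, √(‖T c * W x‖ * ‖W x‖) ≤ M ^ (2 * m) * √B := by
  induction m with
  | zero =>
    refine ⟨Unit, inferInstance, fun _ => 1, by simp, fun c => ?_⟩
    simp only [Finset.univ_unique, Finset.sum_singleton, mul_one, mul_zero, pow_zero, one_mul]
    apply Real.sqrt_le_sqrt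
    calc ‖T c‖ * ‖(1 : A)‖ ≤ ‖T c‖ * 1 := by
          gcongr
      _ ≤ B := by simpa using hB c
  | succ m ih =>
    obtain ⟨X, _, W, hW, hsum⟩ := ih
    refine ⟨ι × ι × X, inferInstance,
      fun x => star (T x.1) * T x.2.1 * W x.2.2, ?_, fun c => ?_⟩
    · rw [pow_succ', hW, star_sum]
      simp only [Fintype.sum_prod_type]
      rw [Finset.sum_mul, Finset.sum_mul]
      refine Finset.sum_congr rfl fun a _ => ?_
      rw [Finset.mul_sum Finset.univ T, Finset.sum_mul]
      refine Finset.sum_congr rfl fun b _ => ?_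
      rw [Finset.mul_sum]
    · simp only [Fintype.sum_prod_type]
      have key : ∀ a b x, √(‖T c * (star (T a) * T b * W x)‖ *
          ‖star (T a) * T b * W x‖) ≤
          γ c a * (γ a b * √(‖T b * W x‖ * ‖W x‖)) := by
        intro a b x
        rw [Real.sqrt_le_left (by have := hγ c a; have := hγ a b; positivity)]
        rw [mul_pow, mul_pow, Real.sq_sqrt (by positivity)]
        have e1 : ‖T c * (star (T a) * T b * W x)‖ ≤
            γ c a ^ 2 * ‖T b * W x‖ := by
          have : T c * (star (T a) * T b * W x) =
            (T c * star (T a)) * (T b * W x) := by simp only [mul_assoc]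
          rw [this]
          exact (norm_mul_le _ _).trans (by gcongr; exact h2 c a)
        have e2 : ‖star (T a) * T b * W x‖ ≤ γ a b ^ 2 * ‖W x‖ :=
          (norm_mul_le _ _).trans (by gcongr; exact h1 a b)
        calc _ ≤ (γ c a ^ 2 * ‖T b * W x‖) * (γ a b ^ 2 * ‖W x‖) := by gcongr
          _ = _ := by ring
      calc _ ≤ ∑ a, ∑ b, ∑ x, γ c a * (γ a b * √(‖T b * W x‖ * ‖W x‖)) := by
            gcongr; exact key _ _ _
        _ = ∑ a, γ c a * ∑ b, γ a b * ∑ x, √(‖T b * W x‖ * ‖W x‖) := by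
            simp only [Finset.mul_sum]
        _ ≤ ∑ a, γ c a * ∑ b, γ a b * (M ^ (2 * m) * √B) := by
            gcongr with a _ b _
            · exact hγ c a
            · exact hγ a b
            · exact hsum b
        _ ≤ ∑ a, γ c a * (M * (M ^ (2 * m) * √B)) := by
            gcongr with a _
            · exact hγ c a
            · rw [← Finset.sum_mul]
              gcongr
              exact hs a
        _ ≤ M * (M * (M ^ (2 * m) * √B)) := by
            rw [← Finset.sum_mul]
            gcongr
            exact hs c
        _ = _ := by ring

lemma cotlar_stein {A : Type*} [CStarAlgebra A] (hone : ‖(1 : A)‖ ≤ 1)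
    {ι : Type} [Fintype ι] (T : ι → A) (γ : ι → ι → ℝ) (M : ℝ) (hM : 0 < M)
    (hγ : ∀ i j, 0 ≤ γ i j)
    (h1 : ∀ i j, ‖star (T i) * T j‖ ≤ γ i j ^ 2)
    (h2 : ∀ i j, ‖T i * star (T j)‖ ≤ γ i j ^ 2)
    (hs : ∀ i, ∑ j, γ i j ≤ M) : ‖∑ i, T i‖ ≤ M := by
  by_contra! hlt
  set TT := ∑ i, T i with hTT
  set B := ∑ i, ‖T i‖ with hBdef
  have hB : ∀ i, ‖T i‖ ≤ B := fun i =>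
    Finset.single_le_sum (f := fun i => ‖T i‖) (fun _ _ => norm_nonneg _) (Finset.mem_univ i)
  have hB0 : 0 ≤ B := Finset.sum_nonneg fun _ _ => norm_nonneg _
  set S := star TT * TT with hS
  have hSsa : IsSelfAdjoint S := IsSelfAdjoint.star_mul_self TT
  have hSn : ‖S‖ = ‖TT‖ * ‖TT‖ := CStarRing.norm_star_mul_self
  have hb : ∀ m, ‖TT * S ^ m‖ ≤ Fintype.card ι * (B * M ^ (2 * m)) := by
    intro m
    obtain ⟨X, _, W, hW, hsum⟩ := cotlar_aux hone T γ M B hM hγ h1 h2 hs hB m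
    rw [← hTT, ← hS] at hW
    rw [hW, hTT, Finset.sum_mul]
    refine (norm_sum_le _ _).trans ?_
    calc _ ≤ ∑ c : ι, B * M ^ (2 * m) := by
          refine Finset.sum_le_sum fun c _ => ?_
          rw [Finset.mul_sum]
          refine (norm_sum_le _ _).trans ?_
          calc _ ≤ ∑ x, √B * √(‖T c * W x‖ * ‖W x‖) := by
                refine Finset.sum_le_sum fun x _ => ?_
                rw [← Real.sqrt_mul hB0]
                apply Real.le_sqrt_of_sq_le
                rw [sq]
                calc _ ≤ ‖T c * W x‖ * (B * ‖W x‖) := by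
                      gcongr
                      exact (norm_mul_le _ _).trans (by gcongr; exact hB c)
                  _ = _ := by ring
            _ ≤ √B * (M ^ (2 * m) * √B) := by
                rw [← Finset.mul_sum]
                gcongr
                exact hsum c
            _ = B * M ^ (2 * m) := by
                have e := Real.mul_self_sqrt hB0
                calc √B * (M ^ (2 * m) * √B) = (√B * √B) * M ^ (2 * m) := by ring
                  _ = _ := by rw [e]
      _ = _ := by simp
  have hT0 : 0 < ‖TT‖ := hM.trans hlt
  have hk : ∀ k : ℕ, (‖TT‖ / M) ^ (2 ^ (k + 1)) ≤ ‖TT‖ * (Fintype.card ι * B) / M ^ 2 := by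
    intro k
    have e1 : ‖S ^ 2 ^ k‖ = ‖TT‖ ^ (2 ^ (k + 1)) := by
      have := congrArg NNReal.toReal (hSsa.nnnorm_pow_two_pow k)
      simp only [coe_nnnorm, NNReal.coe_pow] at this
      rw [this, hSn, ← sq, ← pow_mul, pow_succ', mul_comm]
    obtain ⟨m, hm⟩ : ∃ m, 2 ^ k = m + 1 := ⟨2 ^ k - 1, by have := Nat.one_le_two_pow (n := k); omega⟩
    have e2 : ‖S ^ 2 ^ k‖ ≤ ‖TT‖ * (Fintype.card ι * (B * M ^ (2 * m))) := by
      rw [hm, pow_succ', hS, mul_assoc, ← hS]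
      refine (norm_mul_le _ _).trans ?_
      have : ‖star TT‖ = ‖TT‖ := norm_star _
      rw [this]
      gcongr
      exact hb m
    rw [div_pow, ← e1, div_le_div_iff₀ (by positivity) (by positivity)]
    have e3 : M ^ 2 ^ (k + 1) = M ^ (2 * m) * M ^ 2 := by
      rw [← pow_add]; congr 1; rw [pow_succ, hm]; ring
    rw [e3]
    calc _ ≤ ‖TT‖ * (Fintype.card ι * (B * M ^ (2 * m))) * M ^ 2 := by gcongr
      _ = _ := by ring
  have hr : 1 < ‖TT‖ / M := by rwa [one_lt_div hM]
  obtain ⟨N, hN⟩ := pow_unbounded_of_one_lt (‖TT‖ * (Fintype.card ι * B) / M ^ 2) hr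
  have hN2 : N ≤ 2 ^ (N + 1) := by
    have := Nat.lt_two_pow_self (n := N); rw [pow_succ]; omega
  have := pow_le_pow_right₀ hr.le hN2
  linarith [hk N]

/-! ### Lattice sums and the partition of unity -/

lemma lat_summable (n : ℕ) (r : ℝ) (hr : (n : ℝ) < r) :
    Summable fun m : Fin n → ℤ => (1 + ‖m‖) ^ (-r) := by
  let L : Submodule ℤ (Fin n → ℝ) := Submodule.span ℤ (Set.range (Pi.basisFun ℝ (Fin n)))
  have hrank : Module.finrank ℤ L = n := by
    rw [ZLattice.rank ℝ L]; simp
  have h1 := ZLattice.summable_norm_rpow L (-r) (by rw [hrank]; linarith)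
  let f : (Fin n → ℤ) → L := fun m => ⟨fun i => (m i : ℝ), by
    have : (fun i => (m i : ℝ)) = ∑ i, m i • (Pi.basisFun ℝ (Fin n) i) := by
      ext k; simp [Pi.single_apply]
    rw [this]
    exact Submodule.sum_mem _ fun i _ => Submodule.smul_mem _ _ (Submodule.subset_span ⟨i, rfl⟩)⟩
  have hf : Function.Injective f := by
    intro a b h
    have := congrArg Subtype.val h
    ext i
    have h2 : (a i : ℝ) = (b i : ℝ) := congrFun this i
    exact_mod_cast h2
  have hn : ∀ m, ‖f m‖ = ‖m‖ := by
    intro m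
    change ‖(fun i => (m i : ℝ))‖ = ‖m‖
    simp only [Pi.norm_def]
    congr 2
  have h2 := h1.comp_injective hf
  have h3 : Summable fun m : Fin n → ℤ => if m = 0 then (1 : ℝ) else 0 :=
    summable_of_ne_finset_zero (s := {0}) (by intro b hb; simp at hb; simp [hb])
  refine Summable.of_nonneg_of_le (fun m => by positivity) (fun m => ?_) (h2.add h3)
  simp only [Function.comp, hn]
  by_cases hm : m = 0
  · subst hm
    have : (0 : ℝ) ≤ 0 ^ (-r) := Real.rpow_nonneg le_rfl _
    simpa using this
  · have hpos : 0 < ‖m‖ := norm_pos_iff.2 hm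
    simp only [hm, if_false, add_zero]
    exact Real.rpow_le_rpow_of_nonpos hpos (by linarith) (by
      have : (0 : ℝ) ≤ n := Nat.cast_nonneg n
      linarith)

lemma lat_sum (n : ℕ) (r : ℝ) (hr : (n : ℝ) < r) : ∃ M : ℝ, 0 < M ∧
    ∀ (s : Finset (Fin n → ℤ)) (j : Fin n → ℤ), ∑ j' ∈ s, (1 + ‖j - j'‖) ^ (-r) ≤ M := by
  have h := lat_summable n r hr
  refine ⟨∑' m : Fin n → ℤ, (1 + ‖m‖) ^ (-r) + 1, ?_, fun s j => ?_⟩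
  · have : 0 ≤ ∑' m : Fin n → ℤ, (1 + ‖m‖) ^ (-r) := tsum_nonneg fun m => by positivity
    linarith
  · have hinj : Function.Injective fun j' => j - j' := sub_right_injective
    have h2 : ∑ j' ∈ s, (1 + ‖j - j'‖) ^ (-r) =
        ∑ m ∈ s.map ⟨fun j' => j - j', hinj⟩, (1 + ‖m‖) ^ (-r) := by simp
    rw [h2]
    have := h.sum_le_tsum (s.map ⟨fun j' => j - j', hinj⟩) (fun m _ => by positivity)
    linarith

/-- one-dimensional window -/
def chi1 (t : ℝ) : ℝ := Real.smoothTransition (t + 1) - Real.smoothTransition t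

lemma chi1_contDiff : ContDiff ℝ (⊤ : ℕ∞) chi1 := by
  unfold chi1
  exact (Real.smoothTransition.contDiff.comp (contDiff_id.add contDiff_const)).sub
    Real.smoothTransition.contDiff

lemma chi1_nonneg (t : ℝ) : 0 ≤ chi1 t :=
  sub_nonneg.2 (Real.smoothTransition.monotone (by linarith))

lemma chi1_le_one (t : ℝ) : chi1 t ≤ 1 := by
  have := Real.smoothTransition.le_one (t + 1)
  have := Real.smoothTransition.nonneg t
  unfold chi1; linarith

lemma chi1_eq_zero {t : ℝ} (h : 1 ≤ |t|) : chi1 t = 0 := by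
  unfold chi1
  rcases le_abs.1 h with h | h
  · rw [Real.smoothTransition.one_of_one_le h, Real.smoothTransition.one_of_one_le (by linarith)]
    ring
  · rw [Real.smoothTransition.zero_of_nonpos (by linarith),
      Real.smoothTransition.zero_of_nonpos (by linarith)]
    ring

lemma chi1_sum (N : ℕ) (t : ℝ) (h : |t| ≤ N) :
    ∑ k ∈ Finset.Ico (-(N : ℤ)) (N + 2 : ℤ), chi1 (t - k) = 1 := by
  have key : ∀ m : ℕ, ∑ k ∈ Finset.Ico (-(N : ℤ)) (-(N : ℤ) + m), chi1 (t - k) =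
      Real.smoothTransition (t + N + 1) - Real.smoothTransition (t + N + 1 - m) := by
    intro m
    induction m with
    | zero => simp
    | succ m ih =>
      have : Finset.Ico (-(N : ℤ)) (-(N : ℤ) + (m + 1 : ℕ)) =
          insert (-(N : ℤ) + m) (Finset.Ico (-(N : ℤ)) (-(N : ℤ) + m)) := by
        ext x; simp only [Finset.mem_Ico, Finset.mem_insert]; push_cast; omega
      rw [this, Finset.sum_insert (by simp), ih]
      unfold chi1
      push_cast
      have e1 : t - (-(N : ℝ) + m) + 1 = t + N + 1 - m := by ring
      have e2 : t - (-(N : ℝ) + m) = t + N + 1 - (m + 1) := by ring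
      rw [e1, e2]; ring
  have e : ((N : ℤ) + 2) = -(N : ℤ) + (2 * N + 2 : ℕ) := by push_cast; ring
  rw [e, key]
  have := abs_le.1 h
  rw [Real.smoothTransition.one_of_one_le (by linarith),
    Real.smoothTransition.zero_of_nonpos (by push_cast; linarith)]
  ring

/-- window on Euclidean space -/
def chi {n : ℕ} (y : Eu n) : ℝ := ∏ i, chi1 (y i)

lemma chi_contDiff {n : ℕ} : ContDiff ℝ (⊤ : ℕ∞) (chi (n := n)) := by
  unfold chi
  exact contDiff_prod fun i _ => chi1_contDiff.comp (EuclideanSpace.proj i : Eu n →L[ℝ] ℝ).contDiff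

lemma chi_nonneg {n : ℕ} (y : Eu n) : 0 ≤ chi y := Finset.prod_nonneg fun _ _ => chi1_nonneg _

lemma chi_le_one {n : ℕ} (y : Eu n) : chi y ≤ 1 :=
  Finset.prod_le_one (fun _ _ => chi1_nonneg _) fun _ _ => chi1_le_one _

lemma chi_ne_zero {n : ℕ} {y : Eu n} (h : chi y ≠ 0) : ‖y‖ ≤ n := by
  refine (eu_norm_le_sum y).trans ?_
  calc ∑ i, |y i| ≤ ∑ i : Fin n, (1 : ℝ) := by
        refine Finset.sum_le_sum fun i _ => ?_
        by_contra! hc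
        exact h (Finset.prod_eq_zero (Finset.mem_univ i) (chi1_eq_zero hc.le))
    _ = n := by simp

lemma chi_tsupport {n : ℕ} : tsupport (chi (n := n)) ⊆ Metric.closedBall 0 n := by
  refine closure_minimal (fun x hx => ?_) Metric.isClosed_closedBall
  simpa using chi_ne_zero hx

lemma chi_hasCompactSupport {n : ℕ} : HasCompactSupport (chi (n := n)) :=
  (isCompact_closedBall _ _).of_isClosed_subset (isClosed_tsupport _) chi_tsupport

lemma chi_pos_zero {n : ℕ} : 0 < chi (0 : Eu n) := by
  unfold chi
  refine Finset.prod_pos fun i _ => ?_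
  simp [chi1]

/-- lattice points in Euclidean space -/
def lat {n : ℕ} (j : Fin n → ℤ) : Eu n := WithLp.toLp 2 fun i => (j i : ℝ)

/-- a box of lattice points -/
def box (n N : ℕ) : Finset (Fin n → ℤ) :=
  Fintype.piFinset fun _ => Finset.Ico (-(N : ℤ)) (N + 2 : ℤ)

lemma chi_sum {n : ℕ} (N : ℕ) (y : Eu n) (h : ‖y‖ ≤ N) :
    ∑ j ∈ box n N, chi (y - lat j) = 1 := by
  unfold chi box
  have : ∀ (j : Fin n → ℤ) (i : Fin n), (y - lat j) i = y i - j i := fun j i => by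
    simp [lat]
  simp only [this]
  rw [← Finset.prod_univ_sum (fun _ => Finset.Ico (-(N : ℤ)) (N + 2 : ℤ))
    (fun i k => chi1 (y i - k))]
  exact Finset.prod_eq_one fun i _ => chi1_sum N _ ((eu_abs_le y i).trans h)

lemma lat_norm_le {n : ℕ} (j j' : Fin n → ℤ) : ‖j - j'‖ ≤ ‖lat j - lat j'‖ := by
  rw [pi_norm_le_iff_of_nonneg (norm_nonneg _)]
  intro i
  have := eu_abs_le (lat j - lat j') i
  refine le_trans (le_of_eq ?_) this
  simp [lat, Int.norm_eq_abs]

lemma DB_translate {n m : ℕ} {C : ℝ} {f : Eu n → ℝ} (h : DB bas m C f) (z : Eu n) :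
    DB bas m C (fun y => f (y - z)) := by
  have : ∀ l : List (Fin n), dList bas l (fun y => f (y - z)) = fun y => dList bas l f (y - z) := by
    intro l
    induction l with
    | nil => rfl
    | cons i l ih =>
      rw [dList_cons, ih, dList_cons]
      funext y
      simp only [dLine]
      rw [fderiv_comp_sub]
  intro l hl y
  rw [this]
  exact h l hl _

lemma DB_exists {n : ℕ} (m : ℕ) {f : Eu n → ℝ} (hf : ContDiff ℝ (⊤ : ℕ∞) f)
    (hs : HasCompactSupport f) : ∃ C, DB bas m C f := by
  induction m generalizing f with
  | zero =>
    obtain ⟨C, hC⟩ := hs.exists_bound_of_continuous hf.continuous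
    exact ⟨C, DB_zero_iff.2 hC⟩
  | succ m ih =>
    obtain ⟨C, hC⟩ := hs.exists_bound_of_continuous hf.continuous
    have : ∀ i : Fin n, ∃ C, DB bas m C (dLine (bas i) f) := fun i =>
      ih (dLine_contDiff hf _)
        (hs.of_isClosed_subset (isClosed_tsupport _) (tsupport_dLine_subset _ _))
    choose D hD using this
    refine ⟨|C| + ∑ i, |D i|, DB_succ_iff.2 ⟨fun z => ?_, fun i => ?_⟩⟩
    · have h0 : 0 ≤ ∑ i, |D i| := Finset.sum_nonneg fun _ _ => abs_nonneg _
      have := hC z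
      rw [Real.norm_eq_abs] at this
      linarith [le_abs_self C]
    · refine (hD i).mono le_rfl ?_
      have := Finset.single_le_sum (f := fun i => |D i|) (fun _ _ => abs_nonneg _)
        (Finset.mem_univ i)
      linarith [le_abs_self (D i), abs_nonneg C]

/-! ### Kernel operators on L² -/

/-- the Hilbert space -/
abbrev L2 (n : ℕ) := Lp ℂ 2 (volume : Measure (Eu n))

/-- volume of a ball -/
def vb (n : ℕ) (R : ℝ) : ℝ := (volume (Metric.closedBall (0 : Eu n) R)).toReal

lemma vb_nonneg (n : ℕ) (R : ℝ) : 0 ≤ vb n R := ENNReal.toReal_nonneg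

lemma volume_ball_eq {n : ℕ} (c : Eu n) (R : ℝ) :
    volume (Metric.closedBall c R) = ENNReal.ofReal (vb n R) := by
  rw [Measure.addHaar_closedBall_center, vb, ENNReal.ofReal_toReal]
  exact measure_closedBall_lt_top.ne

/-- nice kernels -/
structure Kern {n : ℕ} (R : ℝ) (c₁ c₂ : Eu n) (K : Eu n → Eu n → ℂ) : Prop where
  cont : Continuous fun z : Eu n × Eu n => K z.1 z.2
  bdd : ∀ ξ y, ‖K ξ y‖ ≤ 1
  s1 : ∀ ξ y, ξ ∉ Metric.closedBall c₁ R → K ξ y = 0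
  s2 : ∀ ξ y, y ∉ Metric.closedBall c₂ R → K ξ y = 0

lemma Kern.adj {n : ℕ} {R : ℝ} {c₁ c₂ : Eu n} {K : Eu n → Eu n → ℂ} (h : Kern R c₁ c₂ K) :
    Kern R c₂ c₁ (fun y ξ => (starRingEnd ℂ) (K ξ y)) where
  cont := Complex.continuous_conj.comp (h.cont.comp continuous_swap)
  bdd := fun y ξ => by rw [RCLike.norm_conj]; exact h.bdd ξ y
  s1 := fun y ξ hy => by rw [h.s2 ξ y hy, map_zero]
  s2 := fun y ξ hy => by rw [h.s1 ξ y hy, map_zero]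

/-- the localized function -/
def loc {n : ℕ} (c : Eu n) (R : ℝ) (f : Eu n → ℂ) : Eu n → ℂ := (Metric.closedBall c R).indicator f

lemma loc_integrable {n : ℕ} (c : Eu n) (R : ℝ) (f : L2 n) : Integrable (loc c R f) := by
  unfold loc
  rw [integrable_indicator_iff measurableSet_closedBall]
  exact ((Lp.memLp f).locallyIntegrable (by norm_num)).integrableOn_isCompact
    (isCompact_closedBall c R)

lemma loc_norm {n : ℕ} (c : Eu n) (R : ℝ) (f : L2 n) : ∫ y, ‖loc c R f y‖ ≤ √(vb n R) * ‖f‖ := by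
  have h1 : eLpNorm (loc c R f) 1 volume ≤ eLpNorm f 2 volume * ENNReal.ofReal (√(vb n R)) := by
    unfold loc
    rw [eLpNorm_indicator_eq_eLpNorm_restrict measurableSet_closedBall]
    refine (eLpNorm_le_eLpNorm_mul_rpow_measure_univ (p := 1) (q := 2) (by norm_num)
      (Lp.aestronglyMeasurable f).restrict).trans ?_
    gcongr
    · exact Measure.restrict_le_self
    · rw [Measure.restrict_apply_univ, volume_ball_eq,
        ENNReal.ofReal_rpow_of_nonneg (vb_nonneg _ _) (by norm_num), Real.sqrt_eq_rpow]
      norm_num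
  rw [integral_norm_eq_lintegral_enorm (loc_integrable c R f).1, ← eLpNorm_one_eq_lintegral_enorm]
  refine (ENNReal.toReal_mono ?_ h1).trans (le_of_eq ?_)
  · exact ENNReal.mul_ne_top (Lp.eLpNorm_ne_top f) ENNReal.ofReal_ne_top
  · rw [ENNReal.toReal_mul, ENNReal.toReal_ofReal (Real.sqrt_nonneg _), mul_comm, Lp.norm_def]

lemma Kern.mul_loc {n : ℕ} {R : ℝ} {c₁ c₂ : Eu n} {K : Eu n → Eu n → ℂ} (h : Kern R c₁ c₂ K)
    (f : Eu n → ℂ) (ξ y : Eu n) : K ξ y * f y = K ξ y * loc c₂ R f y := by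
  by_cases hy : y ∈ Metric.closedBall c₂ R
  · rw [loc, Set.indicator_of_mem hy]
  · rw [h.s2 ξ y hy]; simp

lemma Kern.mul_loc' {n : ℕ} {R : ℝ} {c₁ c₂ : Eu n} {K : Eu n → Eu n → ℂ} (h : Kern R c₁ c₂ K)
    (f : Eu n → ℂ) (ξ y : Eu n) : K ξ y * f ξ = K ξ y * loc c₁ R f ξ := by
  by_cases hy : ξ ∈ Metric.closedBall c₁ R
  · rw [loc, Set.indicator_of_mem hy]
  · rw [h.s1 ξ y hy]; simp

lemma Kern.int1 {n : ℕ} {R : ℝ} {c₁ c₂ : Eu n} {K : Eu n → Eu n → ℂ} (h : Kern R c₁ c₂ K)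
    (f : L2 n) (ξ : Eu n) : Integrable fun y => K ξ y * f y := by
  simp only [h.mul_loc f]
  refine (loc_integrable c₂ R f).bdd_mul (c := 1) ?_ (Filter.Eventually.of_forall (h.bdd ξ))
  exact (h.cont.comp (by fun_prop : Continuous fun y : Eu n => (ξ, y))).aestronglyMeasurable

lemma Kern.int2 {n : ℕ} {R : ℝ} {c₁ c₂ : Eu n} {K : Eu n → Eu n → ℂ} (h : Kern R c₁ c₂ K)
    (f g : L2 n) : Integrable (fun z : Eu n × Eu n =>
      (starRingEnd ℂ) (g z.1) * (K z.1 z.2 * f z.2)) (volume.prod volume) := by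
  have e : (fun z : Eu n × Eu n => (starRingEnd ℂ) (g z.1) * (K z.1 z.2 * f z.2)) = fun z =>
      K z.1 z.2 * ((starRingEnd ℂ) (loc c₁ R g z.1) * loc c₂ R f z.2) := by
    funext z
    rw [h.mul_loc f]
    by_cases hy : z.1 ∈ Metric.closedBall c₁ R
    · rw [loc, loc, Set.indicator_of_mem hy]; ring
    · rw [h.s1 _ _ hy]; simp
  rw [e]
  refine Integrable.bdd_mul (c := 1) ?_ h.cont.aestronglyMeasurable
    (Filter.Eventually.of_forall fun z => h.bdd _ _)
  exact Integrable.mul_prod (f := fun x => (starRingEnd ℂ) (loc c₁ R g x))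
    (Complex.conjCLE.toContinuousLinearMap.integrable_comp (loc_integrable c₁ R g)) (loc_integrable c₂ R f)

/-- action of a kernel -/
def kact {n : ℕ} (K : Eu n → Eu n → ℂ) (f : Eu n → ℂ) (ξ : Eu n) : ℂ := ∫ y, K ξ y * f y

lemma Kern.kact_bound {n : ℕ} {R : ℝ} {c₁ c₂ : Eu n} {K : Eu n → Eu n → ℂ} (h : Kern R c₁ c₂ K)
    (f : L2 n) (ξ : Eu n) :
    ‖kact K f ξ‖ ≤ (Metric.closedBall c₁ R).indicator (fun _ => √(vb n R) * ‖f‖) ξ := by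
  unfold kact
  by_cases hy : ξ ∈ Metric.closedBall c₁ R
  · rw [Set.indicator_of_mem hy]
    refine le_trans ?_ (loc_norm c₂ R f)
    refine norm_integral_le_of_norm_le (loc_integrable c₂ R f).norm
      (Filter.Eventually.of_forall fun y => ?_)
    rw [h.mul_loc f, norm_mul]
    exact mul_le_of_le_one_left (norm_nonneg _) (h.bdd _ _)
  · rw [Set.indicator_of_notMem hy]
    simp [h.s1 _ _ hy]

lemma Kern.kact_meas {n : ℕ} {R : ℝ} {c₁ c₂ : Eu n} {K : Eu n → Eu n → ℂ} (h : Kern R c₁ c₂ K)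
    (f : L2 n) : AEStronglyMeasurable (kact K f) volume := by
  have : AEStronglyMeasurable (fun z : Eu n × Eu n => K z.1 z.2 * f z.2) (volume.prod volume) :=
    h.cont.aestronglyMeasurable.mul (Lp.aestronglyMeasurable f).comp_snd
  exact this.integral_prod_right'

lemma Kern.kact_eLp {n : ℕ} {R : ℝ} {c₁ c₂ : Eu n} {K : Eu n → Eu n → ℂ} (h : Kern R c₁ c₂ K)
    (f : L2 n) : eLpNorm (kact K f) 2 volume ≤ ENNReal.ofReal (vb n R * ‖f‖) := by
  refine (eLpNorm_mono_real (h.kact_bound f)).trans ?_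
  rw [eLpNorm_indicator_const measurableSet_closedBall (by norm_num) (by norm_num), volume_ball_eq,
    ENNReal.ofReal_rpow_of_nonneg (vb_nonneg _ _) (by norm_num),
    Real.enorm_of_nonneg (by positivity), ← ENNReal.ofReal_mul (by positivity)]
  apply ENNReal.ofReal_le_ofReal
  have : vb n R ^ (1 / (2 : ℝ≥0∞).toReal) = √(vb n R) := by
    rw [Real.sqrt_eq_rpow]; norm_num
  rw [this]
  have e := Real.mul_self_sqrt (vb_nonneg n R)
  apply le_of_eq
  calc √(vb n R) * ‖f‖ * √(vb n R) = (√(vb n R) * √(vb n R)) * ‖f‖ := by ring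
    _ = _ := by rw [e]

lemma Kern.kact_memLp {n : ℕ} {R : ℝ} {c₁ c₂ : Eu n} {K : Eu n → Eu n → ℂ} (h : Kern R c₁ c₂ K)
    (f : L2 n) : MemLp (kact K f) 2 volume :=
  ⟨h.kact_meas f, (h.kact_eLp f).trans_lt ENNReal.ofReal_lt_top⟩

/-- the operator of a kernel -/
def Kern.op {n : ℕ} {R : ℝ} {c₁ c₂ : Eu n} {K : Eu n → Eu n → ℂ} (h : Kern R c₁ c₂ K) :
    L2 n →L[ℂ] L2 n :=
  LinearMap.mkContinuous
    { toFun := fun f => (h.kact_memLp f).toLp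
      map_add' := fun f g => by
        rw [← MemLp.toLp_add]
        congr 1
        funext ξ
        simp only [kact, Pi.add_apply]
        rw [← integral_add (h.int1 f ξ) (h.int1 g ξ)]
        refine integral_congr_ae ?_
        filter_upwards [Lp.coeFn_add f g] with y hy
        rw [hy, Pi.add_apply, mul_add]
      map_smul' := fun a f => by
        rw [RingHom.id_apply, ← MemLp.toLp_const_smul]
        congr 1
        funext ξ
        simp only [kact, Pi.smul_apply, smul_eq_mul]
        rw [← integral_const_mul]
        refine integral_congr_ae ?_
        filter_upwards [Lp.coeFn_smul a f] with y hy
        rw [hy, Pi.smul_apply, smul_eq_mul]; ring }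
    (vb n R) (fun f => by
      have := vb_nonneg n R
      simp only [LinearMap.coe_mk, AddHom.coe_mk]
      rw [Lp.norm_toLp]
      exact ENNReal.toReal_le_of_le_ofReal (by positivity) (h.kact_eLp f))

lemma Kern.op_ae {n : ℕ} {R : ℝ} {c₁ c₂ : Eu n} {K : Eu n → Eu n → ℂ} (h : Kern R c₁ c₂ K)
    (f : L2 n) : h.op f =ᵐ[volume] kact K f := MemLp.coeFn_toLp (h.kact_memLp f)

lemma Kern.inner_op {n : ℕ} {R : ℝ} {c₁ c₂ : Eu n} {K : Eu n → Eu n → ℂ} (h : Kern R c₁ c₂ K)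
    (f g : L2 n) : inner ℂ g (h.op f) = ∫ ξ, ∫ y, (starRingEnd ℂ) (g ξ) * (K ξ y * f y) := by
  rw [L2.inner_def]
  refine integral_congr_ae ?_
  filter_upwards [h.op_ae f] with ξ hξ
  rw [hξ, RCLike.inner_apply, kact, mul_comm, integral_const_mul]

lemma Kern.adjoint_op {n : ℕ} {R : ℝ} {c₁ c₂ : Eu n} {K : Eu n → Eu n → ℂ} (h : Kern R c₁ c₂ K) :
    ContinuousLinearMap.adjoint h.op = h.adj.op := by
  symm
  rw [ContinuousLinearMap.eq_adjoint_iff]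
  intro x y
  rw [h.inner_op, ← inner_conj_symm, h.adj.inner_op, ← integral_conj]
  rw [integral_integral_swap (h.int2 y x)]
  congr 1
  funext t
  rw [← integral_conj]
  congr 1
  funext ξ
  simp only [map_mul, Complex.conj_conj]
  ring

lemma Kern.inner_op_op {n : ℕ} {R : ℝ} {c₁ c₂ c₁' c₂' : Eu n} {K K' : Eu n → Eu n → ℂ}
    (h : Kern R c₁ c₂ K) (h' : Kern R c₁' c₂' K') (D : ℝ)
    (hD : ∀ y y', ‖∫ ξ, (starRingEnd ℂ) (K ξ y) * K' ξ y'‖ ≤ D) (f g : L2 n) :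
    ‖inner ℂ (h.op f) (h'.op g)‖ ≤ D * vb n R * ‖f‖ * ‖g‖ := by
  have hD0 : 0 ≤ D := (norm_nonneg _).trans (hD 0 0)
  set F : Eu n → ℂ := fun y => (starRingEnd ℂ) (loc c₂ R f y) with hF
  set G := loc c₂' R g with hG
  have hFi : Integrable F :=
    Complex.conjCLE.toContinuousLinearMap.integrable_comp (loc_integrable c₂ R f)
  have hGi : Integrable G := loc_integrable c₂' R g
  have hcK : Continuous fun q : Eu n × (Eu n × Eu n) => (starRingEnd ℂ) (K q.1 q.2.1) * K' q.1 q.2.2 :=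
    (Complex.continuous_conj.comp (h.cont.comp (by fun_prop :
      Continuous fun q : Eu n × (Eu n × Eu n) => (q.1, q.2.1)))).mul
      (h'.cont.comp (by fun_prop : Continuous fun q : Eu n × (Eu n × Eu n) => (q.1, q.2.2)))
  have e1 : inner ℂ (h.op f) (h'.op g) = ∫ ξ, ∫ z : Eu n × Eu n,
      ((starRingEnd ℂ) (K ξ z.1) * K' ξ z.2) * (F z.1 * G z.2) := by
    rw [L2.inner_def]
    refine integral_congr_ae ?_
    filter_upwards [h.op_ae f, h'.op_ae g] with ξ h1 h2
    rw [h1, h2, RCLike.inner_apply, kact, kact, ← integral_conj, mul_comm]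
    rw [← integral_prod_mul (μ := volume) (ν := volume)]
    congr 1
    funext z
    rw [h.mul_loc f, h'.mul_loc g, map_mul]
    simp only [hF, hG]
    ring
  have hintg : Integrable (fun q : Eu n × (Eu n × Eu n) =>
      ((starRingEnd ℂ) (K q.1 q.2.1) * K' q.1 q.2.2) * (F q.2.1 * G q.2.2))
      (volume.prod (volume.prod volume)) := by
    have h1 : Integrable (fun q : Eu n × (Eu n × Eu n) =>
        (Metric.closedBall c₁ R).indicator (fun _ => (1 : ℂ)) q.1 * (F q.2.1 * G q.2.2))
        (volume.prod (volume.prod volume)) := by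
      refine Integrable.mul_prod (f := (Metric.closedBall c₁ R).indicator (fun _ => (1 : ℂ)))
        (g := fun z : Eu n × Eu n => F z.1 * G z.2) ?_ (hFi.mul_prod hGi)
      rw [integrable_indicator_iff measurableSet_closedBall]
      exact integrableOn_const (measure_closedBall_lt_top.ne)
    have h2 := h1.bdd_mul (c := 1) hcK.aestronglyMeasurable (Filter.Eventually.of_forall fun q => by
      rw [norm_mul, RCLike.norm_conj]
      exact mul_le_one₀ (h.bdd _ _) (norm_nonneg _) (h'.bdd _ _))
    refine h2.congr (Filter.Eventually.of_forall fun q => ?_)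
    by_cases hq : q.1 ∈ Metric.closedBall c₁ R
    · simp [Set.indicator_of_mem hq]
    · simp [h.s1 _ _ hq]
  rw [e1, integral_integral_swap hintg]
  have e2 : ∀ z : Eu n × Eu n, ∫ ξ, ((starRingEnd ℂ) (K ξ z.1) * K' ξ z.2) * (F z.1 * G z.2) =
      (∫ ξ, (starRingEnd ℂ) (K ξ z.1) * K' ξ z.2) * (F z.1 * G z.2) := fun z => by
    rw [integral_mul_const]
  simp only [e2]
  have hb : ‖∫ z : Eu n × Eu n, (∫ ξ, (starRingEnd ℂ) (K ξ z.1) * K' ξ z.2) * (F z.1 * G z.2)‖ ≤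
      ∫ z : Eu n × Eu n, D * (‖F z.1‖ * ‖G z.2‖) := by
    refine norm_integral_le_of_norm_le ?_ (Filter.Eventually.of_forall fun z => ?_)
    · exact (hFi.norm.mul_prod hGi.norm).const_mul D
    · rw [norm_mul, norm_mul]
      gcongr
      exact hD _ _
  refine hb.trans ?_
  rw [integral_const_mul, Measure.volume_eq_prod, integral_prod_mul (fun y => ‖F y‖) (fun y => ‖G y‖)]
  have hFn : ∫ y, ‖F y‖ ≤ √(vb n R) * ‖f‖ := by
    simp only [hF, RCLike.norm_conj]; exact loc_norm c₂ R f
  calc D * ((∫ y, ‖F y‖) * ∫ y, ‖G y‖) ≤ D * ((√(vb n R) * ‖f‖) * (√(vb n R) * ‖g‖)) := by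
        gcongr
        exact loc_norm c₂' R g
    _ = D * (√(vb n R) * √(vb n R)) * ‖f‖ * ‖g‖ := by ring
    _ = _ := by rw [Real.mul_self_sqrt (vb_nonneg n R)]

lemma Kern.norm_adj_op {n : ℕ} {R : ℝ} {c₁ c₂ c₁' c₂' : Eu n} {K K' : Eu n → Eu n → ℂ}
    (h : Kern R c₁ c₂ K) (h' : Kern R c₁' c₂' K') (D : ℝ)
    (hD : ∀ y y', ‖∫ ξ, (starRingEnd ℂ) (K ξ y) * K' ξ y'‖ ≤ D) :
    ‖star h.op * h'.op‖ ≤ D * vb n R := by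
  have hD0 : 0 ≤ D := (norm_nonneg _).trans (hD 0 0)
  have hv := vb_nonneg n R
  refine ContinuousLinearMap.opNorm_le_bound _ (by positivity) fun g => ?_
  set w := (star h.op * h'.op) g with hw
  have h1 : ‖w‖ * ‖w‖ ≤ (D * vb n R * ‖g‖) * ‖w‖ := by
    rw [← inner_self_eq_norm_mul_norm (𝕜 := ℂ)]
    refine (RCLike.re_le_norm _).trans ?_
    have : inner ℂ w w = inner ℂ (h.op w) (h'.op g) := by
      have hw2 : w = ContinuousLinearMap.adjoint h.op (h'.op g) := rfl
      have := ContinuousLinearMap.adjoint_inner_right h.op w (h'.op g)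
      rw [← hw2] at this
      exact this
    rw [this]
    refine (h.inner_op_op h' D hD w g).trans (le_of_eq (by ring))
  rcases (norm_nonneg w).eq_or_lt with h0 | h0
  · rw [← h0]; positivity
  · exact le_of_mul_le_mul_right h1 h0

/-! ### Boundedness of the phase operator -/

/-- localized kernels -/
def kph {n : ℕ} (φ : Eu n × Eu n → ℝ) (j k : Fin n → ℤ) (ξ y : Eu n) : ℂ :=
  osc (φ (y, ξ)) * ((chi (ξ - lat k) * chi (y - lat j) : ℝ) : ℂ)

lemma kph_swap {n : ℕ} (φ : Eu n × Eu n → ℝ) (j k : Fin n → ℤ) (ξ y : Eu n) :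
    kph φ j k ξ y = kph (fun z => φ z.swap) k j y ξ := by
  unfold kph; rw [mul_comm (chi (ξ - lat k))]; rfl

lemma chi_translate_zero {n : ℕ} {ξ c : Eu n} (h : ξ ∉ Metric.closedBall c n) : chi (ξ - c) = 0 := by
  by_contra h'
  apply h
  rw [Metric.mem_closedBall, dist_eq_norm]
  exact chi_ne_zero h'

lemma kph_kern {n : ℕ} {φ : Eu n × Eu n → ℝ} (hφ : Continuous φ) (j k : Fin n → ℤ) :
    Kern (n : ℝ) (lat k) (lat j) (kph φ j k) where
  cont := by
    unfold kph
    have h1 := continuous_osc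
    have h2 := (chi_contDiff (n := n)).continuous
    fun_prop
  bdd := fun ξ y => by
    unfold kph
    rw [norm_mul, norm_osc, one_mul, Complex.norm_real, Real.norm_of_nonneg
      (mul_nonneg (chi_nonneg _) (chi_nonneg _))]
    exact mul_le_one₀ (chi_le_one _) (chi_nonneg _) (chi_le_one _)
  s1 := fun ξ y h => by simp [kph, chi_translate_zero h]
  s2 := fun ξ y h => by simp [kph, chi_translate_zero h]

lemma chi_far {n : ℕ} {y y' : Eu n} {j j' : Fin n → ℤ} (h : chi (y - lat j) ≠ 0)
    (h' : chi (y' - lat j') ≠ 0) : 1 + ‖j - j'‖ ≤ (1 + 2 * n) * (1 + ‖y' - y‖) := by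
  have h1 := lat_norm_le j j'
  have h2 := chi_ne_zero h
  have h3 := chi_ne_zero h'
  have h4 : ‖lat j - lat j'‖ ≤ ‖y - lat j‖ + ‖y' - lat j'‖ + ‖y' - y‖ := by
    have : lat j - lat j' = -(y - lat j) + (y' - lat j') - (y' - y) := by abel
    rw [this]
    refine (norm_sub_le _ _).trans ?_
    gcongr
    refine (norm_add_le _ _).trans ?_
    rw [norm_neg]
  have : 0 ≤ (n : ℝ) * ‖y' - y‖ := by positivity
  nlinarith

lemma kern_bound (n : ℕ) (C₀ C : ℝ) (hC₀ : 0 < C₀) (hC : 0 ≤ C) : ∃ D : ℝ, 0 ≤ D ∧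
    ∀ φ : Eu n × Eu n → ℝ, GoodPhase n C₀ C φ → ∀ (j k j' k' : Fin n → ℤ) (y y' : Eu n),
      ((1 + ‖j - j'‖) * (1 + ‖k - k'‖)) ^ (2 * n + 1) *
        ‖∫ ξ, (starRingEnd ℂ) (kph φ j k ξ y) * kph φ j' k' ξ y'‖ ≤ D := by
  obtain ⟨c, hc, hph⟩ := phase_diff n C₀ C hC₀ hC
  obtain ⟨K, hK0, hK⟩ := nonstat n (2 * n + 1) n c (n * C) hc (by positivity)
  obtain ⟨B, hB⟩ := DB_exists (2 * n + 1) (chi_contDiff (n := n)) chi_hasCompactSupport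
  have hB0 := hB.nonneg
  refine ⟨(1 + 2 * n) ^ (2 * n + 1) * (1 + 2 * n) ^ (2 * n + 1) * (K * (2 ^ (2 * n + 1) * (B * B))),
    by positivity, ?_⟩
  intro φ hφ j k j' k' y y'
  have hs := hφ.smooth
  have e : ∀ ξ, (starRingEnd ℂ) (kph φ j k ξ y) * kph φ j' k' ξ y' =
      ((chi (y - lat j) * chi (y' - lat j') : ℝ) : ℂ) * (osc (φ (y', ξ) - φ (y, ξ)) *
        ((chi (ξ - lat k) * chi (ξ - lat k') : ℝ) : ℂ)) := by
    intro ξ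
    unfold kph
    rw [osc_sub]
    simp only [map_mul, Complex.conj_ofReal, Complex.ofReal_mul]
    ring
  simp only [e]
  rw [integral_const_mul, norm_mul, Complex.norm_real, Real.norm_of_nonneg
      (mul_nonneg (chi_nonneg _) (chi_nonneg _))]
  by_cases hj : chi (y - lat j) * chi (y' - lat j') = 0
  · rw [hj]; simp; positivity
  by_cases hk : ∃ ξ, chi (ξ - lat k) * chi (ξ - lat k') ≠ 0
  swap
  · push Not at hk
    simp only [hk]; simp; positivity
  obtain ⟨ξ₀, hξ₀⟩ := hk
  have f1 := chi_far (left_ne_zero_of_mul hj) (right_ne_zero_of_mul hj)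
  have f2 := chi_far (left_ne_zero_of_mul hξ₀) (right_ne_zero_of_mul hξ₀)
  rw [sub_self, norm_zero, add_zero, mul_one] at f2
  have f3 : chi (y - lat j) * chi (y' - lat j') ≤ 1 :=
    mul_le_one₀ (chi_le_one _) (chi_nonneg _) (chi_le_one _)
  obtain ⟨p1, p2⟩ := hph _ hφ.swap y' y
  have hψs : ContDiff ℝ (⊤ : ℕ∞) (fun ξ => φ (y', ξ) - φ (y, ξ)) :=
    (hs.comp (contDiff_prodMk_right y')).sub (hs.comp (contDiff_prodMk_right y))
  have hcs : ∀ c : Eu n, ContDiff ℝ (⊤ : ℕ∞) (fun ξ => chi (ξ - c)) := fun c =>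
    chi_contDiff.comp (contDiff_id.sub contDiff_const)
  have main := hK (fun ξ => φ (y', ξ) - φ (y, ξ)) ‖y' - y‖ (norm_nonneg _) hψs p1 p2
    (fun ξ => chi (ξ - lat k) * chi (ξ - lat k')) _ (lat k) ((hcs _).mul (hcs _))
    ((DB_translate hB (lat k)).mul (DB_translate hB (lat k')) (hcs _) (hcs _))
    (closure_minimal (fun ξ hξ => by
      by_contra h
      exact hξ (by simp [chi_translate_zero h])) Metric.isClosed_closedBall)
  set J := ‖∫ ξ, osc (φ (y', ξ) - φ (y, ξ)) * ((chi (ξ - lat k) * chi (ξ - lat k') : ℝ) : ℂ)‖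
  have hJ : 0 ≤ J := norm_nonneg _
  calc ((1 + ‖j - j'‖) * (1 + ‖k - k'‖)) ^ (2 * n + 1) * (chi (y - lat j) * chi (y' - lat j') * J)
      ≤ (((1 + 2 * n) * (1 + ‖y' - y‖)) * (1 + 2 * n)) ^ (2 * n + 1) * (1 * J) := by
        gcongr
        exact mul_nonneg (mul_nonneg (chi_nonneg _) (chi_nonneg _)) hJ
    _ = (1 + 2 * n) ^ (2 * n + 1) * (1 + 2 * n) ^ (2 * n + 1) *
        ((1 + ‖y' - y‖) ^ (2 * n + 1) * J) := by rw [mul_pow, mul_pow]; ring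
    _ ≤ _ := by gcongr

lemma phase_sum_bound (n : ℕ) (C₀ C : ℝ) (hC₀ : 0 < C₀) (hC : 0 ≤ C) : ∃ M : ℝ, 0 < M ∧
    ∀ (φ : Eu n × Eu n → ℝ) (hφ : GoodPhase n C₀ C φ) (N : ℕ),
      ‖∑ i : ↥(box n N) × ↥(box n N), (kph_kern hφ.smooth.continuous i.1.1 i.2.1).op‖ ≤ M := by
  obtain ⟨D, hD0, hD⟩ := kern_bound n C₀ C hC₀ hC
  obtain ⟨S, hS0, hS⟩ := lat_sum n (n + 1 / 2) (by linarith)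
  set v := vb n n
  have hv : 0 ≤ v := vb_nonneg n n
  refine ⟨√(D * v) * (S * S) + 1, by positivity, fun φ hφ N => ?_⟩
  let w : (Fin n → ℤ) → ℝ := fun m => (1 + ‖m‖) ^ (-((n : ℝ) + 1 / 2))
  have hw0 : ∀ m, 0 ≤ w m := fun m => by positivity
  have hw2 : ∀ m, w m ^ 2 = ((1 + ‖m‖) ^ (2 * n + 1))⁻¹ := by
    intro m
    have : 0 < 1 + ‖m‖ := by positivity
    simp only [w]
    rw [← Real.rpow_natCast, ← Real.rpow_mul this.le, ← Real.rpow_natCast (1 + ‖m‖) (2 * n + 1),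
      ← Real.rpow_neg this.le]
    congr 1
    push_cast; ring
  let γ : ↥(box n N) × ↥(box n N) → ↥(box n N) × ↥(box n N) → ℝ := fun i i' =>
    √(D * v) * (w (i.1.1 - i'.1.1) * w (i.2.1 - i'.2.1))
  have hγ2 : ∀ i i', γ i i' ^ 2 = D *
      (((1 + ‖i.1.1 - i'.1.1‖) * (1 + ‖i.2.1 - i'.2.1‖)) ^ (2 * n + 1))⁻¹ * v := by
    intro i i'
    simp only [γ]
    rw [mul_pow, mul_pow, Real.sq_sqrt (by positivity), hw2, hw2, mul_pow, mul_inv]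
    ring
  refine cotlar_stein ContinuousLinearMap.norm_id_le _ γ _ (by positivity)
    (fun i i' => ?_) (fun i i' => ?_) (fun i i' => ?_) (fun i => ?_)
  · have := hw0 (i.1.1 - i'.1.1); have := hw0 (i.2.1 - i'.2.1)
    simp only [γ]; positivity
  · rw [hγ2]
    refine Kern.norm_adj_op _ _ _ fun y y' => ?_
    rw [← div_eq_mul_inv, le_div_iff₀ (by positivity), mul_comm]
    exact hD φ hφ _ _ _ _ y y'
  · rw [hγ2]
    have e : ∀ i : ↥(box n N) × ↥(box n N), (kph_kern hφ.smooth.continuous i.1.1 i.2.1).op =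
        star (kph_kern hφ.smooth.continuous i.1.1 i.2.1).adj.op := by
      intro i
      rw [← Kern.adjoint_op, ← ContinuousLinearMap.star_eq_adjoint, star_star]
    have e2 : star (kph_kern hφ.smooth.continuous i'.1.1 i'.2.1).op =
        (kph_kern hφ.smooth.continuous i'.1.1 i'.2.1).adj.op := by
      rw [← Kern.adjoint_op, ← ContinuousLinearMap.star_eq_adjoint]
    rw [e2, e i]
    refine Kern.norm_adj_op _ _ _ fun ξ ξ' => ?_
    rw [← div_eq_mul_inv, le_div_iff₀ (by positivity), mul_comm]
    have := hD _ hφ.swap i'.2.1 i'.1.1 i.2.1 i.1.1 ξ' ξ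
    rw [norm_sub_rev i'.2.1, norm_sub_rev i'.1.1, mul_comm (1 + ‖_‖)] at this
    refine le_trans (le_of_eq ?_) this
    congr 2
    congr 1
    funext y
    rw [kph_swap φ, kph_swap φ, Complex.conj_conj, mul_comm]
  · have : ∑ i', γ i i' = √(D * v) * ((∑ j' ∈ box n N, w (i.1.1 - j')) *
        ∑ k' ∈ box n N, w (i.2.1 - k')) := by
      simp only [γ]
      rw [← Finset.mul_sum, Fintype.sum_prod_type, ← Finset.sum_coe_sort (box n N),
        ← Finset.sum_coe_sort (box n N) (fun k' => w (i.2.1 - k')), Finset.sum_mul_sum]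
    rw [this]
    have a1 := hS (box n N) i.1.1
    have a2 := hS (box n N) i.2.1
    have : √(D * v) * ((∑ j' ∈ box n N, w (i.1.1 - j')) * ∑ k' ∈ box n N, w (i.2.1 - k')) ≤
        √(D * v) * (S * S) := by
      gcongr
    linarith

lemma osc_prod_integrable {n : ℕ} {ψ : Eu n × Eu n → ℝ} (hψ : Continuous ψ) {g u : Eu n → ℂ}
    (hg : Integrable g) (hu : Integrable u) :
    Integrable (fun z : Eu n × Eu n => g z.1 * (osc (ψ z) * u z.2)) (volume.prod volume) := by
  have := (hg.mul_prod hu).bdd_mul (c := 1)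
    (f := fun z : Eu n × Eu n => osc (ψ z)) (continuous_osc.comp hψ).aestronglyMeasurable
    (Filter.Eventually.of_forall fun z => (norm_osc _).le)
  refine this.congr (Filter.Eventually.of_forall fun z => ?_)
  simp only
  ring

lemma phase_bilinear (n : ℕ) (C₀ C : ℝ) (hC₀ : 0 < C₀) (hC : 0 ≤ C) : ∃ M : ℝ, 0 < M ∧
    ∀ (φ : Eu n × Eu n → ℝ), GoodPhase n C₀ C φ → ∀ u g : Eu n → ℂ,
      Continuous u → HasCompactSupport u → Continuous g → HasCompactSupport g →
      ‖∫ ξ, ∫ y, g ξ * (osc (φ (y, ξ)) * u y)‖ ≤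
        M * (eLpNorm g 2 volume).toReal * (eLpNorm u 2 volume).toReal := by
  obtain ⟨M, hM0, hM⟩ := phase_sum_bound n C₀ C hC₀ hC
  refine ⟨M, hM0, fun φ hφ u g hu hus hg hgs => ?_⟩
  have hφc := hφ.smooth.continuous
  have hgi := hg.integrable_of_hasCompactSupport (μ := volume) hgs
  have hui := hu.integrable_of_hasCompactSupport (μ := volume) hus
  obtain ⟨N, hN⟩ : ∃ N : ℕ, (∀ y, u y ≠ 0 → ‖y‖ ≤ N) ∧ ∀ y, g y ≠ 0 → ‖y‖ ≤ N := by
    obtain ⟨r1, h1⟩ := hus.isBounded.exists_norm_le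
    obtain ⟨r2, h2⟩ := hgs.isBounded.exists_norm_le
    obtain ⟨N, hN⟩ := exists_nat_ge (max r1 r2)
    exact ⟨N, fun y hy => (h1 y (subset_tsupport _ hy)).trans ((le_max_left _ _).trans hN),
      fun y hy => (h2 y (subset_tsupport _ hy)).trans ((le_max_right _ _).trans hN)⟩
  have hum : MemLp u 2 volume := hu.memLp_of_hasCompactSupport hus
  have hcg : Continuous fun ξ => (starRingEnd ℂ) (g ξ) := Complex.continuous_conj.comp hg
  have hcgs : HasCompactSupport fun ξ => (starRingEnd ℂ) (g ξ) :=
    hgs.comp_left (g := fun z : ℂ => (starRingEnd ℂ) z) (by simp)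
  have hgm : MemLp (fun ξ => (starRingEnd ℂ) (g ξ)) 2 volume := hcg.memLp_of_hasCompactSupport hcgs
  set uL : L2 n := hum.toLp with huL
  set gL : L2 n := hgm.toLp with hgL
  set T : ↥(box n N) × ↥(box n N) → L2 n →L[ℂ] L2 n := fun i => (kph_kern hφc i.1.1 i.2.1).op with hT
  have hin : inner ℂ gL ((∑ i, T i) uL) = ∫ ξ, ∫ y, g ξ * (osc (φ (y, ξ)) * u y) := by
    have e1 : ∀ i, inner ℂ gL (T i uL) = ∫ z : Eu n × Eu n, (starRingEnd ℂ) (gL z.1) *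
        (kph φ i.1.1 i.2.1 z.1 z.2 * uL z.2) := by
      intro i
      rw [hT, Kern.inner_op, Measure.volume_eq_prod,
        integral_prod _ ((kph_kern hφc i.1.1 i.2.1).int2 uL gL)]
    have hI := osc_prod_integrable (ψ := fun z => φ (z.2, z.1)) (hφc.comp continuous_swap) hgi hui
    rw [sum_apply, inner_sum]
    simp only [e1]
    rw [← integral_finsetSum _ fun i _ => (kph_kern hφc i.1.1 i.2.1).int2 uL gL]
    rw [← integral_prod (fun z : Eu n × Eu n => g z.1 * (osc (φ (z.2, z.1)) * u z.2)) hI]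
    rw [Measure.volume_eq_prod]
    refine integral_congr_ae ?_
    have a1 : ∀ᵐ z : Eu n × Eu n ∂(volume.prod volume), gL z.1 = (starRingEnd ℂ) (g z.1) :=
      Measure.quasiMeasurePreserving_fst.ae hgm.coeFn_toLp
    have a2 : ∀ᵐ z : Eu n × Eu n ∂(volume.prod volume), uL z.2 = u z.2 :=
      Measure.quasiMeasurePreserving_snd.ae hum.coeFn_toLp
    filter_upwards [a1, a2] with z h1 h2
    rw [h1, h2, Complex.conj_conj, ← Finset.mul_sum, ← Finset.sum_mul]
    by_cases hu0 : u z.2 = 0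
    · simp [hu0]
    by_cases hg0 : g z.1 = 0
    · simp [hg0]
    congr 2
    simp only [kph]
    rw [← Finset.mul_sum, ← Complex.ofReal_sum]
    have : ∑ i : ↥(box n N) × ↥(box n N), chi (z.1 - lat i.2.1) * chi (z.2 - lat i.1.1) = 1 := by
      have e1 := chi_sum N z.1 (hN.2 _ hg0)
      have e2 := chi_sum N z.2 (hN.1 _ hu0)
      rw [← Finset.sum_coe_sort] at e1 e2
      rw [Fintype.sum_prod_type, Finset.sum_comm]
      dsimp only
      rw [← Finset.sum_mul_sum, e1, e2, one_mul]
    rw [this]; simp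
  rw [← hin]
  refine (norm_inner_le_norm _ _).trans ?_
  have n1 : ‖gL‖ = (eLpNorm g 2 volume).toReal := by
    rw [hgL, Lp.norm_toLp]
    congr 1
    exact eLpNorm_congr_norm_ae (Filter.Eventually.of_forall fun x => RCLike.norm_conj _)
  have n2 : ‖uL‖ = (eLpNorm u 2 volume).toReal := by rw [huL, Lp.norm_toLp]
  have n3 : ‖(∑ i, T i) uL‖ ≤ M * ‖uL‖ :=
    (ContinuousLinearMap.le_opNorm _ _).trans (by gcongr; exact hM φ hφ N)
  rw [← n1, ← n2]
  calc _ ≤ ‖gL‖ * (M * ‖uL‖) := by gcongr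
    _ = _ := by ring

theorem eLpNorm_two_sq {α : Type*} [MeasurableSpace α] {μ : Measure α} (f : α → ℂ) :
    eLpNorm f 2 μ ^ 2 = ∫⁻ x, ‖f x‖ₑ ^ 2 ∂μ := by
  rw [eLpNorm_eq_lintegral_rpow_enorm_toReal (by norm_num) (by norm_num)]
  simp only [ENNReal.toReal_ofNat, ENNReal.rpow_ofNat]
  rw [← ENNReal.rpow_natCast, ← ENNReal.rpow_mul]
  norm_num

theorem toReal_eLpNorm_two_sq {α : Type*} [MeasurableSpace α] {μ : Measure α} {f : α → ℂ}
    (hf : AEStronglyMeasurable f μ) :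
    (eLpNorm f 2 μ).toReal ^ 2 = ∫ x, ‖f x‖ ^ 2 ∂μ := by
  rw [← ENNReal.toReal_pow, eLpNorm_two_sq, integral_eq_lintegral_of_nonneg_ae
    (f := fun x => ‖f x‖ ^ 2) (Filter.Eventually.of_forall fun x => by positivity) (hf.norm.pow 2)]
  congr 1
  refine lintegral_congr fun x => ?_
  rw [ENNReal.ofReal_pow (norm_nonneg _), ofReal_norm]

theorem eLpNorm_two_le_of_sq {α : Type*} [MeasurableSpace α] {μ : Measure α} {f : α → ℂ} {M : ℝ≥0∞}
    (h : ∫⁻ x, ‖f x‖ₑ ^ 2 ∂μ ≤ M ^ 2) : eLpNorm f 2 μ ≤ M := by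
  rw [← eLpNorm_two_sq] at h
  exact (ENNReal.pow_le_pow_left_iff (by norm_num)).1 h

theorem exists_cut (n : ℕ) (R : ℝ) (hR : 0 < R) : ∃ c : Eu n → ℝ, ContDiff ℝ (⊤ : ℕ∞) c ∧
    HasCompactSupport c ∧ (∀ x, 0 ≤ c x) ∧ (∀ x, c x ≤ 1) ∧ ∀ x, ‖x‖ ≤ R → c x = 1 := by
  let c : ContDiffBump (0 : Eu n) := ⟨R, R + 1, hR, by linarith⟩
  exact ⟨c, c.contDiff, c.hasCompactSupport, fun x => c.nonneg, fun x => c.le_one,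
    fun x hx => c.one_of_mem_closedBall (by simpa using hx)⟩

theorem duality {n : ℕ} (k : ℕ∞) {h : Eu n → ℂ} (hk : ContDiff ℝ k h) {M : ℝ} (hM : 0 ≤ M)
    (H : ∀ ψ : Eu n → ℂ, ContDiff ℝ k ψ → HasCompactSupport ψ →
      ‖∫ x, h x * ψ x‖ ≤ M * (eLpNorm ψ 2 volume).toReal) :
    eLpNorm h 2 volume ≤ ENNReal.ofReal M := by
  have hc : Continuous h := hk.continuous
  have key : ∀ N : ℕ, ∫⁻ x in Metric.closedBall (0 : Eu n) (N + 1), ‖h x‖ₑ ^ 2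
      ≤ ENNReal.ofReal M ^ 2 := by
    intro N
    obtain ⟨c, hcs, hcc, hc0, hc1, hcR⟩ := exists_cut n (N + 1) (by positivity)
    have cc : HasCompactSupport (fun x => ((c x : ℝ) : ℂ)) :=
      hcc.comp_left (g := fun t : ℝ => (t : ℂ)) (by simp)
    have ck : ContDiff ℝ k (fun x => ((c x : ℝ) : ℂ)) :=
      Complex.ofRealCLM.contDiff.comp (hcs.of_le (by exact_mod_cast le_top))
    set ψ : Eu n → ℂ := fun x => ((c x : ℝ) : ℂ) * (starRingEnd ℂ) (h x) with hψ
    have ψk : ContDiff ℝ k ψ := ck.mul (Complex.conjCLE.contDiff.comp hk)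
    have ψc : HasCompactSupport ψ := cc.mul_right
    have h1 := H ψ ψk ψc
    set J : ℝ := ∫ x, c x * ‖h x‖ ^ 2 with hJ
    have hJi : Integrable (fun x => c x * ‖h x‖ ^ 2) :=
      (hcs.continuous.mul (hc.norm.pow 2)).integrable_of_hasCompactSupport
        hcc.mul_right
    have hJ0 : 0 ≤ J := integral_nonneg fun x => mul_nonneg (hc0 x) (by positivity)
    have e1 : ∫ x, h x * ψ x = (J : ℂ) := by
      rw [hJ, ← integral_complex_ofReal]
      refine integral_congr_ae (Filter.Eventually.of_forall fun x => ?_)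
      simp only [hψ]
      rw [mul_left_comm, Complex.mul_conj, Complex.normSq_eq_norm_sq]
      push_cast; ring
    have e2 : (eLpNorm ψ 2 volume).toReal ^ 2 ≤ J := by
      rw [toReal_eLpNorm_two_sq ψk.continuous.aestronglyMeasurable]
      have i1 : HasCompactSupport (fun x => ‖ψ x‖ ^ 2) :=
        ψc.comp_left (g := fun t : ℂ => ‖t‖ ^ 2) (by simp)
      have i2 : Continuous (fun x => ‖ψ x‖ ^ 2) := ψk.continuous.norm.pow 2
      have i3 : Integrable (fun x => ‖ψ x‖ ^ 2) := i2.integrable_of_hasCompactSupport i1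
      refine integral_mono i3 hJi fun x => ?_
      simp only [hψ, norm_mul, Complex.norm_real, RCLike.norm_conj, Real.norm_eq_abs,
        abs_of_nonneg (hc0 x), mul_pow]
      gcongr
      nlinarith [hc0 x, hc1 x]
    rw [e1, Complex.norm_real, Real.norm_eq_abs, abs_of_nonneg hJ0] at h1
    have e3 : J ≤ M ^ 2 := by
      set q := (eLpNorm ψ 2 volume).toReal
      by_contra hcon
      push Not at hcon
      have q0 : 0 ≤ q := ENNReal.toReal_nonneg
      have : M ^ 2 * q ^ 2 ≤ M ^ 2 * J := by gcongr
      have : J ^ 2 ≤ (M * q) ^ 2 := by gcongr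
      nlinarith [sq_nonneg M]
    rw [← ENNReal.ofReal_pow hM]
    refine le_trans ?_ (ENNReal.ofReal_le_ofReal e3)
    rw [hJ, ofReal_integral_eq_lintegral_ofReal hJi
      (Filter.Eventually.of_forall fun x => mul_nonneg (hc0 x) (by positivity))]
    refine le_trans ?_ (setLIntegral_le_lintegral (Metric.closedBall (0 : Eu n) (N + 1)) _)
    refine setLIntegral_mono' measurableSet_closedBall fun x hx => ?_
    rw [hcR x (by simpa using hx), one_mul, ENNReal.ofReal_pow (norm_nonneg _), ofReal_norm]
  refine eLpNorm_two_le_of_sq ?_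
  have hU : ⋃ N : ℕ, Metric.closedBall (0 : Eu n) (N + 1) = Set.univ := by
    refine Set.eq_univ_of_forall fun x => Set.mem_iUnion.2 ?_
    obtain ⟨N, hN⟩ := exists_nat_ge ‖x‖
    exact ⟨N, by simp; linarith⟩
  rw [← setLIntegral_univ, ← hU, setLIntegral_iUnion_of_directed]
  · exact iSup_le key
  · refine directed_of_isDirected_le fun i j hij => Metric.closedBall_subset_closedBall ?_
    gcongr

theorem cs_enorm {α : Type*} [MeasurableSpace α] {μ : Measure α} {f g : α → ℂ}
    (hf : AEStronglyMeasurable f μ) (hg : AEStronglyMeasurable g μ) :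
    ‖∫ x, f x * g x ∂μ‖ₑ ≤ eLpNorm f 2 μ * eLpNorm g 2 μ := by
  refine (enorm_integral_le_lintegral_enorm _).trans ?_
  simp only [enorm_mul]
  have := ENNReal.lintegral_mul_le_Lp_mul_Lq μ Real.HolderConjugate.two_two hf.enorm hg.enorm
  rw [eLpNorm_eq_lintegral_rpow_enorm_toReal (by norm_num) (by norm_num),
    eLpNorm_eq_lintegral_rpow_enorm_toReal (by norm_num) (by norm_num)]
  simpa using this

theorem cs_norm {α : Type*} [MeasurableSpace α] {μ : Measure α} {f g : α → ℂ}
    (hf : MemLp f 2 μ) (hg : MemLp g 2 μ) :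
    ‖∫ x, f x * g x ∂μ‖ ≤ (eLpNorm f 2 μ).toReal * (eLpNorm g 2 μ).toReal := by
  have := ENNReal.toReal_mono (ENNReal.mul_ne_top hf.2.ne hg.2.ne) (cs_enorm hf.1 hg.1)
  rwa [toReal_enorm, ENNReal.toReal_mul] at this

theorem cc_memLp {n : ℕ} {g : Eu n → ℂ} (hg : Continuous g) (hc : HasCompactSupport g) (p : ℝ≥0∞) :
    MemLp g p volume := hg.memLp_of_hasCompactSupport hc

theorem eLpNorm_fourier_schwartz {n : ℕ} (ψ : 𝓢(Eu n, ℂ)) :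
    eLpNorm (FourierTransform.fourier (ψ : Eu n → ℂ)) 2 volume = eLpNorm (ψ : Eu n → ℂ) 2 volume := by
  have h := SchwartzMap.norm_fourier_toL2_eq ψ
  rw [SchwartzMap.norm_toLp, SchwartzMap.norm_toLp] at h
  rw [← SchwartzMap.fourier_coe]
  exact (ENNReal.toReal_eq_toReal_iff' (SchwartzMap.memLp _ 2 volume).2.ne
    (SchwartzMap.memLp _ 2 volume).2.ne).1 h

theorem fourier_flip {n : ℕ} {f g : Eu n → ℂ} (hf : Integrable f) (hg : Integrable g) :
    ∫ ξ, FourierTransform.fourier f ξ * g ξ = ∫ x, f x * FourierTransform.fourier g x := by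
  have := VectorFourier.integral_fourierIntegral_smul_eq_flip (L := innerₗ (Eu n)) (μ := volume)
    (ν := volume) Real.continuous_fourierChar continuous_inner hf hg
  simpa using! this

theorem plancherel_cc {n : ℕ} {g : Eu n → ℂ} (hg : Continuous g) (hc : HasCompactSupport g) :
    eLpNorm (FourierTransform.fourier g) 2 volume ≤ eLpNorm g 2 volume := by
  have hgm := cc_memLp hg hc 2
  rw [← ENNReal.ofReal_toReal hgm.2.ne]
  refine duality ⊤ (Real.contDiff_fourier fun k _ => ?_) ENNReal.toReal_nonneg fun ψ hψ hψc => ?_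
  · exact ((continuous_norm.pow k).mul hg.norm).integrable_of_hasCompactSupport hc.norm.mul_left
  · rw [fourier_flip (hg.integrable_of_hasCompactSupport hc)
      (hψ.continuous.integrable_of_hasCompactSupport hψc)]
    have e := eLpNorm_fourier_schwartz (hψc.toSchwartzMap hψ)
    have e0 : ((hψc.toSchwartzMap hψ : 𝓢(Eu n, ℂ)) : Eu n → ℂ) = ψ := by ext; simp
    have m : MemLp (FourierTransform.fourier ψ) 2 volume := by
      have := SchwartzMap.memLp (FourierTransform.fourier (hψc.toSchwartzMap hψ)) 2 volume
      rwa [SchwartzMap.fourier_coe, e0] at this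
    rw [e0] at e
    rw [← e]
    exact cs_norm hgm m

theorem osc_param_continuous {n : ℕ} {ψ : Eu n × Eu n → ℝ} (hψ : Continuous ψ) {u : Eu n → ℂ}
    (hu : Integrable u) : Continuous fun ξ => ∫ y, osc (ψ (y, ξ)) * u y := by
  refine continuous_of_dominated (F := fun ξ y => osc (ψ (y, ξ)) * u y)
    (bound := fun y => ‖u y‖) (fun ξ => ?_) (fun ξ => ?_) hu.norm ?_
  · exact (continuous_osc.comp (hψ.comp (by fun_prop))).aestronglyMeasurable.mul hu.1
  · exact Filter.Eventually.of_forall fun y => by simp [norm_osc]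
  · exact Filter.Eventually.of_forall fun y =>
      (continuous_osc.comp (hψ.comp (by fun_prop))).mul continuous_const

/-- `L²` bound for the phase operator on Schwartz functions. -/
theorem phase_schwartz (n : ℕ) (C₀ C : ℝ) (hC₀ : 0 < C₀) (hC : 0 ≤ C) : ∃ M : ℝ, 0 < M ∧
    ∀ φ : Eu n × Eu n → ℝ, GoodPhase n C₀ C φ → ∀ u : 𝓢(Eu n, ℂ),
      Continuous (fun ξ => ∫ y, osc (φ (y, ξ)) * u y) ∧
      eLpNorm (fun ξ => ∫ y, osc (φ (y, ξ)) * u y) 2 volume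
        ≤ ENNReal.ofReal M * eLpNorm u 2 volume := by
  obtain ⟨M, hM, H⟩ := phase_bilinear n C₀ C hC₀ hC
  refine ⟨M, hM, fun φ hφ u => ?_⟩
  have hφc : Continuous φ := hφ.smooth.continuous
  have hui : Integrable (u : Eu n → ℂ) := u.integrable
  have hum : MemLp (u : Eu n → ℂ) 2 volume := u.memLp 2 volume
  have c1 := osc_param_continuous hφc hui
  refine ⟨c1, ?_⟩
  rw [← ENNReal.ofReal_toReal hum.2.ne, ← ENNReal.ofReal_mul hM.le]
  refine duality 0 (contDiff_zero.2 c1) (by positivity) fun g hg hgc => ?_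
  have hg' := contDiff_zero.1 hg
  have hgi := hg'.integrable_of_hasCompactSupport (μ := volume) hgc
  have hgm := cc_memLp hg' hgc 2
  -- the transposed operator
  have c2 : Continuous fun y => ∫ ξ, osc (φ (y, ξ)) * g ξ :=
    osc_param_continuous (ψ := fun z => φ (z.2, z.1)) (hφc.comp continuous_swap) hgi
  have b2 : eLpNorm (fun y => ∫ ξ, osc (φ (y, ξ)) * g ξ) 2 volume
      ≤ ENNReal.ofReal (M * (eLpNorm g 2 volume).toReal) := by
    refine duality 0 (contDiff_zero.2 c2) (by positivity) fun v hv hvc => ?_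
    have hv' := contDiff_zero.1 hv
    have hvi := hv'.integrable_of_hasCompactSupport (μ := volume) hvc
    refine le_of_eq_of_le ?_ (H φ hφ v g hv' hvc hg' hgc)
    congr 1
    have hI := osc_prod_integrable (ψ := fun z => φ (z.2, z.1)) (hφc.comp continuous_swap) hgi hvi
    rw [integral_integral_swap hI]
    refine integral_congr_ae (Filter.Eventually.of_forall fun y => ?_)
    dsimp only
    rw [← integral_mul_const]
    refine integral_congr_ae (Filter.Eventually.of_forall fun ξ => ?_)
    dsimp only; ring
  have hI := osc_prod_integrable (ψ := fun z => φ (z.2, z.1)) (hφc.comp continuous_swap) hgi hui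
  have e : ∫ ξ, (∫ y, osc (φ (y, ξ)) * u y) * g ξ
      = ∫ y, u y * ∫ ξ, osc (φ (y, ξ)) * g ξ := by
    trans ∫ ξ, ∫ y, g ξ * (osc (φ (y, ξ)) * u y)
    · refine integral_congr_ae (Filter.Eventually.of_forall fun ξ => ?_)
      dsimp only
      rw [← integral_mul_const]
      refine integral_congr_ae (Filter.Eventually.of_forall fun y => ?_)
      dsimp only; ring
    rw [integral_integral_swap hI]
    refine integral_congr_ae (Filter.Eventually.of_forall fun y => ?_)
    dsimp only
    rw [← integral_const_mul]
    refine integral_congr_ae (Filter.Eventually.of_forall fun ξ => ?_)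
    dsimp only; ring
  rw [e]
  refine (cs_norm hum ⟨c2.aestronglyMeasurable, b2.trans_lt ENNReal.ofReal_lt_top⟩).trans ?_
  have := ENNReal.toReal_mono ENNReal.ofReal_ne_top b2
  rw [ENNReal.toReal_ofReal (by positivity)] at this
  calc _ ≤ (eLpNorm u 2 volume).toReal * (M * (eLpNorm g 2 volume).toReal) := by gcongr
    _ = _ := by ring

/-- derivative lists: nothing, or `s` times the same coordinate -/
def ol {n : ℕ} (s : ℕ) : Option (Fin n) → List (Fin n)
  | none => []
  | some i => List.replicate s i

/-- Fourier weight corresponding to `ol` -/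
def wo {n : ℕ} (s : ℕ) : Option (Fin n) → Eu n → ℝ
  | none => fun _ => 1
  | some i => fun μ => |2 * π * μ i| ^ s

/-- total weight -/
def wM {n : ℕ} (s : ℕ) (μ : Eu n) : ℝ := ∑ o : Option (Fin n), wo s o μ ^ 2

theorem wo_continuous {n : ℕ} (s : ℕ) (o : Option (Fin n)) : Continuous (wo s o) := by
  cases o with
  | none => exact continuous_const
  | some i => simp only [wo]; fun_prop

theorem wM_continuous {n : ℕ} (s : ℕ) : Continuous (wM (n := n) s) :=
  continuous_finsetSum _ fun o _ => (wo_continuous s o).pow 2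

theorem one_le_wM {n : ℕ} (s : ℕ) (μ : Eu n) : 1 ≤ wM s μ := by
  unfold wM
  rw [Fintype.sum_option]
  simp only [wo, one_pow, le_add_iff_nonneg_right]
  positivity

theorem schwartz_dLine {n : ℕ} (f : 𝓢(Eu n, ℂ)) (v : Eu n) :
    ((LineDeriv.lineDerivOp v f : 𝓢(Eu n, ℂ)) : Eu n → ℂ) = dLine v f := by
  ext x
  rw [SchwartzMap.lineDerivOp_apply_eq_fderiv]; rfl

theorem fourierInv_dLine {n : ℕ} (f : 𝓢(Eu n, ℂ)) (i : Fin n) (μ : Eu n) :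
    ‖FourierTransformInv.fourierInv (LineDeriv.lineDerivOp (bas i) f : 𝓢(Eu n, ℂ)) μ‖
      = |2 * π * μ i| * ‖FourierTransformInv.fourierInv f μ‖ := by
  rw [SchwartzMap.fourierInv_lineDerivOp_eq]
  have h : (fun x : Eu n => inner ℝ x (bas i)).HasTemperateGrowth := by fun_prop
  have h2 : inner ℝ μ (bas i) = μ i := by simp [bas, PiLp.inner_apply]
  simp only [smul_apply, SchwartzMap.smulLeftCLM_apply_apply h, norm_smul, h2]
  simp [abs_mul, abs_of_pos Real.pi_pos]
  ring

theorem schwartz_iter {n : ℕ} (f : 𝓢(Eu n, ℂ)) (s : ℕ) (o : Option (Fin n)) :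
    ∃ g : 𝓢(Eu n, ℂ), (g : Eu n → ℂ) = dList bas (ol s o) f ∧
      ∀ μ, ‖FourierTransformInv.fourierInv g μ‖ = wo s o μ * ‖FourierTransformInv.fourierInv f μ‖ := by
  cases o with
  | none => exact ⟨f, rfl, fun μ => by simp [wo]⟩
  | some i =>
    simp only [ol, wo]
    induction s with
    | zero => exact ⟨f, rfl, fun μ => by simp⟩
    | succ k ih =>
      obtain ⟨g, h1, h2⟩ := ih
      refine ⟨LineDeriv.lineDerivOp (bas i) g, ?_, fun μ => ?_⟩
      · rw [schwartz_dLine, h1]; rfl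
      · rw [fourierInv_dLine, h2]; ring

theorem eLpNorm_fourierInv_schwartz {n : ℕ} (ψ : 𝓢(Eu n, ℂ)) :
    eLpNorm (FourierTransformInv.fourierInv ψ : 𝓢(Eu n, ℂ)) 2 volume = eLpNorm (ψ : Eu n → ℂ) 2 volume := by
  have h := eLpNorm_fourier_schwartz (FourierTransformInv.fourierInv ψ)
  rw [← SchwartzMap.fourier_coe, FourierTransform.fourier_fourierInv_eq] at h
  exact h.symm

/-- the dual Sobolev quantity -/
def NN {n : ℕ} (s : ℕ) (F : Eu n → ℂ) : ℝ≥0∞ :=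
  ∫⁻ μ, ‖FourierTransform.fourier F μ‖ₑ ^ 2 * ENNReal.ofReal (1 / wM s μ)

theorem sobolev_one {n : ℕ} (s : ℕ) {b F : Eu n → ℂ} (hb : ContDiff ℝ (⊤ : ℕ∞) b)
    (hbc : HasCompactSupport b) (hF : Continuous F) (hFc : HasCompactSupport F) :
    ‖∫ x, b x * F x‖ₑ ^ 2 ≤ (∑ o : Option (Fin n), ∫⁻ x, ‖dList bas (ol s o) b x‖ₑ ^ 2) * NN s F := by
  set bS : 𝓢(Eu n, ℂ) := hbc.toSchwartzMap hb with hbS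
  have e0 : (bS : Eu n → ℂ) = b := by ext; simp [hbS]
  set β : 𝓢(Eu n, ℂ) := FourierTransformInv.fourierInv bS with hβ
  have hFi : Integrable F := hF.integrable_of_hasCompactSupport hFc
  have e1 : ∫ x, b x * F x = ∫ x, β x * FourierTransform.fourier F x := by
    rw [← fourier_flip β.integrable hFi, ← SchwartzMap.fourier_coe, hβ,
      FourierTransform.fourier_fourierInv_eq, e0]
  have cF : Continuous (FourierTransform.fourier F) :=
    (Real.contDiff_fourier (f := F) (N := 0) fun k _ =>
      ((continuous_norm.pow k).mul hF.norm).integrable_of_hasCompactSupport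
        hFc.norm.mul_left).continuous
  set r : Eu n → ℝ := fun μ => Real.sqrt (wM s μ) with hr
  have r0 : ∀ μ, 0 < r μ := fun μ => Real.sqrt_pos.2 (lt_of_lt_of_le one_pos (one_le_wM s μ))
  have rc : Continuous r := (wM_continuous s).sqrt
  have rsq : ∀ μ, r μ ^ 2 = wM s μ := fun μ => Real.sq_sqrt (zero_le_one.trans (one_le_wM s μ))
  have e2 : ∫ x, β x * FourierTransform.fourier F x
      = ∫ x, ((r x : ℂ) * β x) * ((((r x)⁻¹ : ℝ) : ℂ) * FourierTransform.fourier F x) := by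
    refine integral_congr_ae (Filter.Eventually.of_forall fun x => ?_)
    have : (r x : ℂ) ≠ 0 := by exact_mod_cast (r0 x).ne'
    dsimp only; push_cast; field_simp
  have rc' : Continuous fun x => (r x)⁻¹ := rc.inv₀ fun x => (r0 x).ne'
  have c1 : Continuous fun x => (r x : ℂ) * β x := (Complex.continuous_ofReal.comp rc).mul β.continuous
  have c2 : Continuous fun x => (((r x)⁻¹ : ℝ) : ℂ) * FourierTransform.fourier F x :=
    (Complex.continuous_ofReal.comp rc').mul cF
  rw [e1, e2]
  refine (pow_le_pow_left₀ (zero_le) (cs_enorm c1.aestronglyMeasurable c2.aestronglyMeasurable) 2).trans ?_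
  rw [mul_pow, eLpNorm_two_sq, eLpNorm_two_sq]
  refine mul_le_mul' (le_of_eq ?_) (le_of_eq ?_)
  · choose g hg1 hg2 using fun o => schwartz_iter bS s o
    have : ∀ o, ∫⁻ x, ‖dList bas (ol s o) b x‖ₑ ^ 2
        = ∫⁻ μ, ENNReal.ofReal (wo s o μ ^ 2) * ‖β μ‖ₑ ^ 2 := by
      intro o
      rw [← e0, ← hg1, ← eLpNorm_two_sq, ← eLpNorm_fourierInv_schwartz, eLpNorm_two_sq]
      refine lintegral_congr fun μ => ?_
      rw [← ofReal_norm, hg2, ENNReal.ofReal_mul (by cases o <;> simp only [wo] <;> positivity),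
        mul_pow, ENNReal.ofReal_pow (by cases o <;> simp only [wo] <;> positivity), ofReal_norm]
    simp only [this]
    rw [← lintegral_finsetSum]
    · refine lintegral_congr fun μ => ?_
      rw [← Finset.sum_mul, ← ENNReal.ofReal_sum_of_nonneg fun _ _ => by positivity]
      rw [enorm_mul, mul_pow]
      congr 1
      rw [← ofReal_norm, Complex.norm_real, Real.norm_eq_abs, abs_of_pos (r0 μ),
        ← ENNReal.ofReal_pow (r0 μ).le, rsq]
      rfl
    · intro o _
      exact ((((wo_continuous s o).pow 2).measurable).ennreal_ofReal).mul
        (β.continuous.enorm.measurable.pow_const 2)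
  · unfold NN
    refine lintegral_congr fun μ => ?_
    rw [enorm_mul, mul_pow, mul_comm]
    congr 1
    rw [← ofReal_norm, Complex.norm_real, Real.norm_eq_abs, abs_of_pos (inv_pos.2 (r0 μ)),
        ← ENNReal.ofReal_pow (inv_pos.2 (r0 μ)).le, inv_pow, rsq, one_div]

theorem dLine_hasCompactSupport {W F : Type*} [NormedAddCommGroup W] [NormedSpace ℝ W]
    [NormedAddCommGroup F] [NormedSpace ℝ F] {g : W → F} (hg : HasCompactSupport g) (v : W) :
    HasCompactSupport (dLine v g) :=
  hg.fderiv (𝕜 := ℝ) |>.comp_left (g := fun L : W →L[ℝ] F => L v) (by simp)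

theorem dList_hasCompactSupport {W F ι : Type*} [NormedAddCommGroup W] [NormedSpace ℝ W]
    [NormedAddCommGroup F] [NormedSpace ℝ F] {g : W → F} (hg : HasCompactSupport g) (d : ι → W)
    (l : List ι) : HasCompactSupport (dList d l g) := by
  induction l with
  | nil => exact hg
  | cons i l ih => exact dLine_hasCompactSupport ih _

theorem par_compact {n : ℕ} {B : Eu n × Eu n → ℂ} (hc : HasCompactSupport B) (G : Eu n → ℂ) :
    HasCompactSupport fun x => ∫ ξ, B (x, ξ) * G ξ := by
  refine HasCompactSupport.intro (hc.isCompact.image continuous_fst) fun x hx => ?_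
  have : ∀ ξ, B (x, ξ) = 0 := fun ξ => by
    by_contra h
    exact hx ⟨(x, ξ), subset_tsupport _ h, rfl⟩
  simp [this]

theorem par_slice_compact {n : ℕ} {B : Eu n × Eu n → ℂ} (hc : HasCompactSupport B) (x : Eu n) :
    HasCompactSupport fun ξ => B (x, ξ) := by
  refine HasCompactSupport.intro (hc.isCompact.image continuous_snd) fun ξ hx => ?_
  by_contra h
  exact hx ⟨(x, ξ), subset_tsupport _ h, rfl⟩

theorem par_contDiff {n : ℕ} {B : Eu n × Eu n → ℂ} (hB : ContDiff ℝ (⊤ : ℕ∞) B)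
    (hc : HasCompactSupport B) {G : Eu n → ℂ} (hG : Continuous G) :
    ContDiff ℝ (⊤ : ℕ∞) fun x => ∫ ξ, B (x, ξ) * G ξ := by
  have h := contDiffOn_convolution_right_with_param_comp (n := ⊤) (μ := (volume : Measure (Eu n)))
    (ContinuousLinearMap.mul ℝ ℂ)
    (s := Set.univ) (v := fun _ : Eu n => (0 : Eu n)) contDiffOn_const (f := G)
    (g := fun x ξ => B (x, -ξ)) (k := -(Prod.snd '' tsupport B)) isOpen_univ
    (hc.isCompact.image continuous_snd).neg ?_ hG.locallyIntegrable ?_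
  · rw [contDiffOn_univ] at h
    convert h using 2 with x
    simp only [MeasureTheory.convolution_def, ContinuousLinearMap.mul_apply', zero_sub, neg_neg]
    refine integral_congr_ae (Filter.Eventually.of_forall fun ξ => mul_comm _ _)
  · intro x ξ _ hξ
    by_contra hne
    exact hξ (by simpa using ⟨x, subset_tsupport _ hne⟩)
  · exact (hB.comp (contDiff_fst.prodMk contDiff_snd.neg)).contDiffOn

theorem par_dLine {n : ℕ} {B : Eu n × Eu n → ℂ} (hB : ContDiff ℝ (⊤ : ℕ∞) B)
    (hc : HasCompactSupport B) {G : Eu n → ℂ} (hG : Continuous G) (hGc : HasCompactSupport G)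
    (i : Fin n) :
    dLine (bas i) (fun x => ∫ ξ, B (x, ξ) * G ξ) = fun x => ∫ ξ, dLine (dX i) B (x, ξ) * G ξ := by
  funext x
  have hd : DifferentiableAt ℝ (fun x => ∫ ξ, B (x, ξ) * G ξ) x :=
    smooth_diff (par_contDiff hB hc hG) x
  have h1 := hd.hasFDerivAt.hasLineDerivAt (bas i)
  have hD := dLine_contDiff hB (dX i)
  have hDc := dLine_hasCompactSupport hc (dX i)
  obtain ⟨K, hK⟩ := hDc.exists_bound_of_continuous hD.continuous
  have hGi : Integrable G := hG.integrable_of_hasCompactSupport hGc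
  have h2 : HasDerivAt (fun t : ℝ => ∫ ξ, B (x + t • bas i, ξ) * G ξ)
      (∫ ξ, dLine (dX i) B (x + (0 : ℝ) • bas i, ξ) * G ξ) 0 := by
    refine (hasDerivAt_integral_of_dominated_loc_of_deriv_le (bound := fun ξ => K * ‖G ξ‖)
      (F' := fun t ξ => dLine (dX i) B (x + t • bas i, ξ) * G ξ) Filter.univ_mem
      (Filter.Eventually.of_forall fun t => ?_) ?_ ?_ ?_ (hGi.norm.const_mul K) ?_).2
    · exact ((hB.continuous.comp (by fun_prop)).mul hG).aestronglyMeasurable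
    · exact ((hB.continuous.comp (by fun_prop)).mul hG).integrable_of_hasCompactSupport hGc.mul_left
    · exact ((hD.continuous.comp (by fun_prop)).mul hG).aestronglyMeasurable
    · refine Filter.Eventually.of_forall fun ξ t _ => ?_
      rw [norm_mul]
      gcongr
      exact hK _
    · refine Filter.Eventually.of_forall fun ξ t _ => ?_
      refine HasDerivAt.mul_const ?_ _
      have e : HasDerivAt (fun t : ℝ => ((x + t • bas i, ξ) : Eu n × Eu n)) (dX i) t := by
        have e1 : HasDerivAt (fun t : ℝ => x + t • bas i) (bas i) t := by
          simpa using ((hasDerivAt_id t).smul_const (bas i)).const_add x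
        exact e1.prodMk (hasDerivAt_const t ξ)
      exact (smooth_diff hB _).hasFDerivAt.comp_hasDerivAt t e
  have h3 := HasDerivAt.unique h1 h2
  simpa [dLine] using h3

theorem par_dList {n : ℕ} {B : Eu n × Eu n → ℂ} (hB : ContDiff ℝ (⊤ : ℕ∞) B)
    (hc : HasCompactSupport B) {G : Eu n → ℂ} (hG : Continuous G) (hGc : HasCompactSupport G)
    (l : List (Fin n)) :
    dList bas l (fun x => ∫ ξ, B (x, ξ) * G ξ) = fun x => ∫ ξ, dList dX l B (x, ξ) * G ξ := by
  induction l with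
  | nil => rfl
  | cons i l ih =>
    rw [dList_cons, ih, par_dLine (dList_contDiff l hB) (dList_hasCompactSupport hc _ l) hG hGc]
    rfl

theorem sobolev_two {n : ℕ} (s : ℕ) {B : Eu n × Eu n → ℂ} (hB : ContDiff ℝ (⊤ : ℕ∞) B)
    (hc : HasCompactSupport B) {F G : Eu n → ℂ} (hF : Continuous F) (hFc : HasCompactSupport F)
    (hG : Continuous G) (hGc : HasCompactSupport G) :
    ‖∫ x, (∫ ξ, B (x, ξ) * G ξ) * F x‖ₑ ^ 2 ≤
      (∑ o : Option (Fin n), ∑ o' : Option (Fin n),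
        ∫⁻ x, ∫⁻ ξ, ‖dList dY (ol s o') (dList dX (ol s o) B) (x, ξ)‖ₑ ^ 2) * (NN s F * NN s G) := by
  refine (sobolev_one s (par_contDiff hB hc hG) (par_compact hc G) hF hFc).trans ?_
  rw [mul_comm (NN s F), ← mul_assoc]
  gcongr
  rw [Finset.sum_mul]
  refine Finset.sum_le_sum fun o _ => ?_
  set B' := dList dX (ol s o) B with hB'
  have b1 : ContDiff ℝ (⊤ : ℕ∞) B' := dList_contDiff _ hB
  have b2 : HasCompactSupport B' := dList_hasCompactSupport hc _ _
  rw [par_dList hB hc hG hGc]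
  have key : ∀ x, ‖∫ ξ, B' (x, ξ) * G ξ‖ₑ ^ 2 ≤
      (∑ o' : Option (Fin n), ∫⁻ ξ, ‖dList dY (ol s o') B' (x, ξ)‖ₑ ^ 2) * NN s G := by
    intro x
    have := sobolev_one s (b := fun ξ => B' (x, ξ)) (b1.comp (contDiff_prodMk_right x))
      (par_slice_compact b2 x) hG hGc
    simpa only [dList_restrict_snd b1] using this
  refine (lintegral_mono key).trans ?_
  have hm : ∀ o', Measurable fun z : Eu n × Eu n => ‖dList dY (ol s o') B' z‖ₑ ^ 2 := fun o' =>
    (dList_contDiff _ b1).continuous.enorm.measurable.pow_const 2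
  rw [lintegral_mul_const _ (Finset.measurable_fun_sum _ fun o' _ => (hm o').lintegral_prod_right'),
    lintegral_finsetSum _ fun o' _ => (hm o').lintegral_prod_right']

section leib
variable {W ι : Type*} [NormedAddCommGroup W] [NormedSpace ℝ W]

theorem dList_add' {d : ι → W} (l : List ι) {f g : W → ℂ} (hf : ContDiff ℝ (⊤ : ℕ∞) f)
    (hg : ContDiff ℝ (⊤ : ℕ∞) g) :
    dList d l (fun z => f z + g z) = fun z => dList d l f z + dList d l g z := by
  induction l with
  | nil => rfl
  | cons i l ih =>
    rw [dList_cons, ih, dLine_add (smooth_diff (dList_contDiff l hf)) (smooth_diff (dList_contDiff l hg))]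
    rfl

theorem leibniz_le {d : ι → W} (l : List ι) {w a : W → ℂ} (hw : ContDiff ℝ (⊤ : ℕ∞) w)
    (ha : ContDiff ℝ (⊤ : ℕ∞) a) (z : W) (C : ℝ)
    (hC : ∀ l' : List ι, l'.length ≤ l.length → ‖dList d l' w z‖ ≤ C) :
    ‖dList d l (fun p => w p * a p) z‖ ≤ C * (l.sublists'.map fun l' => ‖dList d l' a z‖).sum := by
  induction l generalizing w a with
  | nil =>
    have := hC [] le_rfl
    simp only [dList_nil] at this
    simp
    gcongr
  | cons i l ih =>
    rw [dList_cons, dLine_dList_comm d _ l (hw.mul ha), dLine_mul (smooth_diff hw) (smooth_diff ha),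
      dList_add' l ((dLine_contDiff hw _).mul ha) (hw.mul (dLine_contDiff ha _))]
    refine (norm_add_le _ _).trans ?_
    have h1 := ih (dLine_contDiff hw (d i)) ha fun l' hl' => by
      rw [← dLine_dList_comm d _ l' hw]
      exact hC (i :: l') (by simpa using hl')
    have h2 := ih hw (dLine_contDiff ha (d i)) fun l' hl' => hC l' (by simp; omega)
    rw [List.sublists'_cons, List.map_append, List.sum_append, mul_add, List.map_map]
    refine add_le_add h1 (h2.trans (le_of_eq ?_))
    congr 2
    refine List.map_congr_left fun l' _ => ?_
    simp only [Function.comp, dList_cons]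
    rw [dLine_dList_comm d _ l' ha]

theorem dList_bound_exists [Finite ι] {d : ι → W} (m : ℕ) {f : W → ℂ} (hf : ContDiff ℝ (⊤ : ℕ∞) f)
    (hs : HasCompactSupport f) :
    ∃ C, 0 ≤ C ∧ ∀ l : List ι, l.length ≤ m → ∀ z, ‖dList d l f z‖ ≤ C := by
  have hfin : {l : List ι | l.length ≤ m}.Finite := List.finite_length_le ι m
  have hb : ∀ l : List ι, ∃ C, ∀ z, ‖dList d l f z‖ ≤ C := fun l =>
    (dList_hasCompactSupport hs d l).exists_bound_of_continuous (dList_contDiff l hf).continuous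
  choose D hD using hb
  obtain ⟨C, hC⟩ := (hfin.image D).bddAbove
  refine ⟨max C 0, le_max_right _ _, fun l hl z => (hD l z).trans ?_⟩
  exact (hC ⟨l, hl, rfl⟩).trans (le_max_left _ _)

theorem dList_sub_const {d : ι → W} (l : List ι) (f : W → ℂ) (q : W) :
    dList d l (fun p => f (p - q)) = fun p => dList d l f (p - q) := by
  induction l with
  | nil => rfl
  | cons i l ih =>
    rw [dList_cons, ih, dList_cons]
    funext y
    simp only [dLine]
    rw [fderiv_comp_sub]

theorem tsupport_dList_subset {d : ι → W} (l : List ι) (f : W → ℂ) :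
    tsupport (dList d l f) ⊆ tsupport f := by
  induction l with
  | nil => exact subset_rfl
  | cons i l ih => exact (tsupport_dLine_subset _ _).trans ih

theorem dList_map {κ : Type*} (d : ι → W) (h : κ → ι) (l : List κ) (f : W → ℂ) :
    dList d (l.map h) f = dList (fun k => d (h k)) l f := by
  induction l with
  | nil => rfl
  | cons i l ih => rw [List.map_cons, dList_cons, ih]; rfl

end leib

/-- all coordinate directions -/
def dXY {n : ℕ} : Fin n ⊕ Fin n → Eu n × Eu n := Sum.elim dX dY

/-- combined lists -/
def ll {n : ℕ} (s : ℕ) (o o' : Option (Fin n)) : List (Fin n ⊕ Fin n) :=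
  (ol s o').map Sum.inr ++ (ol s o).map Sum.inl

theorem dList_ll {n : ℕ} (l l' : List (Fin n)) (f : Eu n × Eu n → ℂ) :
    dList dXY (l'.map Sum.inr ++ l.map Sum.inl) f = dList dY l' (dList dX l f) := by
  rw [dList_append, dList_map, dList_map]; rfl

theorem ol_length {n : ℕ} (s : ℕ) (o : Option (Fin n)) : (ol s o).length ≤ s := by
  cases o <;> simp [ol]

/-- sum of all relevant derivatives -/
def SS {n : ℕ} (s : ℕ) (a : Eu n × Eu n → ℂ) (z : Eu n × Eu n) : ℝ :=
  ∑ o, ∑ o', ((ll s o o').sublists'.map fun l' => ‖dList dXY l' a z‖).sum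

theorem list_sum_continuous {n : ℕ} (L : List (List (Fin n ⊕ Fin n))) {a : Eu n × Eu n → ℂ}
    (ha : ContDiff ℝ (⊤ : ℕ∞) a) :
    Continuous fun z => (L.map fun l' => ‖dList dXY l' a z‖).sum := by
  induction L with
  | nil => simpa using continuous_const
  | cons l L ih =>
    simp only [List.map_cons, List.sum_cons]
    exact (dList_contDiff l ha).continuous.norm.add ih

theorem list_sum_nonneg' {n : ℕ} (L : List (List (Fin n ⊕ Fin n))) (a : Eu n × Eu n → ℂ)
    (z : Eu n × Eu n) : 0 ≤ (L.map fun l' => ‖dList dXY l' a z‖).sum :=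
  List.sum_nonneg (by simp only [List.mem_map]; rintro _ ⟨l, _, rfl⟩; positivity)

theorem list_sum_eLpNorm {n : ℕ} (L : List (List (Fin n ⊕ Fin n))) {a : Eu n × Eu n → ℂ}
    (ha : ContDiff ℝ (⊤ : ℕ∞) a) {p A : ℝ≥0∞} (hp : 1 ≤ p)
    (h : ∀ l ∈ L, eLpNorm (dList dXY l a) p volume ≤ A) :
    eLpNorm (fun z => (L.map fun l' => ‖dList dXY l' a z‖).sum) p volume ≤ L.length * A := by
  induction L with
  | nil => simp
  | cons l L ih =>
    simp only [List.map_cons, List.sum_cons]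
    refine (eLpNorm_add_le (dList_contDiff l ha).continuous.norm.aestronglyMeasurable
      (list_sum_continuous L ha).aestronglyMeasurable hp).trans ?_
    rw [eLpNorm_norm]
    have h1 := h l (by simp)
    have h2 := ih fun l' hl' => h l' (by simp [hl'])
    refine (add_le_add h1 h2).trans (le_of_eq ?_)
    simp only [List.length_cons]; push_cast; ring

theorem SS_continuous {n : ℕ} (s : ℕ) {a : Eu n × Eu n → ℂ} (ha : ContDiff ℝ (⊤ : ℕ∞) a) :
    Continuous (SS s a) :=
  continuous_finsetSum _ fun _ _ => continuous_finsetSum _ fun _ _ => list_sum_continuous _ ha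

theorem SS_nonneg {n : ℕ} (s : ℕ) (a : Eu n × Eu n → ℂ) (z) : 0 ≤ SS s a z :=
  Finset.sum_nonneg fun _ _ => Finset.sum_nonneg fun _ _ => list_sum_nonneg' _ _ _

theorem SS_eLpNorm {n : ℕ} (s : ℕ) : ∃ N : ℕ, ∀ {a : Eu n × Eu n → ℂ}, ContDiff ℝ (⊤ : ℕ∞) a →
    ∀ {p A : ℝ≥0∞}, 1 ≤ p → (∀ l l' : List (Fin n), l.length ≤ s → l'.length ≤ s →
      eLpNorm (dList dY l' (dList dX l a)) p volume ≤ A) →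
    eLpNorm (SS s a) p volume ≤ N * A := by
  refine ⟨∑ o : Option (Fin n), ∑ o' : Option (Fin n), (ll s o o').sublists'.length,
    fun {a} ha {p A} hp h => ?_⟩
  have e : SS s a = ∑ o, ∑ o', fun z => ((ll s o o').sublists'.map fun l' => ‖dList dXY l' a z‖).sum := by
    funext z; simp [SS]
  rw [e]
  push_cast
  rw [Finset.sum_mul]
  refine (eLpNorm_sum_le (fun o _ => ?_) hp).trans (Finset.sum_le_sum fun o _ => ?_)
  · exact Finset.aestronglyMeasurable_sum _ fun o' _ => (list_sum_continuous _ ha).aestronglyMeasurable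
  rw [Finset.sum_mul]
  refine (eLpNorm_sum_le (fun o _ => (list_sum_continuous _ ha).aestronglyMeasurable) hp).trans
    (Finset.sum_le_sum fun o' _ => ?_)
  refine list_sum_eLpNorm _ ha hp fun l hl => ?_
  rw [List.mem_sublists', ll, List.sublist_append_iff] at hl
  obtain ⟨l1, l2, rfl, h1, h2⟩ := hl
  rw [List.sublist_map_iff] at h1 h2
  obtain ⟨m1, hm1, rfl⟩ := h1
  obtain ⟨m2, hm2, rfl⟩ := h2
  rw [dList_ll]
  exact h _ _ (hm2.length_le.trans (ol_length _ _)) (hm1.length_le.trans (ol_length _ _))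

/-- the window -/
def win {n : ℕ} (p : Eu n × Eu n) : ℂ := ((chi p.1 * chi p.2 : ℝ) : ℂ) * osc ⟪p.1, p.2⟫

/-- the box where the window lives -/
def bx (n : ℕ) : Set (Eu n × Eu n) := Metric.closedBall 0 n ×ˢ Metric.closedBall 0 n

theorem bx_closed (n : ℕ) : IsClosed (bx n) := Metric.isClosed_closedBall.prod Metric.isClosed_closedBall
theorem bx_compact (n : ℕ) : IsCompact (bx n) := (isCompact_closedBall _ _).prod (isCompact_closedBall _ _)

theorem win_contDiff {n : ℕ} : ContDiff ℝ (⊤ : ℕ∞) (win (n := n)) := by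
  unfold win
  refine ContDiff.mul (Complex.ofRealCLM.contDiff.comp ((chi_contDiff.comp contDiff_fst).mul
    (chi_contDiff.comp contDiff_snd))) (osc_contDiff (contDiff_fst.inner ℝ contDiff_snd))

theorem win_tsupport {n : ℕ} : tsupport (win (n := n)) ⊆ bx n := by
  refine closure_minimal (fun p hp => ?_) (bx_closed n)
  have : chi p.1 ≠ 0 ∧ chi p.2 ≠ 0 := by
    constructor <;> · intro h; exact hp (by simp [win, h])
  exact ⟨by simpa using chi_ne_zero this.1, by simpa using chi_ne_zero this.2⟩

theorem win_compact {n : ℕ} : HasCompactSupport (win (n := n)) :=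
  (bx_compact n).of_isClosed_subset (isClosed_tsupport _) win_tsupport

/-- windowed amplitude -/
def BB {n : ℕ} (a : Eu n × Eu n → ℂ) (q p : Eu n × Eu n) : ℂ := win (p - q) * a p

theorem BB_contDiff {n : ℕ} {a : Eu n × Eu n → ℂ} (ha : ContDiff ℝ (⊤ : ℕ∞) a) (q) :
    ContDiff ℝ (⊤ : ℕ∞) (BB a q) :=
  (win_contDiff.comp (contDiff_id.sub contDiff_const)).mul ha

theorem BB_compact {n : ℕ} (a : Eu n × Eu n → ℂ) (q) : HasCompactSupport (BB a q) :=
  HasCompactSupport.mul_right (win_compact.comp_homeomorph (Homeomorph.subRight q))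

theorem BB_bound (n s : ℕ) : ∃ C : ℝ, 0 ≤ C ∧ ∀ {a : Eu n × Eu n → ℂ}, ContDiff ℝ (⊤ : ℕ∞) a →
    ∀ q p o o', ‖dList dY (ol s o') (dList dX (ol s o) (BB a q)) p‖
      ≤ (bx n).indicator (fun _ => C) (p - q) * SS s a p := by
  obtain ⟨C, hC0, hC⟩ := dList_bound_exists (d := dXY (n := n)) (2 * s) win_contDiff win_compact
  refine ⟨C, hC0, fun {a} ha q p o o' => ?_⟩
  rw [← dList_ll]
  have hw : ContDiff ℝ (⊤ : ℕ∞) fun p : Eu n × Eu n => win (p - q) :=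
    win_contDiff.comp (contDiff_id.sub contDiff_const)
  have := leibniz_le (d := dXY) (ll s o o') hw ha p ((bx n).indicator (fun _ => C) (p - q))
    fun l' hl' => by
      rw [dList_sub_const]
      by_cases hb : p - q ∈ bx n
      · rw [Set.indicator_of_mem hb]
        refine hC _ (hl'.trans ?_) _
        have h1 := ol_length s o
        have h2 := ol_length s o'
        simp [ll]; omega
      · rw [Set.indicator_of_notMem hb]
        have : dList dXY l' win (p - q) = 0 := by
          by_contra h
          exact hb (win_tsupport (tsupport_dList_subset _ _ (subset_tsupport _ h)))
        simp [this]
  refine this.trans ?_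
  gcongr
  · exact Set.indicator_nonneg (fun _ _ => hC0) _
  · unfold SS
    refine le_trans ?_ (Finset.single_le_sum (f := fun o => ∑ o', ((ll s o o').sublists'.map
      fun l' => ‖dList dXY l' a p‖).sum) (fun _ _ => Finset.sum_nonneg fun _ _ =>
        list_sum_nonneg' _ _ _) (Finset.mem_univ o))
    exact (Finset.single_le_sum (f := fun o' => ((ll s o o').sublists'.map
      fun l' => ‖dList dXY l' a p‖).sum) (fun _ _ => list_sum_nonneg' _ _ _) (Finset.mem_univ o'))

def AA {n : ℕ} (s : ℕ) (a : Eu n × Eu n → ℂ) (q : Eu n × Eu n) : ℝ≥0∞ :=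
  ∫⁻ p, (bx n).indicator (fun _ => 1) (p - q) * ‖SS s a p‖ₑ ^ 2

theorem pair_bound (n s : ℕ) : ∃ K : ℝ≥0∞, K ≠ ∞ ∧ ∀ {a : Eu n × Eu n → ℂ},
    ContDiff ℝ (⊤ : ℕ∞) a → ∀ q, ∀ {F G : Eu n → ℂ}, Continuous F → HasCompactSupport F →
    Continuous G → HasCompactSupport G →
    ‖∫ x, (∫ ξ, BB a q (x, ξ) * G ξ) * F x‖ₑ ^ 2 ≤ K * AA s a q * (NN s F * NN s G) := by
  obtain ⟨C, hC0, hC⟩ := BB_bound n s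
  refine ⟨((n + 1 : ℕ) * ((n + 1 : ℕ) * ENNReal.ofReal C ^ 2)),
    by finiteness, fun {a} ha q {F G} hF hFc hG hGc => ?_⟩
  refine (sobolev_two s (BB_contDiff ha q) (BB_compact a q) hF hFc hG hGc).trans ?_
  gcongr
  have hm : Measurable fun p : Eu n × Eu n => (bx n).indicator (fun _ => (1 : ℝ≥0∞)) (p - q) * ‖SS s a p‖ₑ ^ 2 :=
    ((measurable_const.indicator (bx_closed n).measurableSet).comp (measurable_id.sub_const q)).mul
      ((SS_continuous s ha).enorm.measurable.pow_const 2)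
  have key : ∀ o o', ∫⁻ x, ∫⁻ ξ, ‖dList dY (ol s o') (dList dX (ol s o) (BB a q)) (x, ξ)‖ₑ ^ 2
      ≤ ENNReal.ofReal C ^ 2 * AA s a q := by
    intro o o'
    unfold AA
    rw [Measure.volume_eq_prod, lintegral_prod _ hm.aemeasurable, ← lintegral_const_mul _ hm.lintegral_prod_right']
    refine lintegral_mono fun x => ?_
    have hm' : Measurable fun y : Eu n => (bx n).indicator (fun _ => (1 : ℝ≥0∞)) ((x, y) - q)
        * ‖SS s a (x, y)‖ₑ ^ 2 := hm.comp measurable_prodMk_left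
    rw [← lintegral_const_mul _ hm']
    refine lintegral_mono fun ξ => ?_
    have := hC ha q (x, ξ) o o'
    rw [← ofReal_norm, ← ofReal_norm (SS s a (x, ξ))]
    refine (pow_le_pow_left₀ zero_le (ENNReal.ofReal_le_ofReal this) 2).trans ?_
    by_cases hb : (x, ξ) - q ∈ bx n
    · simp only [Set.indicator_of_mem hb]
      rw [ENNReal.ofReal_mul hC0, mul_pow, one_mul, Real.norm_eq_abs, abs_of_nonneg (SS_nonneg _ _ _)]
    · simp [Set.indicator_of_notMem hb]
  refine (Finset.sum_le_sum fun o _ => Finset.sum_le_sum fun o' _ => key o o').trans (le_of_eq ?_)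
  simp only [Finset.sum_const, Finset.card_univ, Fintype.card_option, Fintype.card_fin, nsmul_eq_mul]
  ring

instance vol_haar (n : ℕ) : (volume : Measure (Eu n × Eu n)).IsAddHaarMeasure := by
  rw [Measure.volume_eq_prod]; infer_instance

instance vol_neg (n : ℕ) : (volume : Measure (Eu n × Eu n)).IsNegInvariant := by
  constructor
  have h := Measure.map_addHaar_smul (volume : Measure (Eu n × Eu n)) (r := -1) (by norm_num)
  have e : (fun x : Eu n × Eu n => (-1 : ℝ) • x) = Neg.neg := by ext1 x; simp
  rw [show ((-1 : ℝ) • · : Eu n × Eu n → Eu n × Eu n) = Neg.neg from e] at h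
  rw [Measure.neg, h]
  simp [abs_inv, abs_pow]

theorem bx_ind_measurable (n : ℕ) :
    Measurable fun z : (Eu n × Eu n) × (Eu n × Eu n) =>
      (bx n).indicator (fun _ => (1 : ℝ≥0∞)) (z.2 - z.1) :=
  (measurable_const.indicator (bx_closed n).measurableSet).comp (measurable_snd.sub measurable_fst)

theorem AA_measurable {n : ℕ} (s : ℕ) {a : Eu n × Eu n → ℂ} (ha : ContDiff ℝ (⊤ : ℕ∞) a) :
    Measurable (AA s a) := by
  have : Measurable fun z : (Eu n × Eu n) × (Eu n × Eu n) =>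
      (bx n).indicator (fun _ => (1 : ℝ≥0∞)) (z.2 - z.1) * ‖SS s a z.2‖ₑ ^ 2 :=
    (bx_ind_measurable n).mul (((SS_continuous s ha).enorm.measurable.pow_const 2).comp measurable_snd)
  exact this.lintegral_prod_right'

theorem AA_pow_le {n : ℕ} (s : ℕ) {a : Eu n × Eu n → ℂ} (ha : ContDiff ℝ (⊤ : ℕ∞) a) {p : ℝ}
    (hp : 2 ≤ p) (q : Eu n × Eu n) :
    AA s a q ^ (p / 2) ≤ (∫⁻ y, (bx n).indicator (fun _ => 1) (y - q) * ‖SS s a y‖ₑ ^ p)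
      * (volume (bx n)) ^ (p / 2 - 1) := by
  have hp0 : 0 < p := by linarith
  have m1 : Measurable fun y : Eu n × Eu n => (bx n).indicator (fun _ => (1 : ℝ≥0∞)) (y - q) :=
    (measurable_const.indicator (bx_closed n).measurableSet).comp (measurable_id.sub_const q)
  have m2 : Measurable fun y : Eu n × Eu n => (bx n).indicator (fun _ => (1 : ℝ≥0∞)) (y - q)
      * ‖SS s a y‖ₑ ^ p := m1.mul ((SS_continuous s ha).enorm.measurable.pow_const p)
  have hv : ∫⁻ y, (bx n).indicator (fun _ => (1 : ℝ≥0∞)) (y - q) = volume (bx n) := by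
    rw [lintegral_sub_right_eq_self (fun y => (bx n).indicator (fun _ => (1 : ℝ≥0∞)) y) q,
      lintegral_indicator (bx_closed n).measurableSet]
    simp
  have hp2 : 2 / p ≤ 1 := by rw [div_le_one hp0]; exact hp
  have h := ENNReal.lintegral_mul_norm_pow_le (μ := volume) m2.aemeasurable m1.aemeasurable
    (p := 2 / p) (q := 1 - 2 / p) (by positivity) (by linarith) (by ring)
  rw [hv] at h
  have h0 : AA s a q ≤ _ := le_trans (lintegral_mono fun y => ?_) h
  · refine (ENNReal.rpow_le_rpow h0 (by positivity)).trans (le_of_eq ?_)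
    rw [ENNReal.mul_rpow_of_nonneg _ _ (by positivity), ← ENNReal.rpow_mul, ← ENNReal.rpow_mul]
    congr 1
    · rw [show 2 / p * (p / 2) = 1 by field_simp, ENNReal.rpow_one]
    · congr 1; field_simp
  · by_cases hb : y - q ∈ bx n
    · simp only [Set.indicator_of_mem hb, one_mul, ENNReal.one_rpow, mul_one]
      rw [← ENNReal.rpow_mul, show p * (2 / p) = 2 by field_simp]
      simp
    · simp [Set.indicator_of_notMem hb]

theorem AA_lint (n : ℕ) {p : ℝ} (hp : 2 ≤ p) : ∃ K : ℝ≥0∞, K ≠ ∞ ∧ ∀ (s : ℕ)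
    {a : Eu n × Eu n → ℂ}, ContDiff ℝ (⊤ : ℕ∞) a →
    ∫⁻ q, AA s a q ^ (p / 2) ≤ K * ∫⁻ y, ‖SS s a y‖ₑ ^ p := by
  have hvf : volume (bx n) ≠ ∞ := (bx_compact n).measure_lt_top.ne
  refine ⟨volume (bx n) * volume (bx n) ^ (p / 2 - 1), ENNReal.mul_ne_top hvf
    (ENNReal.rpow_ne_top_of_nonneg (by linarith) hvf), fun s {a} ha => ?_⟩
  refine (lintegral_mono fun q => AA_pow_le s ha hp q).trans ?_
  have mS : Measurable fun y => ‖SS s a y‖ₑ ^ p := (SS_continuous s ha).enorm.measurable.pow_const p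
  have m : Measurable fun z : (Eu n × Eu n) × (Eu n × Eu n) =>
      (bx n).indicator (fun _ => (1 : ℝ≥0∞)) (z.2 - z.1) * ‖SS s a z.2‖ₑ ^ p :=
    (bx_ind_measurable n).mul (mS.comp measurable_snd)
  rw [lintegral_mul_const _ m.lintegral_prod_right', lintegral_lintegral_swap m.aemeasurable]
  have : ∀ y : Eu n × Eu n, ∫⁻ q : Eu n × Eu n, (bx n).indicator (fun _ => (1 : ℝ≥0∞)) (y - q) * ‖SS s a y‖ₑ ^ p
      = volume (bx n) * ‖SS s a y‖ₑ ^ p := by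
    intro y
    have my : Measurable fun q : Eu n × Eu n => (bx n).indicator (fun _ => (1 : ℝ≥0∞)) (y - q) :=
      (measurable_const.indicator (bx_closed n).measurableSet).comp (measurable_const.sub measurable_id)
    rw [lintegral_mul_const _ my]
    congr 1
    rw [lintegral_sub_left_eq_self (fun y => (bx n).indicator (fun _ => (1 : ℝ≥0∞)) y) y,
      lintegral_indicator (bx_closed n).measurableSet]
    simp
  simp only [this]
  rw [lintegral_const_mul _ mS]
  exact le_of_eq (by ring)

theorem wM_lower {n : ℕ} (s : ℕ) (μ : Eu n) :
    (1 + ‖μ‖) ^ (2 * s) ≤ (n + 1) ^ (2 * s) * wM s μ := by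
  have hm : ∃ o : Option (Fin n), ∀ o', wo 1 o' μ ≤ wo 1 o μ := Finite.exists_max _
  obtain ⟨o, ho⟩ := hm
  have hpos : ∀ o, 0 ≤ wo 1 o μ := fun o => by cases o <;> simp only [wo] <;> positivity
  have h1 : 1 + ‖μ‖ ≤ (n + 1) * wo 1 o μ := by
    have a1 : (1 : ℝ) ≤ wo 1 o μ := ho none
    have a2 : ‖μ‖ ≤ ∑ i : Fin n, wo 1 o μ := by
      refine (eu_norm_le_sum μ).trans (Finset.sum_le_sum fun i _ => ?_)
      refine le_trans ?_ (ho (some i))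
      simp only [wo, pow_one, abs_mul, Nat.abs_ofNat, abs_of_pos Real.pi_pos]
      nlinarith [abs_nonneg (μ i), Real.pi_gt_three]
    simp at a2
    linarith
  calc (1 + ‖μ‖) ^ (2 * s) ≤ ((n + 1) * wo 1 o μ) ^ (2 * s) := by gcongr
    _ = (n + 1) ^ (2 * s) * wo 1 o μ ^ (2 * s) := by rw [mul_pow]
    _ ≤ _ := by
      gcongr
      have : wo 1 o μ ^ (2 * s) = wo s o μ ^ 2 := by
        cases o <;> simp only [wo, one_pow, pow_one]; rw [← pow_mul, mul_comm s 2]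
      rw [this]
      unfold wM
      exact Finset.single_le_sum (f := fun o => wo s o μ ^ 2) (fun _ _ => by positivity) (Finset.mem_univ o)

/-- the interpolated weight -/
def VV {n : ℕ} (s : ℕ) (t : ℝ) (μ : Eu n) : ℝ≥0∞ := ENNReal.ofReal (1 / wM s μ) ^ (1 / t)

theorem VV_measurable {n : ℕ} (s : ℕ) (t : ℝ) : Measurable (VV (n := n) s t) := by
  unfold VV
  refine Measurable.pow_const ?_ _
  exact (measurable_const.div (wM_continuous s).measurable).ennreal_ofReal

theorem le_VV {n : ℕ} (s : ℕ) {t : ℝ} (ht : 0 ≤ t) (μ : Eu n) :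
    ENNReal.ofReal (1 / wM s μ) ≤ VV s t μ ^ t := by
  unfold VV
  rcases ht.eq_or_lt with rfl | ht
  · simp only [ENNReal.rpow_zero]
    rw [ENNReal.ofReal_le_one, div_le_one (lt_of_lt_of_le one_pos (one_le_wM s μ))]
    exact one_le_wM s μ
  · rw [← ENNReal.rpow_mul, one_div_mul_cancel ht.ne', ENNReal.rpow_one]

theorem VV_lint {n : ℕ} (s : ℕ) {t : ℝ} (ht : 0 < t) (hs : n * t < 2 * s) :
    ∫⁻ μ : Eu n, VV s t μ ≠ ∞ := by
  set r : ℝ := 2 * s / t with hr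
  have hrn : (Module.finrank ℝ (Eu n) : ℝ) < r := by
    rw [finrank_euclideanSpace_fin, hr, lt_div_iff₀ ht]; exact hs
  have hi := (integrable_one_add_norm (E := Eu n) (μ := volume) hrn).const_mul
    (((n + 1 : ℝ) ^ (2 * s)) ^ (1 / t))
  refine ne_top_of_le_ne_top hi.lintegral_lt_top.ne (lintegral_mono fun μ => ?_)
  unfold VV
  have hw : 0 < wM s μ := lt_of_lt_of_le one_pos (one_le_wM s μ)
  rw [ENNReal.ofReal_rpow_of_nonneg (by positivity) (by positivity)]
  refine ENNReal.ofReal_le_ofReal ?_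
  have h1 : 1 / wM s μ ≤ (n + 1 : ℝ) ^ (2 * s) * (1 + ‖μ‖) ^ (-(2 * s : ℝ)) := by
    rw [Real.rpow_neg (by positivity), div_le_iff₀ hw]
    have := wM_lower s μ
    have e : (1 + ‖μ‖) ^ (2 * s : ℝ) = (1 + ‖μ‖) ^ (2 * s) := by
      rw [← Real.rpow_natCast]; push_cast; rfl
    rw [e]
    have hpos : 0 < (1 + ‖μ‖) ^ (2 * s) := by positivity
    rw [mul_right_comm, ← div_eq_mul_inv, le_div_iff₀ hpos, one_mul]
    exact this
  refine (Real.rpow_le_rpow (by positivity) h1 (by positivity)).trans (le_of_eq ?_)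
  rw [Real.mul_rpow (by positivity) (by positivity), ← Real.rpow_mul (by positivity)]
  congr 2
  rw [hr]; field_simp

/-- localisation of `f` near `z` -/
def fz {n : ℕ} (f : Eu n → ℂ) (z x : Eu n) : ℂ := f x * (chi (x - z) : ℂ)

/-- local mass -/
def ff {n : ℕ} (f : Eu n → ℂ) (z : Eu n) : ℝ≥0∞ := ∫⁻ x, ‖fz f z x‖ₑ ^ 2

theorem fz_continuous2 {n : ℕ} {f : Eu n → ℂ} (hf : Continuous f) :
    Continuous fun q : Eu n × Eu n => fz f q.1 q.2 := by
  have := chi_contDiff (n := n).continuous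
  unfold fz; fun_prop

theorem fz_continuous {n : ℕ} {f : Eu n → ℂ} (hf : Continuous f) (z : Eu n) : Continuous (fz f z) := by
  have := chi_contDiff (n := n).continuous
  unfold fz; fun_prop

theorem fz_compact {n : ℕ} {f : Eu n → ℂ} (hc : HasCompactSupport f) (z : Eu n) :
    HasCompactSupport (fz f z) := by
  unfold fz; exact hc.mul_right

theorem fz_norm_le {n : ℕ} (f : Eu n → ℂ) (z x : Eu n) : ‖fz f z x‖ ≤ ‖f x‖ := by
  unfold fz
  rw [norm_mul, Complex.norm_real, Real.norm_of_nonneg (chi_nonneg _)]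
  exact mul_le_of_le_one_right (norm_nonneg _) (chi_le_one _)

theorem ff_measurable {n : ℕ} {f : Eu n → ℂ} (hf : Continuous f) : Measurable (ff f) := by
  have : Measurable fun q : Eu n × Eu n => ‖fz f q.1 q.2‖ₑ ^ 2 :=
    (fz_continuous2 hf).enorm.measurable.pow_const 2
  exact this.lintegral_prod_right'

def cchi (n : ℕ) : ℝ≥0∞ := ∫⁻ x : Eu n, ‖(chi x : ℂ)‖ₑ ^ 2

theorem cchi_ne_top (n : ℕ) : cchi n ≠ ∞ := by
  have h := cc_memLp (n := n) (g := fun x => (chi x : ℂ))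
    (Complex.continuous_ofReal.comp chi_contDiff.continuous)
    (chi_hasCompactSupport.comp_left (g := fun t : ℝ => (t : ℂ)) (by simp)) 2
  unfold cchi
  rw [← eLpNorm_two_sq]
  exact ENNReal.pow_ne_top h.2.ne

theorem ff_lint {n : ℕ} {f : Eu n → ℂ} (hf : Continuous f) :
    ∫⁻ z, ff f z = cchi n * ∫⁻ x, ‖f x‖ₑ ^ 2 := by
  have m : Measurable fun q : Eu n × Eu n => ‖fz f q.1 q.2‖ₑ ^ 2 :=
    (fz_continuous2 hf).enorm.measurable.pow_const 2
  unfold ff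
  rw [lintegral_lintegral_swap m.aemeasurable]
  have e : ∀ x : Eu n, ∫⁻ z, ‖fz f z x‖ₑ ^ 2 = ‖f x‖ₑ ^ 2 * cchi n := by
    intro x
    unfold fz cchi
    simp only [enorm_mul, mul_pow]
    have mc : Measurable fun z : Eu n => ‖(chi (x - z) : ℂ)‖ₑ ^ 2 := by
      have := chi_contDiff (n := n).continuous
      have : Continuous fun z : Eu n => (chi (x - z) : ℂ) := by fun_prop
      exact this.enorm.measurable.pow_const 2
    rw [lintegral_const_mul _ mc,
      lintegral_sub_left_eq_self (fun z : Eu n => ‖(chi z : ℂ)‖ₑ ^ 2) x]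
  simp only [e]
  rw [lintegral_mul_const _ (hf.enorm.measurable.pow_const 2), mul_comm]

theorem fz_fourier_continuous {n : ℕ} {f : Eu n → ℂ} (hf : Continuous f) (hc : HasCompactSupport f) :
    Continuous fun q : Eu n × Eu n => FourierTransform.fourier (fz f q.1) q.2 := by
  simp only [Real.fourier_eq']
  refine continuous_of_dominated (bound := fun x => ‖f x‖) (fun q => ?_) (fun q => ?_)
    (hf.integrable_of_hasCompactSupport hc).norm ?_
  · have := fz_continuous hf q.1
    exact Continuous.aestronglyMeasurable (by fun_prop)
  · refine Filter.Eventually.of_forall fun x => ?_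
    rw [norm_smul, Complex.norm_exp_ofReal_mul_I, one_mul]
    exact fz_norm_le f q.1 x
  · refine Filter.Eventually.of_forall fun x => ?_
    have : Continuous fun q : Eu n × Eu n => fz f q.1 x :=
      (fz_continuous2 hf).comp (continuous_fst.prodMk continuous_const)
    fun_prop

theorem fz_fourier_cont1 {n : ℕ} {f : Eu n → ℂ} (hf : Continuous f) (hc : HasCompactSupport f)
    (z : Eu n) : Continuous (FourierTransform.fourier (fz f z)) := by
  have h := (fz_fourier_continuous hf hc).comp (f := fun μ : Eu n => (z, μ)) (by fun_prop)
  exact h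

theorem fz_mod_fourier {n : ℕ} (f : Eu n → ℂ) (z ζ μ : Eu n) :
    FourierTransform.fourier (fun x => osc ⟪x, ζ⟫ * fz f z x) μ
      = FourierTransform.fourier (fz f z) (μ - (2 * π)⁻¹ • ζ) := by
  simp only [Real.fourier_eq']
  congr 1; ext1 x
  rw [smul_eq_mul, smul_eq_mul, ← mul_assoc]
  congr 1
  unfold osc
  rw [← Complex.exp_add, inner_sub_right, inner_smul_right]
  congr 1
  push_cast
  have : (π : ℂ) ≠ 0 := by exact_mod_cast Real.pi_ne_zero
  field_simp
  ring

/-- phase-space mass -/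
def PV {n : ℕ} (s : ℕ) (t : ℝ) (f : Eu n → ℂ) (z ζ : Eu n) : ℝ≥0∞ :=
  ∫⁻ μ, ‖FourierTransform.fourier (fz f z) (μ - (2 * π)⁻¹ • ζ)‖ₑ ^ 2 * VV s t μ

theorem PV_meas_aux {n : ℕ} (s : ℕ) (t : ℝ) {f : Eu n → ℂ} (hf : Continuous f) (hc : HasCompactSupport f) :
    Measurable fun w : (Eu n × Eu n) × Eu n =>
      ‖FourierTransform.fourier (fz f w.1.1) (w.2 - (2 * π)⁻¹ • w.1.2)‖ₑ ^ 2 * VV s t w.2 := by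
  refine Measurable.mul ?_ ((VV_measurable s t).comp measurable_snd)
  have h : Continuous fun w : (Eu n × Eu n) × Eu n =>
      FourierTransform.fourier (fz f w.1.1) (w.2 - (2 * π)⁻¹ • w.1.2) :=
    (fz_fourier_continuous hf hc).comp
      (f := fun w : (Eu n × Eu n) × Eu n => (w.1.1, w.2 - (2 * π)⁻¹ • w.1.2)) (by fun_prop)
  exact h.enorm.measurable.pow_const 2

theorem PV_measurable {n : ℕ} (s : ℕ) (t : ℝ) {f : Eu n → ℂ} (hf : Continuous f) (hc : HasCompactSupport f) :
    Measurable fun q : Eu n × Eu n => PV s t f q.1 q.2 :=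
  (PV_meas_aux s t hf hc).lintegral_prod_right'

theorem fz_plancherel {n : ℕ} {f : Eu n → ℂ} (hf : Continuous f) (hc : HasCompactSupport f) (z : Eu n) :
    ∫⁻ μ, ‖FourierTransform.fourier (fz f z) μ‖ₑ ^ 2 ≤ ff f z := by
  unfold ff
  rw [← eLpNorm_two_sq, ← eLpNorm_two_sq]
  exact pow_le_pow_left' (plancherel_cc (fz_continuous hf z) (fz_compact hc z)) 2

theorem NN_le {n : ℕ} (s : ℕ) {t : ℝ} (ht : 0 ≤ t) (ht1 : t ≤ 1) {f : Eu n → ℂ} (hf : Continuous f)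
    (hc : HasCompactSupport f) (z ζ : Eu n) :
    NN s (fun x => osc ⟪x, ζ⟫ * fz f z x) ≤ ff f z ^ (1 - t) * PV s t f z ζ ^ t := by
  unfold NN
  simp only [fz_mod_fourier]
  have hF : Continuous (FourierTransform.fourier (fz f z)) :=
    fz_fourier_cont1 hf hc z
  have m0 : Measurable fun μ => ‖FourierTransform.fourier (fz f z) (μ - (2 * π)⁻¹ • ζ)‖ₑ ^ 2 :=
    (hF.enorm.measurable.pow_const 2).comp (measurable_id.sub_const ((2 * π)⁻¹ • ζ))
  have h := ENNReal.lintegral_mul_norm_pow_le (μ := volume) m0.aemeasurable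
    (m0.mul (VV_measurable s t)).aemeasurable (p := 1 - t) (q := t) (by linarith) ht (by ring)
  rw [lintegral_sub_right_eq_self (fun μ => ‖FourierTransform.fourier (fz f z) μ‖ₑ ^ 2)] at h
  refine le_trans (lintegral_mono fun μ => ?_) (h.trans ?_)
  · simp only [Pi.mul_apply]
    rw [ENNReal.mul_rpow_of_nonneg _ _ ht, ← mul_assoc,
      ← ENNReal.rpow_add_of_nonneg _ _ (by linarith) ht, sub_add_cancel, ENNReal.rpow_one]
    gcongr
    exact le_VV s ht μ
  · unfold PV
    refine mul_le_mul' (ENNReal.rpow_le_rpow (fz_plancherel hf hc z) (by linarith)) le_rfl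

theorem lint_scale {n : ℕ} {g : Eu n → ℝ≥0∞} (hg : Measurable g) (μ : Eu n) :
    ∫⁻ ζ, g (μ - (2 * π)⁻¹ • ζ) = ENNReal.ofReal ((2 * π) ^ n) * ∫⁻ ζ, g ζ := by
  have h := Measure.map_addHaar_smul (volume : Measure (Eu n)) (r := (2 * π)⁻¹)
    (by positivity)
  have e := lintegral_map (μ := (volume : Measure (Eu n))) (f := fun ζ => g (μ - ζ))
    (g := fun ζ : Eu n => (2 * π)⁻¹ • ζ) (hg.comp (measurable_const.sub measurable_id))
    (measurable_const_smul _)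
  rw [← e, h, lintegral_smul_measure, lintegral_sub_left_eq_self, finrank_euclideanSpace_fin, smul_eq_mul]
  congr 2
  rw [inv_pow, inv_inv, abs_of_pos (by positivity)]

theorem PV_lint {n : ℕ} (s : ℕ) (t : ℝ) {f : Eu n → ℂ} (hf : Continuous f) (hc : HasCompactSupport f)
    (z : Eu n) : ∫⁻ ζ, PV s t f z ζ ≤
      (ENNReal.ofReal ((2 * π) ^ n) * ∫⁻ μ : Eu n, VV s t μ) * ff f z := by
  unfold PV
  have m : Measurable fun w : Eu n × Eu n =>
      ‖FourierTransform.fourier (fz f z) (w.2 - (2 * π)⁻¹ • w.1)‖ₑ ^ 2 * VV s t w.2 :=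
    (PV_meas_aux s t hf hc).comp (f := fun w : Eu n × Eu n => ((z, w.1), w.2)) (by fun_prop)
  have hF : Continuous (FourierTransform.fourier (fz f z)) :=
    fz_fourier_cont1 hf hc z
  have m0 : Measurable fun μ => ‖FourierTransform.fourier (fz f z) μ‖ₑ ^ 2 :=
    hF.enorm.measurable.pow_const 2
  rw [lintegral_lintegral_swap m.aemeasurable]
  have e : ∀ μ : Eu n, ∫⁻ ζ, ‖FourierTransform.fourier (fz f z) (μ - (2 * π)⁻¹ • ζ)‖ₑ ^ 2 * VV s t μ
      ≤ ENNReal.ofReal ((2 * π) ^ n) * ff f z * VV s t μ := by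
    intro μ
    have m1 : Measurable fun ζ => ‖FourierTransform.fourier (fz f z) (μ - (2 * π)⁻¹ • ζ)‖ₑ ^ 2 :=
      m0.comp (measurable_const.sub (measurable_const_smul _))
    rw [lintegral_mul_const _ m1, lint_scale m0]
    gcongr
    exact fz_plancherel hf hc z
  refine (lintegral_mono e).trans (le_of_eq ?_)
  rw [lintegral_const_mul _ (VV_measurable s t)]
  ring

/-- the total phase-space mass is controlled by the `L²` norm -/
theorem PV_total {n : ℕ} (s : ℕ) (t : ℝ) {f : Eu n → ℂ} (hf : Continuous f) (hc : HasCompactSupport f) :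
    ∫⁻ q : Eu n × Eu n, PV s t f q.1 q.2 ≤
      (ENNReal.ofReal ((2 * π) ^ n) * ∫⁻ μ : Eu n, VV s t μ) * (cchi n * ∫⁻ x, ‖f x‖ₑ ^ 2) := by
  rw [Measure.volume_eq_prod, lintegral_prod _ (PV_measurable s t hf hc).aemeasurable, ← ff_lint hf]
  rw [← lintegral_const_mul _ (ff_measurable hf)]
  exact lintegral_mono fun z => PV_lint s t hf hc z

/-- the phase-space decomposed integrand -/
def HH {n : ℕ} (a : Eu n × Eu n → ℂ) (f g : Eu n → ℂ) (p q : Eu n × Eu n) : ℂ :=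
  osc (-⟪q.1, q.2⟫) * ((BB a q p * (osc ⟪p.2, q.1⟫ * fz g q.2 p.2)) * (osc ⟪p.1, q.2⟫ * fz f q.1 p.1))

theorem HH_eq {n : ℕ} (a : Eu n × Eu n → ℂ) (f g : Eu n → ℂ) (p q : Eu n × Eu n) :
    HH a f g p q = (osc ⟪p.1, p.2⟫ * a p * g p.2 * f p.1) *
      (((chi (p.1 - q.1) ^ 2 : ℝ) : ℂ) * ((chi (p.2 - q.2) ^ 2 : ℝ) : ℂ)) := by
  obtain ⟨x, ξ⟩ := p
  obtain ⟨z, ζ⟩ := q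
  have e : osc ⟪x, ξ⟫ = osc (-⟪z, ζ⟫) * osc ⟪x - z, ξ - ζ⟫ * osc ⟪ξ, z⟫ * osc ⟪x, ζ⟫ := by
    rw [← osc_add, ← osc_add, ← osc_add]
    congr 1
    rw [inner_sub_left, inner_sub_right, inner_sub_right, real_inner_comm z ξ]
    ring
  simp only [HH, BB, win, fz, Prod.mk_sub_mk]
  rw [e]
  push_cast
  ring

theorem HH_continuous {n : ℕ} {a : Eu n × Eu n → ℂ} (ha : Continuous a) {f g : Eu n → ℂ}
    (hf : Continuous f) (hg : Continuous g) :
    Continuous fun w : (Eu n × Eu n) × (Eu n × Eu n) => HH a f g w.1 w.2 := by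
  simp only [HH_eq]
  have h1 := chi_contDiff (n := n).continuous
  have h2 := continuous_osc
  fun_prop

theorem HH_compact {n : ℕ} (a : Eu n × Eu n → ℂ) {f g : Eu n → ℂ}
    (hf : HasCompactSupport f) (hg : HasCompactSupport g) :
    HasCompactSupport fun w : (Eu n × Eu n) × (Eu n × Eu n) => HH a f g w.1 w.2 := by
  have hK : IsCompact ((fun w : (Eu n × Eu n) × (Eu n × Eu n) => (w.1, w.1 - w.2)) ''
      ((tsupport f ×ˢ tsupport g) ×ˢ (bx n))) :=
    ((hf.isCompact.prod hg.isCompact).prod (bx_compact n)).image (by fun_prop)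
  refine HasCompactSupport.intro hK fun w hw => ?_
  by_contra h
  apply hw
  rw [HH_eq] at h
  refine ⟨(w.1, w.1 - w.2), ⟨⟨?_, ?_⟩, ?_, ?_⟩, by ext1 <;> simp⟩
  · exact subset_tsupport _ fun h0 => h (by simp [h0])
  · exact subset_tsupport _ fun h0 => h (by simp [h0])
  · have : chi (w.1.1 - w.2.1) ≠ 0 := fun h0 => h (by simp [h0])
    simpa using chi_ne_zero this
  · have : chi (w.1.2 - w.2.2) ≠ 0 := fun h0 => h (by simp [h0])
    simpa using chi_ne_zero this

theorem chi_sq_cont (n : ℕ) : Continuous fun x : Eu n => chi x ^ 2 :=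
  (chi_contDiff (n := n)).continuous.pow 2

theorem chi_sq_compact (n : ℕ) : HasCompactSupport fun x : Eu n => chi x ^ 2 :=
  (chi_hasCompactSupport (n := n)).comp_left (g := fun t : ℝ => t ^ 2) (by simp)

theorem chi_sq_int (n : ℕ) : ‖∫ x : Eu n, ((chi x ^ 2 : ℝ) : ℂ)‖ₑ = cchi n := by
  rw [integral_complex_ofReal, ← ofReal_norm, Complex.norm_real,
    Real.norm_of_nonneg (integral_nonneg fun _ => by positivity),
    ofReal_integral_eq_lintegral_ofReal ?_ (Filter.Eventually.of_forall fun _ => by positivity)]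
  · unfold cchi
    congr 1; ext1 x
    rw [← ofReal_norm, Complex.norm_real, Real.norm_of_nonneg (chi_nonneg _),
      ENNReal.ofReal_pow (chi_nonneg _)]
  · exact (chi_sq_cont n).integrable_of_hasCompactSupport (chi_sq_compact n)

theorem cchi_ne_zero (n : ℕ) : cchi n ≠ 0 := by
  rw [← chi_sq_int, integral_complex_ofReal]
  have : 0 < ∫ x : Eu n, chi x ^ 2 := by
    refine Continuous.integral_pos_of_hasCompactSupport_nonneg_nonzero (x := 0)
      (chi_sq_cont n) (chi_sq_compact n)
      (fun _ => by positivity) (by have := chi_pos_zero (n := n); positivity)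
  simpa using this.ne'

theorem HH_int_q {n : ℕ} (a : Eu n × Eu n → ℂ) (f g : Eu n → ℂ) (p : Eu n × Eu n) :
    ∫ q, HH a f g p q = (osc ⟪p.1, p.2⟫ * a p * g p.2 * f p.1) *
      (∫ x : Eu n, ((chi x ^ 2 : ℝ) : ℂ)) ^ 2 := by
  simp only [HH_eq]
  rw [integral_const_mul, Measure.volume_eq_prod,
    integral_prod_mul (fun z : Eu n => ((chi (p.1 - z) ^ 2 : ℝ) : ℂ)) (fun z : Eu n => ((chi (p.2 - z) ^ 2 : ℝ) : ℂ)),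
    integral_sub_left_eq_self (fun z : Eu n => ((chi z ^ 2 : ℝ) : ℂ)),
    integral_sub_left_eq_self (fun z : Eu n => ((chi z ^ 2 : ℝ) : ℂ)), pow_two]

theorem HH_int_p {n : ℕ} {a : Eu n × Eu n → ℂ} (ha : Continuous a) {f g : Eu n → ℂ}
    (hf : Continuous f) (hfc : HasCompactSupport f) (hg : Continuous g) (hgc : HasCompactSupport g)
    (q : Eu n × Eu n) :
    ∫ p, HH a f g p q = osc (-⟪q.1, q.2⟫) * ∫ x, (∫ ξ, BB a q (x, ξ) * (osc ⟪ξ, q.1⟫ * fz g q.2 ξ)) *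
      (osc ⟪x, q.2⟫ * fz f q.1 x) := by
  have hc : Continuous fun p => HH a f g p q :=
    (HH_continuous ha hf hg).comp (f := fun p : Eu n × Eu n => (p, q)) (by fun_prop)
  have hcc : HasCompactSupport fun p => HH a f g p q := by
    refine HasCompactSupport.intro (hfc.isCompact.prod hgc.isCompact) fun p hp => ?_
    by_contra h
    rw [HH_eq] at h
    exact hp ⟨subset_tsupport _ fun h0 => h (by simp [h0]), subset_tsupport _ fun h0 => h (by simp [h0])⟩
  have hi := hc.integrable_of_hasCompactSupport (μ := volume) hcc
  rw [Measure.volume_eq_prod] at hi ⊢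
  rw [integral_prod _ hi, ← integral_const_mul]
  congr 1; ext1 x
  unfold HH
  simp only
  rw [integral_const_mul, integral_mul_const]

theorem lam_step {n : ℕ} {a : Eu n × Eu n → ℂ} (ha : Continuous a) {f g : Eu n → ℂ}
    (hf : Continuous f) (hfc : HasCompactSupport f) (hg : Continuous g) (hgc : HasCompactSupport g) :
    ‖∫ p : Eu n × Eu n, osc ⟪p.1, p.2⟫ * a p * g p.2 * f p.1‖ₑ * cchi n ^ 2 ≤
      ∫⁻ q : Eu n × Eu n, ‖∫ x, (∫ ξ, BB a q (x, ξ) * (osc ⟪ξ, q.1⟫ * fz g q.2 ξ)) *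
        (osc ⟪x, q.2⟫ * fz f q.1 x)‖ₑ := by
  rw [← chi_sq_int, ← enorm_pow, ← enorm_mul, ← integral_mul_const]
  simp only [← HH_int_q]
  have hi := (HH_continuous ha hf hg).integrable_of_hasCompactSupport
    (μ := (volume : Measure (Eu n × Eu n)).prod volume) (HH_compact a hfc hgc)
  rw [integral_integral_swap hi]
  refine (enorm_integral_le_lintegral_enorm _).trans (lintegral_mono fun q => ?_)
  rw [HH_int_p ha hf hfc hg hgc, enorm_mul, ← ofReal_norm (osc _), norm_osc]
  simp

theorem holder_four {α : Type*} [MeasurableSpace α] {μ : Measure α} {f₁ f₂ f₃ f₄ : α → ℝ≥0∞}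
    (h₁ : Measurable f₁) (h₂ : Measurable f₂) (h₃ : Measurable f₃) (h₄ : Measurable f₄)
    (k : ℝ≥0∞) {r u : ℝ} (hr : 0 ≤ r) (hu : 0 ≤ u) (h : 2 * r + 2 * u = 1) :
    ∫⁻ x, k * (f₁ x ^ r * f₂ x ^ r * f₃ x ^ u * f₄ x ^ u) ∂μ ≤
      k * ((∫⁻ x, f₁ x ∂μ) ^ r * (∫⁻ x, f₂ x ∂μ) ^ r * (∫⁻ x, f₃ x ∂μ) ^ u * (∫⁻ x, f₄ x ∂μ) ^ u) := by
  rw [lintegral_const_mul _ (by fun_prop)]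
  refine mul_le_mul' le_rfl ?_
  have H := ENNReal.lintegral_prod_norm_pow_le (μ := μ) (Finset.univ : Finset (Fin 4))
    (f := ![f₁, f₂, f₃, f₄]) (p := ![r, r, u, u])
    (by intro i _; fin_cases i; exacts [h₁.aemeasurable, h₂.aemeasurable, h₃.aemeasurable, h₄.aemeasurable])
    (by simp [Fin.sum_univ_four]; linarith)
    (by intro i _; fin_cases i <;> assumption)
  simpa [Fin.prod_univ_four] using H

theorem pt_bound {J K A N₁ N₂ x y P₁ P₂ : ℝ≥0∞} {p : ℝ} (hp : 2 ≤ p)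
    (h : J ^ 2 ≤ K * A * (N₁ * N₂)) (h₁ : N₁ ≤ x ^ (1 - (1 - 2 / p)) * P₁ ^ (1 - 2 / p))
    (h₂ : N₂ ≤ y ^ (1 - (1 - 2 / p)) * P₂ ^ (1 - 2 / p)) :
    J ≤ K ^ (1 / 2 : ℝ) * ((A ^ (p / 2)) ^ (1 / p) * (x * y) ^ (1 / p) * P₁ ^ ((1 - 2 / p) / 2)
      * P₂ ^ ((1 - 2 / p) / 2)) := by
  have hp0 : 0 < p := by linarith
  have e : (J ^ 2) ^ (1 / 2 : ℝ) = J := by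
    rw [← ENNReal.rpow_natCast, ← ENNReal.rpow_mul]; norm_num
  have h3 := h.trans (mul_le_mul' le_rfl (mul_le_mul' h₁ h₂))
  have h4 := ENNReal.rpow_le_rpow h3 (show (0 : ℝ) ≤ 1 / 2 by norm_num)
  rw [e] at h4
  refine h4.trans (le_of_eq ?_)
  have hh : (0 : ℝ) ≤ 1 / 2 := by norm_num
  have hpp : (0 : ℝ) ≤ 1 / p := by positivity
  simp only [ENNReal.mul_rpow_of_nonneg _ _ hh, ENNReal.mul_rpow_of_nonneg _ _ hpp, ← ENNReal.rpow_mul]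
  rw [show (1 - (1 - 2 / p)) * (1 / 2) = 1 / p by ring, show (1 - 2 / p) * (1 / 2) = (1 - 2 / p) / 2 by ring,
    show p / 2 * (1 / p) = 1 / 2 by field_simp]
  ring

theorem final_alg {D X c : ℝ≥0∞} {p : ℝ} (hp : 2 ≤ p) :
    (c * X) ^ (1 / p) * (D * (c * X)) ^ ((1 - 2 / p) / 2) =
      c ^ (1 / 2 : ℝ) * D ^ ((1 - 2 / p) / 2) * X ^ (1 / 2 : ℝ) := by
  have hp0 : 0 < p := by linarith
  have h2 : 2 / p ≤ 1 := by rw [div_le_one hp0]; exact hp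
  have ht : 0 ≤ (1 - 2 / p) / 2 := by linarith
  have hpp : (0 : ℝ) ≤ 1 / p := by positivity
  have hh : (0 : ℝ) ≤ 1 / 2 := by norm_num
  rw [ENNReal.mul_rpow_of_nonneg _ _ ht, mul_left_comm, ← ENNReal.rpow_add_of_nonneg _ _ hpp ht,
    show 1 / p + (1 - 2 / p) / 2 = 1 / 2 by ring, ENNReal.mul_rpow_of_nonneg _ _ hh]
  ring

theorem mf_meas {n : ℕ} {f g : Eu n → ℂ} (hf : Continuous f) (hg : Continuous g) :
    Measurable fun q : Eu n × Eu n => ff f q.1 * ff g q.2 := by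
  have h1 : Measurable fun q : Eu n × Eu n => ff f q.1 := (ff_measurable hf).comp measurable_fst
  have h2 : Measurable fun q : Eu n × Eu n => ff g q.2 := (ff_measurable hg).comp measurable_snd
  exact h1.mul h2

theorem mQ_meas {n : ℕ} (s : ℕ) (t : ℝ) {g : Eu n → ℂ} (hg : Continuous g) (hgc : HasCompactSupport g) :
    Measurable fun q : Eu n × Eu n => PV s t g q.2 q.1 := by
  have h := (PV_measurable s t hg hgc).comp (f := fun q : Eu n × Eu n => (q.2, q.1)) (by fun_prop)
  exact h

theorem co_cont {n : ℕ} (v : Eu n) : Continuous fun x : Eu n => osc ⟪x, v⟫ := by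
  have h := continuous_osc.comp (f := fun x : Eu n => ⟪x, v⟫) (by fun_prop)
  exact h

theorem mod_fz {n : ℕ} {f : Eu n → ℂ} (hf : Continuous f) (hfc : HasCompactSupport f) (z v : Eu n) :
    Continuous (fun x => osc ⟪x, v⟫ * fz f z x) ∧ HasCompactSupport (fun x => osc ⟪x, v⟫ * fz f z x) :=
  ⟨(co_cont v).mul (fz_continuous hf z), (fz_compact hfc z).mul_left⟩

theorem lam_main (n s : ℕ) {p : ℝ} (hp : 2 ≤ p) {t : ℝ} (ht : t = 1 - 2 / p) {D : ℝ≥0∞}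
    (hD : D = ENNReal.ofReal ((2 * π) ^ n) * ∫⁻ μ : Eu n, VV s t μ) {K L : ℝ≥0∞}
    {a : Eu n × Eu n → ℂ} (ha : ContDiff ℝ (⊤ : ℕ∞) a) {f g : Eu n → ℂ}
    (hf : Continuous f) (hfc : HasCompactSupport f) (hg : Continuous g) (hgc : HasCompactSupport g)
    (hKb : ∀ q, ∀ {F G : Eu n → ℂ}, Continuous F → HasCompactSupport F →
      Continuous G → HasCompactSupport G →
      ‖∫ x, (∫ ξ, BB a q (x, ξ) * G ξ) * F x‖ₑ ^ 2 ≤ K * AA s a q * (NN s F * NN s G))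
    (hLb : ∫⁻ q, AA s a q ^ (p / 2) ≤ L * ∫⁻ y, ‖SS s a y‖ₑ ^ p) :
    ‖∫ q : Eu n × Eu n, osc ⟪q.1, q.2⟫ * a q * g q.2 * f q.1‖ₑ * cchi n ^ 2 ≤
      K ^ (1 / 2 : ℝ) * ((L * ∫⁻ y, ‖SS s a y‖ₑ ^ p) ^ (1 / p) *
      ((cchi n * ∫⁻ x, ‖f x‖ₑ ^ 2) * (cchi n * ∫⁻ x, ‖g x‖ₑ ^ 2)) ^ (1 / p) *
      (D * (cchi n * ∫⁻ x, ‖f x‖ₑ ^ 2)) ^ (t / 2) * (D * (cchi n * ∫⁻ x, ‖g x‖ₑ ^ 2)) ^ (t / 2)) := by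
  have hp0 : 0 < p := by linarith
  have h2 : 2 / p ≤ 1 := by rw [div_le_one hp0]; exact hp
  have ht0 : 0 ≤ t := by linarith
  have ht1 : t ≤ 1 := by
    have : 0 < 2 / p := by positivity
    linarith
  have mA : Measurable fun q : Eu n × Eu n => AA s a q ^ (p / 2) := (AA_measurable s ha).pow_const _
  have mf := mf_meas hf hg
  have mP := PV_measurable s t hf hfc
  have mQ := mQ_meas s t hg hgc
  have hpt : ∀ q : Eu n × Eu n, ‖∫ x, (∫ ξ, BB a q (x, ξ) * (osc ⟪ξ, q.1⟫ * fz g q.2 ξ)) *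
        (osc ⟪x, q.2⟫ * fz f q.1 x)‖ₑ ≤ K ^ (1 / 2 : ℝ) * ((AA s a q ^ (p / 2)) ^ (1 / p) *
        (ff f q.1 * ff g q.2) ^ (1 / p) * PV s t f q.1 q.2 ^ (t / 2) * PV s t g q.2 q.1 ^ (t / 2)) := by
    intro q
    have n1 := NN_le s ht0 ht1 hf hfc q.1 q.2
    have n2 := NN_le s ht0 ht1 hg hgc q.2 q.1
    have k := hKb q (mod_fz hf hfc q.1 q.2).1 (mod_fz hf hfc q.1 q.2).2
      (mod_fz hg hgc q.2 q.1).1 (mod_fz hg hgc q.2 q.1).2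
    subst ht
    exact pt_bound hp k n1 n2
  have hPf : ∫⁻ q : Eu n × Eu n, PV s t f q.1 q.2 ≤ D * (cchi n * ∫⁻ x, ‖f x‖ₑ ^ 2) := by
    rw [hD]; exact PV_total s t hf hfc
  have hPg : ∫⁻ q : Eu n × Eu n, PV s t g q.2 q.1 ≤ D * (cchi n * ∫⁻ x, ‖g x‖ₑ ^ 2) := by
    rw [hD]
    refine le_trans (le_of_eq ?_) (PV_total s t hg hgc)
    rw [Measure.volume_eq_prod]
    exact lintegral_prod_swap (fun q : Eu n × Eu n => PV s t g q.1 q.2)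
  have hff : ∫⁻ q : Eu n × Eu n, ff f q.1 * ff g q.2
      = (cchi n * ∫⁻ x, ‖f x‖ₑ ^ 2) * (cchi n * ∫⁻ x, ‖g x‖ₑ ^ 2) := by
    rw [Measure.volume_eq_prod, lintegral_prod_mul (ff_measurable hf).aemeasurable
      (ff_measurable hg).aemeasurable, ff_lint hf, ff_lint hg]
  have hh := holder_four (μ := volume) mA mf mP mQ (K ^ (1 / 2 : ℝ)) (r := 1 / p) (u := t / 2) (by positivity)
    (by linarith) (by rw [ht]; ring)
  refine (lam_step ha.continuous hf hfc hg hgc).trans ((lintegral_mono hpt).trans ?_)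
  refine hh.trans (mul_le_mul' le_rfl ?_)
  rw [hff]
  have hpp : (0 : ℝ) ≤ 1 / p := by positivity
  have htt : 0 ≤ t / 2 := by linarith
  exact mul_le_mul' (mul_le_mul' (mul_le_mul' (ENNReal.rpow_le_rpow hLb hpp) le_rfl)
    (ENNReal.rpow_le_rpow hPf htt)) (ENNReal.rpow_le_rpow hPg htt)

theorem lam_alg {Λ c K L Z X Y D E : ℝ≥0∞} {p t : ℝ} (hp : 2 ≤ p) (ht : t = 1 - 2 / p)
    (hE : E = c ^ (1 / 2 : ℝ) * D ^ (t / 2)) (hc : c ≠ 0) (hcf : c ≠ ∞)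
    (main : Λ * c ^ 2 ≤ K ^ (1 / 2 : ℝ) * ((L * Z) ^ (1 / p) * ((c * X) * (c * Y)) ^ (1 / p) *
      (D * (c * X)) ^ (t / 2) * (D * (c * Y)) ^ (t / 2))) :
    Λ ≤ K ^ (1 / 2 : ℝ) * L ^ (1 / p) * E ^ 2 * (c ^ 2)⁻¹ * Z ^ (1 / p) * X ^ (1 / 2 : ℝ)
      * Y ^ (1 / 2 : ℝ) := by
  have hp0 : 0 < p := by linarith
  have hpp : (0 : ℝ) ≤ 1 / p := by positivity
  have e1 := final_alg (D := D) (X := X) (c := c) hp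
  have e2 := final_alg (D := D) (X := Y) (c := c) hp
  rw [← ht, ← hE] at e1 e2
  rw [ENNReal.mul_rpow_of_nonneg _ _ hpp, ENNReal.mul_rpow_of_nonneg (c * X) _ hpp] at main
  have main2 : Λ * c ^ 2 ≤ K ^ (1 / 2 : ℝ) * L ^ (1 / p) * Z ^ (1 / p) *
      ((c * X) ^ (1 / p) * (D * (c * X)) ^ (t / 2)) *
      ((c * Y) ^ (1 / p) * (D * (c * Y)) ^ (t / 2)) := main.trans (le_of_eq (by ring))
  rw [e1, e2] at main2
  calc Λ = Λ * c ^ 2 * (c ^ 2)⁻¹ := by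
        rw [mul_assoc, ENNReal.mul_inv_cancel (pow_ne_zero 2 hc) (ENNReal.pow_ne_top hcf), mul_one]
    _ ≤ _ := mul_le_mul' main2 le_rfl
    _ = _ := by ring

theorem lam_bound (n s : ℕ) {p : ℝ} (hp : 2 ≤ p) (hs : n * (1 - 2 / p) < 2 * s) :
    ∃ C : ℝ≥0∞, C ≠ ∞ ∧ ∀ {a : Eu n × Eu n → ℂ}, ContDiff ℝ (⊤ : ℕ∞) a → ∀ {f g : Eu n → ℂ},
      Continuous f → HasCompactSupport f → Continuous g → HasCompactSupport g →
      ‖∫ q : Eu n × Eu n, osc ⟪q.1, q.2⟫ * a q * g q.2 * f q.1‖ₑ ≤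
        C * (∫⁻ y, ‖SS s a y‖ₑ ^ p) ^ (1 / p) * eLpNorm f 2 volume * eLpNorm g 2 volume := by
  have hp0 : 0 < p := by linarith
  have h2 : 2 / p ≤ 1 := by rw [div_le_one hp0]; exact hp
  obtain ⟨K, hK, hKb⟩ := pair_bound n s
  obtain ⟨L, hL, hLb⟩ := AA_lint n hp
  obtain ⟨t, ht⟩ : ∃ t : ℝ, t = 1 - 2 / p := ⟨_, rfl⟩
  have ht0 : 0 ≤ t := by linarith
  obtain ⟨D, hD⟩ : ∃ D : ℝ≥0∞, D = ENNReal.ofReal ((2 * π) ^ n) * ∫⁻ μ : Eu n, VV s t μ := ⟨_, rfl⟩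
  have hDf : D ^ (t / 2) ≠ ∞ := by
    rcases ht0.eq_or_lt with h | h
    · rw [← h]; simp
    · rw [hD]
      exact ENNReal.rpow_ne_top_of_nonneg (by linarith)
        (ENNReal.mul_ne_top ENNReal.ofReal_ne_top (VV_lint s h (by rw [ht]; exact hs)))
  have hcf := cchi_ne_top n
  have hc0 := cchi_ne_zero n
  obtain ⟨E, hE⟩ : ∃ E : ℝ≥0∞, E = cchi n ^ (1 / 2 : ℝ) * D ^ (t / 2) := ⟨_, rfl⟩
  have hEf : E ≠ ∞ := by
    rw [hE]; exact ENNReal.mul_ne_top (ENNReal.rpow_ne_top_of_nonneg (by norm_num) hcf) hDf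
  refine ⟨K ^ (1 / 2 : ℝ) * L ^ (1 / p) * E ^ 2 * (cchi n ^ 2)⁻¹, ?_, fun {a} ha {f g} hf hfc hg hgc => ?_⟩
  · refine ENNReal.mul_ne_top (ENNReal.mul_ne_top (ENNReal.mul_ne_top ?_ ?_) (ENNReal.pow_ne_top hEf))
      (ENNReal.inv_ne_top.2 (pow_ne_zero 2 hc0))
    · exact ENNReal.rpow_ne_top_of_nonneg (by norm_num) hK
    · exact ENNReal.rpow_ne_top_of_nonneg (by positivity) hL
  have eX : ∀ f : Eu n → ℂ, eLpNorm f 2 volume = (∫⁻ x, ‖f x‖ₑ ^ 2) ^ (1 / 2 : ℝ) := fun f => by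
    rw [← eLpNorm_two_sq, ← ENNReal.rpow_natCast, ← ENNReal.rpow_mul]; norm_num
  rw [eX, eX]
  exact lam_alg hp ht hE hc0 hcf (lam_main n s hp ht hD ha hf hfc hg hgc (hKb ha) (hLb s ha))

theorem dList_comm2 {ι κ W F : Type*} [NormedAddCommGroup W] [NormedSpace ℝ W]
    [NormedAddCommGroup F] [NormedSpace ℝ F] (d : ι → W) (d' : κ → W) (l : List ι) (l' : List κ)
    {g : W → F} (hg : ContDiff ℝ (⊤ : ℕ∞) g) :
    dList d' l' (dList d l g) = dList d l (dList d' l' g) := by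
  induction l' with
  | nil => rfl
  | cons i l' ih => rw [dList_cons, dList_cons, ih, dLine_dList_comm _ _ _ (dList_contDiff l' hg)]

theorem op_cont {n : ℕ} {a : Eu n × Eu n → ℂ} (ha : Continuous a) {g : Eu n → ℂ} (hg : Continuous g)
    (hgc : HasCompactSupport g) : Continuous fun x : Eu n => ∫ ξ, osc ⟪x, ξ⟫ * a (x, ξ) * g ξ := by
  have hc := continuous_osc
  have h := continuous_parametric_integral_of_continuous (μ := (volume : Measure (Eu n)))
    (f := fun x ξ : Eu n => osc ⟪x, ξ⟫ * a (x, ξ) * g ξ) (by unfold Function.uncurry; fun_prop) hgc.isCompact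
  refine h.congr fun x => ?_
  refine setIntegral_eq_integral_of_forall_compl_eq_zero fun ξ hξ => ?_
  rw [image_eq_zero_of_notMem_tsupport hξ, mul_zero]

theorem op_bound (n s : ℕ) {p : ℝ} (hp : 2 ≤ p) (hs : n * (1 - 2 / p) < 2 * s) :
    ∃ C : ℝ≥0∞, C ≠ ∞ ∧ ∀ {a : Eu n × Eu n → ℂ}, ContDiff ℝ (⊤ : ℕ∞) a → ∀ {A : ℝ≥0∞}, A ≠ ∞ →
      (∀ l l' : List (Fin n), l.length ≤ s → l'.length ≤ s →
        eLpNorm (dList dY l' (dList dX l a)) (ENNReal.ofReal p) volume ≤ A) → ∀ {g : Eu n → ℂ},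
      Continuous g → HasCompactSupport g →
      eLpNorm (fun x : Eu n => ∫ ξ, osc ⟪x, ξ⟫ * a (x, ξ) * g ξ) 2 volume ≤ C * A * eLpNorm g 2 volume := by
  obtain ⟨C, hC, hCb⟩ := lam_bound n s hp hs
  obtain ⟨N, hN⟩ := SS_eLpNorm (n := n) s
  refine ⟨C * N, ENNReal.mul_ne_top hC (ENNReal.natCast_ne_top N), fun {a} ha {A} hA hl {g} hg hgc => ?_⟩
  have hp1 : 1 ≤ ENNReal.ofReal p := by rw [ENNReal.one_le_ofReal]; linarith
  have hS := hN ha hp1 hl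
  rw [eLpNorm_eq_lintegral_rpow_enorm_toReal (by positivity) ENNReal.ofReal_ne_top,
    ENNReal.toReal_ofReal (by linarith)] at hS
  have hgf := (cc_memLp hg hgc 2).2.ne
  have hfin : C * N * A * eLpNorm g 2 volume ≠ ∞ :=
    ENNReal.mul_ne_top (ENNReal.mul_ne_top (ENNReal.mul_ne_top hC (ENNReal.natCast_ne_top N)) hA) hgf
  refine le_trans (duality 0 (contDiff_zero.2 (op_cont ha.continuous hg hgc))
    (M := (C * N * A * eLpNorm g 2 volume).toReal) ENNReal.toReal_nonneg fun ψ hψ hψc => ?_)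
    ENNReal.ofReal_toReal_le
  have hψ0 : Continuous ψ := contDiff_zero.1 hψ
  have e : ∫ x : Eu n, (∫ ξ, osc ⟪x, ξ⟫ * a (x, ξ) * g ξ) * ψ x
      = ∫ q : Eu n × Eu n, osc ⟪q.1, q.2⟫ * a q * g q.2 * ψ q.1 := by
    have hac := ha.continuous
    have hco := continuous_osc
    have hc : Continuous fun q : Eu n × Eu n => osc ⟪q.1, q.2⟫ * a q * g q.2 * ψ q.1 := by fun_prop
    have hcc : HasCompactSupport fun q : Eu n × Eu n => osc ⟪q.1, q.2⟫ * a q * g q.2 * ψ q.1 := by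
      refine HasCompactSupport.intro (hψc.isCompact.prod hgc.isCompact) fun q hq => ?_
      by_contra h
      exact hq ⟨subset_tsupport _ fun h0 => h (by simp [h0]), subset_tsupport _ fun h0 => h (by simp [h0])⟩
    have hi := hc.integrable_of_hasCompactSupport (μ := volume) hcc
    rw [Measure.volume_eq_prod] at hi ⊢
    rw [integral_prod _ hi]
    congr 1; ext1 x
    rw [← integral_mul_const]
  rw [e]
  have h := hCb ha hψ0 hψc hg hgc
  have hψf := (cc_memLp hψ0 hψc 2).2.ne
  rw [← ENNReal.toReal_mul, ← toReal_enorm]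
  refine ENNReal.toReal_mono (ENNReal.mul_ne_top hfin hψf) (h.trans ?_)
  calc _ ≤ C * (N * A) * eLpNorm ψ 2 volume * eLpNorm g 2 volume := by gcongr
    _ = _ := by ring

theorem floor_cond (n : ℕ) (p : ℝ) :
    n * (1 - 2 / p) < 2 * ((Nat.floor ((n : ℝ) * (1 / 2 - 1 / p)) + 1 : ℕ) : ℝ) := by
  have := Nat.lt_floor_add_one ((n : ℝ) * (1 / 2 - 1 / p))
  push_cast
  have e : (n : ℝ) * (1 - 2 / p) = 2 * ((n : ℝ) * (1 / 2 - 1 / p)) := by ring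
  rw [e]; linarith

theorem op_eq {n : ℕ} (φ : Eu n × Eu n → ℝ) {a : Eu n × Eu n → ℂ} {K : Set (Eu n)}
    (hK : ∀ x ξ, ξ ∉ K → a (x, ξ) = 0) {c : Eu n → ℝ} (hc : ∀ ξ ∈ K, c ξ = 1) (u : Eu n → ℂ) (x : Eu n) :
    (∫ ξ, ∫ y, Complex.exp (Complex.I * ((⟪x, ξ⟫ + φ (y, ξ) : ℝ) : ℂ)) * a (x, ξ) * u y)
      = ∫ ξ, osc ⟪x, ξ⟫ * a (x, ξ) * ((c ξ : ℂ) * ∫ y, osc (φ (y, ξ)) * u y) := by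
  congr 1; ext1 ξ
  have e : ∀ y, Complex.exp (Complex.I * ((⟪x, ξ⟫ + φ (y, ξ) : ℝ) : ℂ)) * a (x, ξ) * u y
      = (osc ⟪x, ξ⟫ * a (x, ξ)) * (osc (φ (y, ξ)) * u y) := by
    intro y
    change osc (⟪x, ξ⟫ + φ (y, ξ)) * _ * _ = _
    rw [osc_add]; ring
  simp only [e]
  rw [integral_const_mul]
  by_cases h : ξ ∈ K
  · rw [hc ξ h]; simp
  · rw [hK x ξ h]; simp

theorem op_final (n : ℕ) (C₀ : ℝ) (hC₀ : 0 < C₀) (Cph : (Fin n → ℕ) → ℝ)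
    (p : ℝ) (hp2 : 2 ≤ p) (A : ℝ) :
    ∃ C : ℝ, 0 < C ∧
      ∀ (φ : Eu n × Eu n → ℝ) (a : Eu n × Eu n → ℂ) (K : Set (Eu n)), IsCompact K →
        ContDiff ℝ (⊤ : ℕ∞) φ →
        (∀ z, C₀ ≤ |Matrix.det (Matrix.of fun i j => mixedHessXY φ i j z)|) →
        (∀ i j : Fin n, ∀ α : Fin n → ℕ, mdeg α ≤ 2 * n + 1 →
          (∀ z, |mderiv dX α (mixedHessXY φ i j) z| ≤ Cph α) ∧
          (∀ z, |mderiv dY α (mixedHessXY φ i j) z| ≤ Cph α)) →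
        ContDiff ℝ (⊤ : ℕ∞) a →
        (∀ x ξ, ξ ∉ K → a (x, ξ) = 0) →
        (∀ α β : Fin n → ℕ,
          mdeg α ≤ Nat.floor ((n : ℝ) * (1 / 2 - 1 / p)) + 1 →
          mdeg β ≤ Nat.floor ((n : ℝ) * (1 / 2 - 1 / p)) + 1 →
          eLpNorm (mderiv dX α (mderiv dY β a)) (ENNReal.ofReal p) volume
            ≤ ENNReal.ofReal A) →
        ∀ u : 𝓢(Eu n, ℂ),
          eLpNorm (fun x => ∫ ξ, ∫ y,
              Complex.exp (Complex.I * ((⟪x, ξ⟫ + φ (y, ξ) : ℝ) : ℂ)) * a (x, ξ) * u y)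
              2 volume
            ≤ ENNReal.ofReal C * eLpNorm (⇑u) 2 volume := by
  obtain ⟨Cφ, hCφ, hgood⟩ := goodPhase_of_hyp n C₀ Cph
  obtain ⟨M, hM, hph⟩ := phase_schwartz n C₀ Cφ hC₀ hCφ
  obtain ⟨B, hB, hop⟩ := op_bound n (Nat.floor ((n : ℝ) * (1 / 2 - 1 / p)) + 1) hp2 (floor_cond n p)
  refine ⟨(B * ENNReal.ofReal A).toReal * M + 1, by positivity, ?_⟩
  intro φ a K hK hφ hdet hder ha hsupp hamp u
  obtain ⟨hFc, hFb⟩ := hph φ (hgood φ hφ hdet hder) u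
  obtain ⟨R, hR0, hR⟩ : ∃ R : ℝ, 0 < R ∧ ∀ ξ ∈ K, ‖ξ‖ ≤ R := hK.isBounded.exists_pos_norm_le
  obtain ⟨c, hc, hcc, hc0, hc1, hcR⟩ := exists_cut n R hR0
  simp only [op_eq φ hsupp (fun ξ hξ => hcR ξ (hR ξ hξ)) u]
  have hgcont : Continuous fun ξ => (c ξ : ℂ) * ∫ y, osc (φ (y, ξ)) * u y :=
    (Complex.continuous_ofReal.comp hc.continuous).mul hFc
  have hgcomp : HasCompactSupport fun ξ => (c ξ : ℂ) * ∫ y, osc (φ (y, ξ)) * u y :=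
    (hcc.comp_left (g := fun t : ℝ => (t : ℂ)) (by simp)).mul_right
  have hamp' : ∀ l l' : List (Fin n), l.length ≤ Nat.floor ((n : ℝ) * (1 / 2 - 1 / p)) + 1 →
      l'.length ≤ Nat.floor ((n : ℝ) * (1 / 2 - 1 / p)) + 1 →
      eLpNorm (dList dY l' (dList dX l a)) (ENNReal.ofReal p) volume ≤ ENNReal.ofReal A := by
    intro l l' hl hl'
    rw [dList_comm2 _ _ _ _ ha, dList_eq_mderiv dX l (dList_contDiff l' ha), dList_eq_mderiv dY l' ha]
    exact hamp _ _ (by rw [mdeg_count]; exact hl) (by rw [mdeg_count]; exact hl')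
  refine (hop ha ENNReal.ofReal_ne_top hamp' hgcont hgcomp).trans ?_
  have hg2 : eLpNorm (fun ξ => (c ξ : ℂ) * ∫ y, osc (φ (y, ξ)) * u y) 2 volume
      ≤ ENNReal.ofReal M * eLpNorm (⇑u) 2 volume := by
    refine le_trans (eLpNorm_mono fun ξ => ?_) hFb
    rw [norm_mul, Complex.norm_real, Real.norm_of_nonneg (hc0 ξ)]
    exact mul_le_of_le_one_left (norm_nonneg _) (hc1 ξ)
  have hBA : B * ENNReal.ofReal A ≠ ∞ := ENNReal.mul_ne_top hB ENNReal.ofReal_ne_top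
  calc _ ≤ B * ENNReal.ofReal A * (ENNReal.ofReal M * eLpNorm (⇑u) 2 volume) := by gcongr
    _ = ENNReal.ofReal ((B * ENNReal.ofReal A).toReal * M) * eLpNorm (⇑u) 2 volume := by
      rw [ENNReal.ofReal_mul ENNReal.toReal_nonneg, ENNReal.ofReal_toReal hBA]; ring
    _ ≤ _ := by gcongr; linarith

/-- `L²`-boundedness of `Tu(x) = ∫∫ e^{i(x·ξ+φ(y,ξ))} a(x,ξ) u(y) dy dξ`
when `∂_x^α ∂_ξ^β a ∈ L^p(ℝ^n × ℝ^n)` for `|α|, |β| ≤ ⌊n(1/2-1/p)⌋+1`, `2 ≤ p < ∞`,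
with constant depending only on `n`, `p`, `C₀`, the phase constants and the listed
`L^p` norms (bounded by `A`), independent of the compact set `K`. -/
theorem statement8 (n : ℕ) (C₀ : ℝ) (hC₀ : 0 < C₀) (Cph : (Fin n → ℕ) → ℝ)
    (p : ℝ) (hp2 : 2 ≤ p) (A : ℝ) :
    ∃ C : ℝ, 0 < C ∧
      ∀ (φ : EuclideanSpace ℝ (Fin n) × EuclideanSpace ℝ (Fin n) → ℝ)
        (a : EuclideanSpace ℝ (Fin n) × EuclideanSpace ℝ (Fin n) → ℂ)
        (K : Set (EuclideanSpace ℝ (Fin n))), IsCompact K →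
        ContDiff ℝ (⊤ : ℕ∞) φ →
        -- nondegeneracy of the mixed Hessian `∂_y∂_ξ φ`:
        (∀ z, C₀ ≤ |Matrix.det (Matrix.of fun i j => mixedHessXY φ i j z)|) →
        -- bounded derivatives of the entries of `∂_y∂_ξ φ`:
        (∀ i j : Fin n, ∀ α : Fin n → ℕ, mdeg α ≤ 2 * n + 1 →
          (∀ z, |mderiv dX α (mixedHessXY φ i j) z| ≤ Cph α) ∧
          (∀ z, |mderiv dY α (mixedHessXY φ i j) z| ≤ Cph α)) →
        ContDiff ℝ (⊤ : ℕ∞) a →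
        -- `a` vanishes for `ξ` outside the compact set `K`:
        (∀ x ξ, ξ ∉ K → a (x, ξ) = 0) →
        -- the derivatives of the amplitude of order `≤ ⌊n(1/2-1/p)⌋+1` lie in `L^p`,
        -- with `L^p` norms bounded by `A`:
        (∀ α β : Fin n → ℕ,
          mdeg α ≤ Nat.floor ((n : ℝ) * (1 / 2 - 1 / p)) + 1 →
          mdeg β ≤ Nat.floor ((n : ℝ) * (1 / 2 - 1 / p)) + 1 →
          eLpNorm (mderiv dX α (mderiv dY β a)) (ENNReal.ofReal p) volume
            ≤ ENNReal.ofReal A) →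
        ∀ u : 𝓢(EuclideanSpace ℝ (Fin n), ℂ),
          eLpNorm (fun x => ∫ ξ, ∫ y,
              Complex.exp (Complex.I * ((⟪x, ξ⟫ + φ (y, ξ) : ℝ) : ℂ)) * a (x, ξ) * u y)
              2 volume
            ≤ ENNReal.ofReal C * eLpNorm (⇑u) 2 volume := by
  exact op_final n C₀ hC₀ Cph p hp2 A
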